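/- For every ε > 0 there exist η > 0 and n₀ ∈ ℕ such that for all n ≥ n₀ the following holds: every edge-colouring of the complete graph K_n that is (1−ε)n/2-bounded and locally ηn/(log n)⁴-bounded admits, for every integer ℓ with 3 ≤ ℓ ≤ n, a rainbow cycle of length ℓ in K_n. -/

import Mathlib

namespace Paper

variable {V : Type*} {W : Type*} {C : Type*}

/-- The set of edges of `G` receiving colour `c` under `φ`. -/
def colourCls (G : SimpleGraph V) (φ : Sym2 V → C) (c : C) : Set (Sym2 V) :=
  {e | e ∈ G.edgeSet ∧ φ e = c}

/-- `φ` is a (globally) `g`-bounded edge-colouring of `G`: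
every colour is used on at most `g` edges. -/
def GBounded (G : SimpleGraph V) (φ : Sym2 V → C) (g : ℝ) : Prop :=
  ∀ c : C, ((colourCls G φ c).ncard : ℝ) ≤ g

/-- `φ` is a locally `l`-bounded edge-colouring of `G`:
every vertex is incident to at most `l` edges of each colour. -/
def LBounded (G : SimpleGraph V) (φ : Sym2 V → C) (l : ℝ) : Prop :=
  ∀ (v : V) (c : C), (({u | G.Adj v u ∧ φ s(v, u) = c}).ncard : ℝ) ≤ l

/-- A set of edges is rainbow if the colouring is injective on it. -/
def Rainbow (φ : Sym2 V → C) (E : Set (Sym2 V)) : Prop :=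
  Set.InjOn φ E

/-- The set of common neighbours `w` of `u` and `v` with `φ(uw) = φ(vw)`. -/
def monoSet (G : SimpleGraph V) (φ : Sym2 V → C) (u v : V) : Set V :=
  {w | G.Adj u w ∧ G.Adj v w ∧ φ s(u, w) = φ s(v, w)}

/-- The monochromatic codegree `c^φ_G(u,v)`. -/
noncomputable def monoCodeg (G : SimpleGraph V) (φ : Sym2 V → C) (u v : V) : ℕ :=
  (monoSet G φ u v).ncard

/-- Degree of `u` into the set `S`. -/
noncomputable def degIn (G : SimpleGraph V) (u : V) (S : Set V) : ℕ :=
  (G.neighborSet u ∩ S).ncard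

/-- Codegree of `u,v` into the set `S`. -/
noncomputable def codegIn (G : SimpleGraph V) (u v : V) (S : Set V) : ℕ :=
  (G.neighborSet u ∩ G.neighborSet v ∩ S).ncard

/-- `G` restricted to `S` is `(ε,d)`-quasirandom: all degrees (within `S`)
are `(d ± ε)|S|` and all but at most `ε|S|²` unordered pairs of distinct
vertices of `S` have codegree (within `S`) equal to `(d² ± ε)|S|`. -/
def QuasirandomOn (G : SimpleGraph V) (S : Set V) (ε d : ℝ) : Prop :=
  (∀ v ∈ S, |(degIn G v S : ℝ) - d * S.ncard| ≤ ε * S.ncard) ∧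
  ((({p : Sym2 V | ∃ u v, p = s(u, v) ∧ u ≠ v ∧ u ∈ S ∧ v ∈ S ∧
        ¬ (|(codegIn G u v S : ℝ) - d ^ 2 * S.ncard| ≤ ε * S.ncard)}).ncard : ℝ)
      ≤ ε * (S.ncard : ℝ) ^ 2)

/-- `G` is `(ε,d)`-quasirandom. -/
def Quasirandom (G : SimpleGraph V) (ε d : ℝ) : Prop :=
  QuasirandomOn G Set.univ ε d

/-- Edges of `G` with one endpoint in `X` and the other in `Y`. -/
def edgesBetween (G : SimpleGraph V) (X Y : Set V) : Set (Sym2 V) :=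
  {e | e ∈ G.edgeSet ∧ ∃ u v, e = s(u, v) ∧ u ∈ X ∧ v ∈ Y}

/-- The pair `(A,B)` is `(ε,d)`-regular in `G`. -/
def RegularPair (G : SimpleGraph V) (A B : Set V) (ε d : ℝ) : Prop :=
  ∀ X ⊆ A, ∀ Y ⊆ B, ε * A.ncard ≤ (X.ncard : ℝ) → ε * B.ncard ≤ (Y.ncard : ℝ) →
    |((edgesBetween G X Y).ncard : ℝ) / ((X.ncard : ℝ) * (Y.ncard : ℝ)) - d| ≤ ε

/-- The pair `(A,B)` is `(ε,d)`-superregular in `G`. -/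
def SuperregularPair (G : SimpleGraph V) (A B : Set V) (ε d : ℝ) : Prop :=
  RegularPair G A B ε d ∧
  (∀ u ∈ A, |(degIn G u B : ℝ) - d * B.ncard| ≤ ε * B.ncard) ∧
  (∀ v ∈ B, |(degIn G v A : ℝ) - d * A.ncard| ≤ ε * A.ncard)

/-- `H` is a copy of `F`: a subgraph of `G` isomorphic to `F`. -/
def IsCopy (F : SimpleGraph W) {G : SimpleGraph V} (H : G.Subgraph) : Prop :=
  Nonempty (F ≃g H.coe)

/-- `L` is the union of the family `𝒞` of pairwise vertex-disjoint copies of `F`. -/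
def IsFactorFrom (F : SimpleGraph W) {G : SimpleGraph V} (L : G.Subgraph)
    (𝒞 : Set G.Subgraph) : Prop :=
  (∀ H ∈ 𝒞, IsCopy F H) ∧
  𝒞.Pairwise (fun H₁ H₂ => Disjoint H₁.verts H₂.verts) ∧
  L = sSup 𝒞

/-- `L` consists of vertex-disjoint copies of `F`. -/
def IsFFactorSub (F : SimpleGraph W) {G : SimpleGraph V} (L : G.Subgraph) : Prop :=
  ∃ 𝒞 : Set G.Subgraph, IsFactorFrom F L 𝒞

/-- An `ε`-decomposition: pairwise edge-disjoint subgraphs of `G` which together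
contain all but at most an `ε`-proportion of the edges of `G`. -/
def ApxDecomp (G : SimpleGraph V) (ε : ℝ) {t : ℕ} (L : Fin t → G.Subgraph) : Prop :=
  (Pairwise fun i j => Disjoint (L i).edgeSet (L j).edgeSet) ∧
  ((G.edgeSet \ ⋃ i, (L i).edgeSet).ncard : ℝ) ≤ ε * (G.edgeSet.ncard : ℝ)

/-- `a(F) ≤ a`, where `a(F) = max {Δ(F), a'(F), a''(F)}`. -/
def AParamLe (F : SimpleGraph W) (a : ℕ) : Prop :=
  (∀ v, (F.neighborSet v).ncard ≤ a) ∧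
  (∀ u v, F.Adj u v →
    (F.neighborSet u).ncard + (F.neighborSet v).ncard - 2 ≤ a) ∧
  (∀ u v w, F.Adj u v → F.Adj v w → u ≠ w →
    (F.neighborSet u).ncard + (F.neighborSet v).ncard + (F.neighborSet w).ncard - 4 ≤ a)

end Paper

open Paper

section

open Finset

section RainbowLists

variable {V : Type*}

/-- A nonempty list chained by `R ⊆ ≠` is the support of a walk in the complete graph whose darts
all satisfy `R`. -/
lemma exists_walk_of_isChain {R : V → V → Prop} (hR : ∀ a b, R a b → a ≠ b) :
    ∀ (t : List V) (a : V), (a :: t).IsChain R →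
      ∃ (b : V) (p : (⊤ : SimpleGraph V).Walk a b), p.support = a :: t ∧
        b = (a :: t).getLast (by simp) ∧ ∀ d ∈ p.darts, R d.fst d.snd
  | [], a, _ => ⟨a, .nil, by simp⟩
  | c :: t, a, h => by
    rw [List.isChain_cons_cons] at h
    obtain ⟨b, p, hp, hb, hd⟩ := exists_walk_of_isChain hR t c h.2
    refine ⟨b, .cons (hR _ _ h.1 : (⊤ : SimpleGraph V).Adj a c) p, by simp [hp], by simpa using hb, ?_⟩
    intro d hd'
    rw [SimpleGraph.Walk.darts_cons, List.mem_cons] at hd'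
    rcases hd' with rfl | hd'
    · exact h.1
    · exact hd d hd'

/-- A duplicate-free list whose cyclically consecutive pairs satisfy `R`, where the colouring is
injective on pairs satisfying `R`, gives a rainbow cycle. -/
lemma exists_rainbow_cycle_of_list {C : Type*} {R : V → V → Prop} (φ : Sym2 V → C)
    (hR : ∀ a b, R a b → a ≠ b)
    (hinj : ∀ a b c d, R a b → R c d → φ s(a, b) = φ s(c, d) → a = c)
    (l : List V) (hne : l ≠ []) (hl : l.Nodup) (hlen : 3 ≤ l.length) (hc : l.IsChain R)
    (hlast : R (l.getLast hne) (l.head hne)) :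
    ∃ (v : V) (w : (⊤ : SimpleGraph V).Walk v v),
      w.IsCycle ∧ w.length = l.length ∧ (w.edges.map φ).Nodup := by
  obtain ⟨a, t, rfl⟩ := List.exists_cons_of_ne_nil hne
  obtain ⟨b, p, hp, hb, hd⟩ := exists_walk_of_isChain hR t a hc
  rw [← hb, List.head_cons] at hlast
  have hadj : (⊤ : SimpleGraph V).Adj b a := hR _ _ hlast
  have hdR : ∀ d ∈ (SimpleGraph.Walk.cons hadj p).darts, R d.fst d.snd := by
    intro d hd'
    rw [SimpleGraph.Walk.darts_cons, List.mem_cons] at hd'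
    rcases hd' with rfl | hd'
    · exact hlast
    · exact hd d hd'
  have hlenp : p.length + 1 = (a :: t).length := by rw [← hp, SimpleGraph.Walk.length_support]
  have hfst : ((SimpleGraph.Walk.cons hadj p).darts.map (·.fst)).Nodup := by
    rw [SimpleGraph.Walk.map_fst_darts, SimpleGraph.Walk.support_cons,
      List.dropLast_cons_of_ne_nil (by simp)]
    have h1 : p.support = p.support.dropLast ++ [b] := by
      conv_lhs => rw [← List.dropLast_append_getLast (l := p.support) (by simp)]
      simp
    have h2 : p.support.Nodup := hp ▸ hl
    rw [h1] at h2
    have h3 := List.nodup_append_comm.mp h2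
    simpa using h3
  have hcol : ((SimpleGraph.Walk.cons hadj p).edges.map φ).Nodup := by
    rw [SimpleGraph.Walk.edges, List.map_map]
    refine List.Nodup.map_on ?_ (List.Nodup.of_map _ hfst)
    intro x hx y hy hxy
    apply List.inj_on_of_nodup_map hfst hx hy
    exact hinj _ _ _ _ (hdR x hx) (hdR y hy) hxy
  refine ⟨b, .cons hadj p, ?_, by simpa using hlenp, hcol⟩
  rw [SimpleGraph.Walk.cons_isCycle_iff]
  refine ⟨by rw [SimpleGraph.Walk.isPath_def, hp]; exact hl, ?_⟩
  have := List.Nodup.of_map _ hcol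
  rw [SimpleGraph.Walk.edges_cons, List.nodup_cons] at this
  exact this.1

end RainbowLists

section Transversal

variable {ι β : Type*} [Fintype ι] [DecidableEq ι]

open Classical in
/-- Conflict-free choice functions on `S`, taking the default value `b₀` off `S`. -/
noncomputable def conflictFree (U : ι → Finset β) (R : ι → β → ι → β → Prop) (b₀ : β)
    (S : Finset ι) : Finset (ι → β) :=
  (Fintype.piFinset fun i => if i ∈ S then U i else {b₀}).filter
    fun f => ∀ i ∈ S, ∀ j ∈ S, i ≠ j → ¬ R i (f i) j (f j)

lemma mem_conflictFree {U : ι → Finset β} {R : ι → β → ι → β → Prop} {b₀ : β} {S : Finset ι}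
    {f : ι → β} : f ∈ conflictFree U R b₀ S ↔ (∀ i ∈ S, f i ∈ U i) ∧ (∀ i ∉ S, f i = b₀) ∧
      ∀ i ∈ S, ∀ j ∈ S, i ≠ j → ¬ R i (f i) j (f j) := by
  classical
  rw [conflictFree, mem_filter, Fintype.mem_piFinset, ← and_assoc]
  refine and_congr_left fun _ => ⟨fun h => ⟨fun i hi => by simpa [hi] using h i,
    fun i hi => by simpa [hi] using h i⟩, fun h i => ?_⟩
  by_cases hi : i ∈ S
  · simpa [hi] using h.1 i hi
  · simpa [hi] using h.2 i hi

lemma card_conflictFree_fiber_le (U : ι → Finset β) (R : ι → β → ι → β → Prop) (b₀ : β)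
    (S : Finset ι) (j : ι) (hj : j ∈ S) (b : β) [DecidableEq β] :
    #((conflictFree U R b₀ S).filter fun f => f j = b) ≤ #(conflictFree U R b₀ (S.erase j)) := by
  refine card_le_card_of_injOn (fun f => Function.update f j b₀) ?_ ?_
  · intro f hf
    simp only [coe_filter, Set.mem_ofPred_eq, mem_conflictFree, mem_coe] at hf ⊢
    refine ⟨fun i hi => ?_, fun i hi => ?_, fun i hi k hk hik => ?_⟩
    · rw [mem_erase] at hi
      rw [Function.update_of_ne hi.1]
      exact hf.1.1 i hi.2
    · by_cases hij : i = j
      · subst hij; simp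
      · rw [Function.update_of_ne hij]
        exact hf.1.2.1 i (by simpa [hij] using hi)
    · rw [mem_erase] at hi hk
      rw [Function.update_of_ne hi.1, Function.update_of_ne hk.1]
      exact hf.1.2.2 i hi.2 k hk.2 hik
  · intro f hf g hg hfg
    simp only [coe_filter, Set.mem_ofPred_eq] at hf hg
    ext i
    by_cases hij : i = j
    · subst hij; rw [hf.2, hg.2]
    · have := congrFun hfg i
      simpa [Function.update_of_ne hij] using this

open Classical in
/-- A weighted version of the local lemma: if each option conflicts with at most a quarter of the
options elsewhere, counted proportionally, then a conflict-free choice exists. -/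
lemma exists_conflictFree (U : ι → Finset β) (R : ι → β → ι → β → Prop) (b₀ : β)
    (hsymm : ∀ i b j b', R i b j b' → R j b' i b)
    (S : Finset ι) (hne : ∀ i ∈ S, (U i).Nonempty)
    (hR : ∀ i ∈ S, ∀ b ∈ U i,
      ∑ j ∈ S.erase i, (#((U j).filter fun b' => R i b j b') : ℝ) / #(U j) ≤ 1 / 4) :
    ∃ f : ι → β, (∀ i ∈ S, f i ∈ U i) ∧ ∀ i ∈ S, ∀ j ∈ S, i ≠ j → ¬ R i (f i) j (f j) := by
  have key : ∀ m : ℕ, ∀ T ⊆ S, #T = m → ∀ i ∈ S, i ∉ T →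
      (#(U i) : ℝ) * #(conflictFree U R b₀ T) ≤ 2 * #(conflictFree U R b₀ (insert i T)) := by
    intro m
    induction m using Nat.strong_induction_on with
    | _ m ih =>
    intro T hT hm i hi hiT
    set G := conflictFree U R b₀ T with hG
    set bad : ι → Finset (β × (ι → β)) := fun j =>
      ((U i) ×ˢ G).filter fun x => R i x.1 j (x.2 j) with hbad
    set good := ((U i) ×ˢ G).filter fun x => ∀ j ∈ T, ¬ R i x.1 j (x.2 j) with hgood
    have h1 : #good ≤ #(conflictFree U R b₀ (insert i T)) := by
      refine card_le_card_of_injOn (fun x => Function.update x.2 i x.1) ?_ ?_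
      · rintro ⟨b, f⟩ hx
        simp only [hgood, hG, coe_filter, mem_product, mem_conflictFree, Set.mem_ofPred_eq,
          mem_coe] at hx ⊢
        obtain ⟨⟨hb, hf1, hf2, hf3⟩, hf4⟩ := hx
        have hne' : ∀ k ∈ T, k ≠ i := fun k hk h => hiT (h ▸ hk)
        refine ⟨fun k hk => ?_, fun k hk => ?_, fun k hk k' hk' hkk => ?_⟩
        · rcases mem_insert.1 hk with rfl | hk
          · simpa using hb
          · rw [Function.update_of_ne (hne' k hk)]; exact hf1 k hk
        · rw [mem_insert, not_or] at hk
          rw [Function.update_of_ne hk.1]; exact hf2 k hk.2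
        · rcases mem_insert.1 hk with hki | hkT <;> rcases mem_insert.1 hk' with hki' | hkT'
          · exact absurd (hki.trans hki'.symm) hkk
          · subst hki
            rw [Function.update_of_ne (hne' k' hkT')]; simpa using hf4 k' hkT'
          · subst hki'
            rw [Function.update_of_ne (hne' k hkT)]
            intro h
            exact hf4 k hkT (hsymm _ _ _ _ (by simpa using h))
          · rw [Function.update_of_ne (hne' k hkT), Function.update_of_ne (hne' k' hkT')]
            exact hf3 k hkT k' hkT' hkk
      · rintro ⟨b, f⟩ hx ⟨b', f'⟩ hx' h
        simp only [hgood, hG, coe_filter, mem_product, mem_conflictFree, Set.mem_ofPred_eq]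
          at hx hx' h
        have hb : b = b' := by simpa using congrFun h i
        refine Prod.ext hb (funext fun k => ?_)
        by_cases hk : k = i
        · subst hk
          change f k = f' k
          rw [hx.1.2.2.1 k hiT, hx'.1.2.2.1 k hiT]
        · simpa [Function.update_of_ne hk] using congrFun h k
    have h2 : #((U i) ×ˢ G) ≤ #good + ∑ j ∈ T, #(bad j) := by
      calc #((U i) ×ˢ G) ≤ #(good ∪ T.biUnion bad) := by
            refine card_le_card fun x hx => ?_
            by_cases hx' : ∀ j ∈ T, ¬ R i x.1 j (x.2 j)
            · exact mem_union_left _ (mem_filter.2 ⟨hx, hx'⟩)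
            · push Not at hx'
              obtain ⟨j, hj, hj'⟩ := hx'
              exact mem_union_right _ (mem_biUnion.2 ⟨j, hj, mem_filter.2 ⟨hx, hj'⟩⟩)
        _ ≤ _ := (card_union_le _ _).trans (by gcongr; exact card_biUnion_le)
    have h3 : ∀ j ∈ T, (#(bad j) : ℝ) ≤
        ∑ b ∈ U i, (#((U j).filter fun b' => R i b j b') : ℝ) / #(U j) * (2 * #G) := by
      intro j hj
      have hUj : (0 : ℝ) < #(U j) := by exact_mod_cast (hne j (hT hj)).card_pos
      have ha : #(bad j) ≤ ∑ b ∈ U i, ∑ b' ∈ (U j).filter (fun b' => R i b j b'),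
          #(G.filter fun f => f j = b') := by
        have : bad j ⊆ (U i).biUnion fun b => ((U j).filter fun b' => R i b j b').biUnion fun b' =>
            (G.filter fun f => f j = b').image fun f => (b, f) := by
          rintro ⟨b, f⟩ hx
          simp only [hbad, mem_filter, mem_product] at hx
          simp only [mem_biUnion, mem_image, mem_filter]
          exact ⟨b, hx.1.1, f j, ⟨(mem_conflictFree.1 hx.1.2).1 j hj, hx.2⟩, f, ⟨hx.1.2, rfl⟩, rfl⟩
        refine (card_le_card this).trans (card_biUnion_le.trans (sum_le_sum fun b _ =>
          card_biUnion_le.trans (sum_le_sum fun b' _ => card_image_le)))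
      have hb : ∀ b', (#(G.filter fun f => f j = b') : ℝ) ≤ 2 * #G / #(U j) := by
        intro b'
        have h4 := ih #(T.erase j) (by rw [← hm]; exact card_erase_lt_of_mem hj) (T.erase j)
          ((erase_subset _ _).trans hT) rfl j (hT hj) (notMem_erase _ _)
        rw [insert_erase hj] at h4
        have h5 : (#(G.filter fun f => f j = b') : ℝ) ≤ #(conflictFree U R b₀ (T.erase j)) := by
          exact_mod_cast card_conflictFree_fiber_le U R b₀ T j hj b'
        rw [le_div_iff₀ hUj]
        nlinarith
      calc (#(bad j) : ℝ) ≤ ∑ b ∈ U i, ∑ b' ∈ (U j).filter (fun b' => R i b j b'),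
          (#(G.filter fun f => f j = b') : ℝ) := by exact_mod_cast ha
        _ ≤ ∑ b ∈ U i, ∑ b' ∈ (U j).filter (fun b' => R i b j b'), 2 * (#G : ℝ) / #(U j) :=
          sum_le_sum fun b _ => sum_le_sum fun b' _ => hb b'
        _ = _ := by
          refine sum_congr rfl fun b _ => ?_
          rw [sum_const, nsmul_eq_mul]; ring
    have h4 : ∑ j ∈ T, (#(bad j) : ℝ) ≤ (#(U i) : ℝ) * #G / 2 := by
      calc ∑ j ∈ T, (#(bad j) : ℝ) ≤ ∑ j ∈ T, ∑ b ∈ U i,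
            (#((U j).filter fun b' => R i b j b') : ℝ) / #(U j) * (2 * #G) := sum_le_sum h3
        _ = ∑ b ∈ U i, (∑ j ∈ T, (#((U j).filter fun b' => R i b j b') : ℝ) / #(U j)) * (2 * #G) := by
            rw [sum_comm]; simp_rw [sum_mul]
        _ ≤ ∑ b ∈ U i, (1 / 4 : ℝ) * (2 * #G) := by
            refine sum_le_sum fun b hb => mul_le_mul_of_nonneg_right ?_ (by positivity)
            refine (sum_le_sum_of_subset_of_nonneg (fun j hj => mem_erase.2
              ⟨by rintro rfl; exact hiT hj, hT hj⟩) fun _ _ _ => by positivity).trans (hR i hi b hb)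
        _ = _ := by rw [sum_const, nsmul_eq_mul]; ring
    have h2' : (#(U i) : ℝ) * #G ≤ #good + ∑ j ∈ T, (#(bad j) : ℝ) := by
      rw [card_product] at h2; exact_mod_cast h2
    have h1' : (#good : ℝ) ≤ #(conflictFree U R b₀ (insert i T)) := by exact_mod_cast h1
    linarith
  have pos : ∀ T ⊆ S, 0 < #(conflictFree U R b₀ T) := by
    intro T
    induction T using Finset.induction_on with
    | empty => exact fun _ => card_pos.2 ⟨fun _ => b₀, mem_conflictFree.2 (by simp)⟩
    | insert i T hiT ih =>
      intro hT
      have h1 := ih ((subset_insert _ _).trans hT)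
      have h2 := key _ T ((subset_insert _ _).trans hT) rfl i (hT (mem_insert_self _ _)) hiT
      have h3 := (hne i (hT (mem_insert_self _ _))).card_pos
      have : (0 : ℝ) < #(U i) * #(conflictFree U R b₀ T) := by positivity
      have : (0 : ℝ) < #(conflictFree U R b₀ (insert i T)) := by linarith
      exact_mod_cast this
  obtain ⟨f, hf⟩ := card_pos.1 (pos S subset_rfl)
  rw [mem_conflictFree] at hf
  exact ⟨f, hf.1, hf.2.2⟩

open Classical in
/-- Resource version: options use finitely many resources, and each resource is used only by a small
proportion of the options. -/
lemma exists_disjoint_choice {ρ : Type*} (U : ι → Finset β) (res : ι → β → Finset ρ)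
    (b₀ : β) (S : Finset ι) (hne : ∀ i ∈ S, (U i).Nonempty) (hcard : ∀ i b, #(res i b) ≤ 5)
    (hload : ∀ r, ∑ j ∈ S, (#((U j).filter fun b => r ∈ res j b) : ℝ) / #(U j) ≤ 1 / 20) :
    ∃ f : ι → β, (∀ i ∈ S, f i ∈ U i) ∧
      ∀ i ∈ S, ∀ j ∈ S, i ≠ j → Disjoint (res i (f i)) (res j (f j)) := by
  have hR : ∀ i ∈ S, ∀ b ∈ U i, ∑ j ∈ S.erase i,
      (#((U j).filter fun b' => ¬ Disjoint (res i b) (res j b')) : ℝ) / #(U j) ≤ 1 / 4 := by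
    intro i _ b _
    calc ∑ j ∈ S.erase i, (#((U j).filter fun b' => ¬ Disjoint (res i b) (res j b')) : ℝ) / #(U j)
        ≤ ∑ j ∈ S, (#((U j).filter fun b' => ¬ Disjoint (res i b) (res j b')) : ℝ) / #(U j) :=
          sum_le_sum_of_subset_of_nonneg (erase_subset _ _) fun _ _ _ => by positivity
      _ ≤ ∑ j ∈ S, ∑ r ∈ res i b, (#((U j).filter fun b' => r ∈ res j b') : ℝ) / #(U j) := by
          refine sum_le_sum fun j _ => ?_
          rw [← sum_div]
          refine div_le_div_of_nonneg_right ?_ (by positivity)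
          have : (U j).filter (fun b' => ¬ Disjoint (res i b) (res j b')) ⊆
              (res i b).biUnion fun r => (U j).filter fun b' => r ∈ res j b' := by
            intro b' hb'
            rw [mem_filter, not_disjoint_iff] at hb'
            obtain ⟨h1, r, h2, h3⟩ := hb'
            exact mem_biUnion.2 ⟨r, h2, mem_filter.2 ⟨h1, h3⟩⟩
          exact_mod_cast (card_le_card this).trans card_biUnion_le
      _ = ∑ r ∈ res i b, ∑ j ∈ S, (#((U j).filter fun b' => r ∈ res j b') : ℝ) / #(U j) := sum_comm
      _ ≤ ∑ r ∈ res i b, (1 / 20 : ℝ) := sum_le_sum fun r _ => hload r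
      _ ≤ 1 / 4 := by
          rw [sum_const, nsmul_eq_mul]
          have : (#(res i b) : ℝ) ≤ 5 := by exact_mod_cast hcard i b
          linarith
  obtain ⟨f, hf, hf'⟩ := exists_conflictFree U
    (fun i b j b' => ¬ Disjoint (res i b) (res j b')) b₀ (fun i b j b' h h' => h h'.symm) S hne
    fun i hi b hb => by convert hR i hi b hb
  exact ⟨f, hf, fun i hi j hj hij => not_not.1 (hf' i hi j hj hij)⟩

end Transversal

section RandomSubset

variable {V : Type*} [Fintype V] [DecidableEq V]

/-- Exponential moment method for a random subset where each element is kept with probability `ζ`. -/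
lemma exists_subset_sum_le {κ : Type*} [Fintype κ] (ζ : ℝ) (h0 : 0 ≤ ζ) (h1 : ζ ≤ 1)
    (x : κ → V → ℝ) (hx : ∀ t v, |x t v| ≤ 1) (a : κ → ℝ)
    (h : ∑ t, Real.exp (ζ * ∑ v, (x t v + x t v ^ 2) - a t) < 1) :
    ∃ S : Finset V, ∀ t, ∑ v ∈ S, x t v ≤ a t := by
  by_contra! hcon
  set wt : Finset V → ℝ := fun S => (∏ _v ∈ S, ζ) * ∏ _v ∈ univ \ S, (1 - ζ) with hwt
  have wt_nonneg : ∀ S, 0 ≤ wt S := fun S =>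
    mul_nonneg (prod_nonneg fun _ _ => h0) (prod_nonneg fun _ _ => by linarith)
  have total : ∑ S ∈ univ.powerset, wt S = 1 := by
    rw [hwt, ← prod_add]; simp
  have moment : ∀ t, ∑ S ∈ univ.powerset, wt S * Real.exp (∑ v ∈ S, x t v - a t) ≤
      Real.exp (ζ * ∑ v, (x t v + x t v ^ 2) - a t) := by
    intro t
    have e1 : ∀ S : Finset V, wt S * Real.exp (∑ v ∈ S, x t v - a t) =
        ((∏ v ∈ S, ζ * Real.exp (x t v)) * ∏ _v ∈ univ \ S, (1 - ζ)) * Real.exp (-a t) := by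
      intro S
      rw [sub_eq_add_neg, Real.exp_add, Real.exp_sum, prod_mul_distrib]; ring
    rw [sum_congr rfl fun S _ => e1 S, ← sum_mul, ← prod_add, sub_eq_add_neg (ζ * _), Real.exp_add]
    gcongr
    rw [mul_sum, Real.exp_sum]
    refine prod_le_prod (fun v _ => by have := Real.exp_pos (x t v); nlinarith) fun v _ => ?_
    have h3 := Real.abs_exp_sub_one_sub_id_le (hx t v)
    have h4 := Real.add_one_le_exp (ζ * (x t v + x t v ^ 2))
    have h5 := (abs_le.1 h3).2
    nlinarith
  have : (1 : ℝ) ≤ ∑ t, Real.exp (ζ * ∑ v, (x t v + x t v ^ 2) - a t) := by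
    calc (1 : ℝ) = ∑ S ∈ univ.powerset, wt S := total.symm
      _ ≤ ∑ S ∈ univ.powerset, wt S * ∑ t, Real.exp (∑ v ∈ S, x t v - a t) := by
          refine sum_le_sum fun S _ => ?_
          obtain ⟨t, ht⟩ := hcon S
          have : 1 ≤ ∑ t, Real.exp (∑ v ∈ S, x t v - a t) :=
            (Real.one_le_exp (by linarith : 0 ≤ ∑ v ∈ S, x t v - a t)).trans
              (single_le_sum (f := fun t => Real.exp (∑ v ∈ S, x t v - a t))
                (fun _ _ => (Real.exp_pos _).le) (mem_univ t))
          nlinarith [wt_nonneg S]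
      _ = ∑ t, ∑ S ∈ univ.powerset, wt S * Real.exp (∑ v ∈ S, x t v - a t) := by
          simp_rw [mul_sum]; rw [sum_comm]
      _ ≤ _ := sum_le_sum fun t _ => moment t
  linarith

/-- A random subset of density about `ζ` carries at most twice its share of each of the bounded
weights `d t`. -/
lemma exists_subset_balanced {κ : Type*} [Fintype κ] (ζ Δ : ℝ) (h0 : 0 ≤ ζ) (h1 : ζ ≤ 1)
    (hΔ : 0 < Δ) (d : κ → V → ℝ) (hd0 : ∀ t v, 0 ≤ d t v) (hdΔ : ∀ t v, d t v ≤ Δ)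
    (hd : ∀ t, ∑ v, d t v ≤ Fintype.card V)
    (hsmall : Fintype.card κ * Real.exp (-(ζ * Fintype.card V / (4 * Δ))) +
      2 * Real.exp (-(ζ * Fintype.card V / 16)) < 1) :
    ∃ Z : Finset V, ζ * Fintype.card V / 2 ≤ #Z ∧ #Z ≤ 2 * ζ * Fintype.card V ∧
      ∀ t, ∑ z ∈ Z, d t z ≤ 2 * ζ * Fintype.card V := by
  set n : ℝ := (Fintype.card V : ℝ) with hn
  have hn0 : 0 ≤ n := by positivity
  set x : κ ⊕ Bool → V → ℝ := Sum.elim (fun t v => d t v / (2 * Δ))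
    fun b _ => if b then 1 / 2 else -(1 / 4) with hx
  set a : κ ⊕ Bool → ℝ := Sum.elim (fun _ => ζ * n / Δ)
    fun b => if b then ζ * n else -(ζ * n / 8) with ha
  have hbd : ∀ t v, 0 ≤ d t v / (2 * Δ) ∧ d t v / (2 * Δ) ≤ 1 / 2 := fun t v =>
    ⟨div_nonneg (hd0 t v) (by positivity), by
      rw [div_le_iff₀ (by positivity)]; linarith [hdΔ t v]⟩
  have hx1 : ∀ t v, |x t v| ≤ 1 := by
    rintro (t | b) v
    · simp only [hx, Sum.elim_inl]
      rw [abs_le]; constructor <;> linarith [hbd t v]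
    · cases b <;> simp [hx] <;> norm_num [abs_le]
  have hlt : ∑ t, Real.exp (ζ * ∑ v, (x t v + x t v ^ 2) - a t) < 1 := by
    rw [Fintype.sum_sum_type, Fintype.sum_bool]
    refine lt_of_le_of_lt ?_ hsmall
    have e1 : ∀ t, Real.exp (ζ * ∑ v, (x (.inl t) v + x (.inl t) v ^ 2) - a (.inl t)) ≤
        Real.exp (-(ζ * n / (4 * Δ))) := by
      intro t
      refine Real.exp_le_exp.2 ?_
      have : ∑ v, (x (.inl t) v + x (.inl t) v ^ 2) ≤ 3 / (4 * Δ) * n := by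
        calc ∑ v, (x (.inl t) v + x (.inl t) v ^ 2) ≤ ∑ v, 3 / (4 * Δ) * d t v := by
              refine sum_le_sum fun v _ => ?_
              simp only [hx, Sum.elim_inl]
              have h3 := hbd t v
              have h4 : 3 / (4 * Δ) * d t v = d t v / (2 * Δ) + d t v / (2 * Δ) * (1 / 2) := by
                field_simp; ring
              rw [h4]
              nlinarith
          _ ≤ _ := by
              rw [← mul_sum]
              exact mul_le_mul_of_nonneg_left (hd t) (by positivity)
      have h3 : ζ * (3 / (4 * Δ) * n) - ζ * n / Δ = -(ζ * n / (4 * Δ)) := by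
        field_simp; ring
      have := mul_le_mul_of_nonneg_left this h0
      simp only [ha, Sum.elim_inl]
      linarith
    have e2 : Real.exp (ζ * ∑ v, (x (.inr true) v + x (.inr true) v ^ 2) - a (.inr true)) ≤
        Real.exp (-(ζ * n / 16)) := by
      refine Real.exp_le_exp.2 ?_
      simp [hx, ha, ← hn]
      nlinarith [mul_nonneg h0 hn0]
    have e3 : Real.exp (ζ * ∑ v, (x (.inr false) v + x (.inr false) v ^ 2) - a (.inr false)) ≤
        Real.exp (-(ζ * n / 16)) := by
      refine Real.exp_le_exp.2 ?_
      simp [hx, ha, ← hn]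
      nlinarith [mul_nonneg h0 hn0]
    have := sum_le_sum fun t (_ : t ∈ univ) => e1 t
    rw [sum_const, nsmul_eq_mul, card_univ] at this
    linarith
  obtain ⟨Z, hZ⟩ := exists_subset_sum_le ζ h0 h1 x hx1 a hlt
  refine ⟨Z, ?_, ?_, fun t => ?_⟩
  · have := hZ (.inr false)
    simp [hx, ha] at this
    linarith
  · have := hZ (.inr true)
    simp [hx, ha] at this
    linarith
  · have := hZ (.inl t)
    simp only [hx, ha, Sum.elim_inl, ← sum_div] at this
    rw [div_le_div_iff₀ (by positivity) hΔ] at this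
    have h3 : Δ * (∑ z ∈ Z, d t z) ≤ Δ * (2 * ζ * n) := by linarith
    exact le_of_mul_le_mul_left h3 hΔ

end RandomSubset

section WeightedStep

/-- If every test has a nonpositive mean increment and bounded increments, some outcome of positive
probability does not increase the exponential potential by much. -/
lemma exists_outcome_potential_le {ο κ : Type*} [Fintype κ] (O : Finset ο) (P : ο → ℝ)
    (hP : ∀ o ∈ O, 0 ≤ P o) (hP1 : ∑ o ∈ O, P o = 1) (lam a b : ℝ) (hlam : 0 ≤ lam)
    (hlb : lam * b ≤ 1) (F : κ → ℝ) (inc : κ → ο → ℝ)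
    (hmean : ∀ t, ∑ o ∈ O, P o * inc t o ≤ 0)
    (hb : ∀ t, ∀ o ∈ O, |inc t o| ≤ b)
    (ha : ∀ t, ∑ o ∈ O, P o * |inc t o| ≤ a) :
    ∃ o ∈ O, 0 < P o ∧ ∑ t, Real.exp (lam * (F t + inc t o)) ≤
      (1 + lam ^ 2 * (a * b)) * ∑ t, Real.exp (lam * F t) := by
  by_contra! hcon
  have hb0 : ∀ t, ∀ o ∈ O, 0 ≤ b := fun t o ho => (abs_nonneg _).trans (hb t o ho)
  have h1 : ∀ t, ∑ o ∈ O, P o * Real.exp (lam * (F t + inc t o)) ≤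
      (1 + lam ^ 2 * (a * b)) * Real.exp (lam * F t) := by
    intro t
    have h2 : ∀ o ∈ O, P o * Real.exp (lam * (F t + inc t o)) ≤ Real.exp (lam * F t) *
        (P o + lam * (P o * inc t o) + lam ^ 2 * b * (P o * |inc t o|)) := by
      intro o ho
      have hx : |lam * inc t o| ≤ 1 := by
        rw [abs_mul, abs_of_nonneg hlam]
        exact (mul_le_mul_of_nonneg_left (hb t o ho) hlam).trans hlb
      have h3 := (abs_le.1 (Real.abs_exp_sub_one_sub_id_le hx)).2
      have h4 : (lam * inc t o) ^ 2 ≤ lam ^ 2 * (b * |inc t o|) := by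
        rw [mul_pow]
        refine mul_le_mul_of_nonneg_left ?_ (by positivity)
        rw [← sq_abs, sq]
        exact mul_le_mul_of_nonneg_right (hb t o ho) (abs_nonneg _)
      rw [mul_add, Real.exp_add]
      have h5 : Real.exp (lam * inc t o) ≤ 1 + lam * inc t o + lam ^ 2 * (b * |inc t o|) := by
        linarith
      have h6 := mul_le_mul_of_nonneg_left h5 (mul_nonneg (hP o ho) (Real.exp_pos (lam * F t)).le)
      linarith
    refine (sum_le_sum h2).trans ?_
    rw [← mul_sum, sum_add_distrib, sum_add_distrib, hP1, ← mul_sum, ← mul_sum, mul_comm]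
    refine mul_le_mul_of_nonneg_right ?_ (Real.exp_pos _).le
    have h7 := mul_nonpos_of_nonneg_of_nonpos hlam (hmean t)
    rcases O.eq_empty_or_nonempty with rfl | ⟨o, ho⟩
    · simp at hP1
    have := hb0 t o ho
    have h8 := mul_le_mul_of_nonneg_left (ha t) (by positivity : 0 ≤ lam ^ 2 * b)
    linarith
  have h9 : ∃ o ∈ O, 0 < P o := by
    by_contra! h
    have := sum_nonpos h
    linarith
  have h10 : ∑ o ∈ O, P o * ((1 + lam ^ 2 * (a * b)) * ∑ t, Real.exp (lam * F t)) <
      ∑ o ∈ O, P o * ∑ t, Real.exp (lam * (F t + inc t o)) := by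
    obtain ⟨o, ho, hPo⟩ := h9
    refine sum_lt_sum (fun o ho => ?_) ⟨o, ho, mul_lt_mul_of_pos_left (hcon o ho hPo) hPo⟩
    rcases (hP o ho).eq_or_lt with h | h
    · simp [← h]
    · exact (mul_lt_mul_of_pos_left (hcon o ho h) h).le
  rw [← sum_mul, hP1, one_mul, mul_sum] at h10
  simp_rw [mul_sum] at h10
  rw [sum_comm] at h10
  exact absurd (sum_le_sum fun t _ => h1 t) (not_le.2 h10)

variable {ο σ : Type*} [DecidableEq σ]

/-- The probability that the random option uses the slot `x`. -/
def hitProb (O : Finset ο) (P : ο → ℝ) (S : ο → Finset σ) (x : σ) : ℝ :=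
  ∑ o ∈ O, if x ∈ S o then P o else 0

/-- Unbiased weight update after the option `o` has been chosen. -/
noncomputable def updWeight (O : Finset ο) (P : ο → ℝ) (S : ο → Finset σ) (o : ο) (ω : σ → ℝ)
    (x : σ) : ℝ :=
  if x ∈ S o then 0 else ω x / (1 - hitProb O P S x)

variable {O : Finset ο} {P : ο → ℝ} {S : ο → Finset σ} {ω : σ → ℝ} {B π q : ℝ}

lemma hitProb_nonneg (hP : ∀ o ∈ O, 0 ≤ P o) (x : σ) : 0 ≤ hitProb O P S x :=
  sum_nonneg fun o ho => by split_ifs <;> simp [hP o ho]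

/-- The hypotheses on one step of the weighted process. -/
structure StepBounds (O : Finset ο) (P : ο → ℝ) (S : ο → Finset σ) (ω : σ → ℝ) (B π q : ℝ) :
    Prop where
  nonneg : ∀ o ∈ O, 0 ≤ P o
  total : ∑ o ∈ O, P o = 1
  weight_nonneg : ∀ x, 0 ≤ ω x
  weight_le : ∀ x, ω x ≤ B
  hit_le : ∀ x, hitProb O P S x ≤ π
  pi_nonneg : 0 ≤ π
  pi_le : π ≤ 1 / 4
  joint_le : ∀ x y, x ≠ y → ∑ o ∈ O, (if x ∈ S o ∧ y ∈ S o then P o else 0) ≤ q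

namespace StepBounds

variable (h : StepBounds O P S ω B π q)
include h

lemma upd_nonneg (o : ο) (x : σ) : 0 ≤ updWeight O P S o ω x := by
  rw [updWeight]
  split_ifs
  · exact le_rfl
  · exact div_nonneg (h.weight_nonneg x) (by linarith [h.hit_le x, h.pi_le])

lemma upd_le (o : ο) (x : σ) : updWeight O P S o ω x ≤ 4 / 3 * B := by
  have h1 := h.weight_nonneg x
  have h2 := h.weight_le x
  have h3 := h.hit_le x
  have h4 := h.pi_le
  rw [updWeight]
  split_ifs
  · linarith
  · rw [div_le_iff₀ (by linarith)]
    nlinarith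

lemma abs_pair_mean_le {x y : σ} (hxy : x ≠ y) :
    |∑ o ∈ O, P o * (updWeight O P S o ω x * updWeight O P S o ω y - ω x * ω y)| ≤
      2 * B ^ 2 * (q + π ^ 2) := by
  set px := hitProb O P S x with hpx
  set py := hitProb O P S y with hpy
  set r := ∑ o ∈ O, (if x ∈ S o ∧ y ∈ S o then P o else 0) with hr
  have hx0 : 0 ≤ px := hitProb_nonneg h.nonneg x
  have hy0 : 0 ≤ py := hitProb_nonneg h.nonneg y
  have hr0 : 0 ≤ r := sum_nonneg fun o ho => by split_ifs <;> simp [h.nonneg o ho]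
  have hx1 := h.hit_le x
  have hy1 := h.hit_le y
  have hr1 := h.joint_le x y hxy
  have h4 := h.pi_le
  rw [← hpx] at hx1
  rw [← hpy] at hy1
  rw [← hr] at hr1
  have hxp : (0 : ℝ) < 1 - px := by linarith
  have hyp : (0 : ℝ) < 1 - py := by linarith
  have e1 : ∀ o ∈ O, P o * (updWeight O P S o ω x * updWeight O P S o ω y - ω x * ω y) =
      ω x * ω y / ((1 - px) * (1 - py)) * (P o - (if x ∈ S o then P o else 0) -
        (if y ∈ S o then P o else 0) + (if x ∈ S o ∧ y ∈ S o then P o else 0))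
        - P o * (ω x * ω y) := by
    intro o _
    rw [updWeight, updWeight, ← hpx, ← hpy]
    by_cases ha : x ∈ S o <;> by_cases hb : y ∈ S o <;> simp [ha, hb]
    field_simp
  have e2 : ∑ o ∈ O, P o * (updWeight O P S o ω x * updWeight O P S o ω y - ω x * ω y) =
      ω x * ω y * ((r - px * py) / ((1 - px) * (1 - py))) := by
    rw [sum_congr rfl e1, sum_sub_distrib, ← mul_sum, sum_add_distrib, sum_sub_distrib,
      sum_sub_distrib, ← sum_mul, h.total]
    change _ * (1 - px - py + r) - _ = _
    field_simp
    ring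
  rw [e2, abs_mul, abs_of_nonneg (mul_nonneg (h.weight_nonneg x) (h.weight_nonneg y))]
  have h5 : ω x * ω y ≤ B ^ 2 := by
    rw [sq]
    exact mul_le_mul (h.weight_le x) (h.weight_le y) (h.weight_nonneg y)
      ((h.weight_nonneg x).trans (h.weight_le x))
  have h6 : |(r - px * py) / ((1 - px) * (1 - py))| ≤ 2 * (q + π ^ 2) := by
    rw [abs_div, abs_of_pos (mul_pos hxp hyp), div_le_iff₀ (mul_pos hxp hyp)]
    have h7 : px * py ≤ π ^ 2 := by
      rw [sq]; exact mul_le_mul hx1 hy1 hy0 (hx0.trans hx1)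
    have h8 : |r - px * py| ≤ q + π ^ 2 := by
      have := mul_nonneg hx0 hy0
      rw [abs_le]; constructor <;> nlinarith
    have h9 : 1 / 2 ≤ (1 - px) * (1 - py) := by nlinarith
    have : 0 ≤ q + π ^ 2 := (abs_nonneg _).trans h8
    nlinarith
  calc ω x * ω y * |(r - px * py) / ((1 - px) * (1 - py))| ≤ B ^ 2 * (2 * (q + π ^ 2)) :=
        mul_le_mul h5 h6 (abs_nonneg _) (sq_nonneg _)
    _ = _ := by ring

lemma abs_pair_inc_le {o : ο} (x y : σ) :
    |updWeight O P S o ω x * updWeight O P S o ω y - ω x * ω y| ≤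
      B ^ 2 * (4 * π + (if x ∈ S o then 1 else 0) + (if y ∈ S o then 1 else 0)) := by
  have hx1 := h.hit_le x
  have hy1 := h.hit_le y
  have hx0 : 0 ≤ hitProb O P S x := hitProb_nonneg h.nonneg x
  have hy0 : 0 ≤ hitProb O P S y := hitProb_nonneg h.nonneg y
  have h4 := h.pi_le
  have hπ : 0 ≤ π := hx0.trans hx1
  have h0 := mul_nonneg (h.weight_nonneg x) (h.weight_nonneg y)
  have h5 : ω x * ω y ≤ B ^ 2 := by
    rw [sq]
    exact mul_le_mul (h.weight_le x) (h.weight_le y) (h.weight_nonneg y)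
      ((h.weight_nonneg x).trans (h.weight_le x))
  have hB : 0 ≤ B ^ 2 := sq_nonneg B
  have hBπ : 0 ≤ B ^ 2 * π := mul_nonneg hB hπ
  rw [updWeight, updWeight]
  by_cases ha : x ∈ S o
  · rw [if_pos ha, if_pos ha, zero_mul, zero_sub, abs_neg, abs_of_nonneg h0]
    split_ifs <;> linarith
  by_cases hb : y ∈ S o
  · rw [if_pos hb, if_pos hb, mul_zero, zero_sub, abs_neg, abs_of_nonneg h0]
    split_ifs; linarith
  rw [if_neg ha, if_neg hb, if_neg ha, if_neg hb]
  set px := hitProb O P S x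
  set py := hitProb O P S y
  have hxp : (0 : ℝ) < 1 - px := by linarith
  have hyp : (0 : ℝ) < 1 - py := by linarith
  have e : ω x / (1 - px) * (ω y / (1 - py)) - ω x * ω y =
      ω x * ω y * ((px + py - px * py) / ((1 - px) * (1 - py))) := by
    field_simp; ring
  have h6 : (px + py - px * py) / ((1 - px) * (1 - py)) ≤ 4 * π := by
    rw [div_le_iff₀ (mul_pos hxp hyp)]
    have h9 : 1 / 2 ≤ (1 - px) * (1 - py) := by nlinarith
    nlinarith [mul_nonneg hx0 hy0]
  have h7 : 0 ≤ (px + py - px * py) / ((1 - px) * (1 - py)) :=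
    div_nonneg (by nlinarith) (mul_pos hxp hyp).le
  rw [e, abs_of_nonneg (mul_nonneg h0 h7), add_zero, add_zero]
  exact mul_le_mul h5 h6 h7 hB

variable {ι : Type*} (I : Finset ι) (f g : ι → σ)

lemma abs_quad_mean_le (hfg : ∀ i ∈ I, f i ≠ g i) (n : ℝ) (hn : (#I : ℝ) ≤ n) (hq : 0 ≤ q) :
    |∑ o ∈ O, P o * (∑ i ∈ I, updWeight O P S o ω (f i) * updWeight O P S o ω (g i) -
      ∑ i ∈ I, ω (f i) * ω (g i))| ≤ n * (2 * B ^ 2 * (q + π ^ 2)) := by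
  simp_rw [← sum_sub_distrib, mul_sum]
  rw [sum_comm]
  calc _ ≤ ∑ i ∈ I, _ := abs_sum_le_sum_abs _ _
    _ ≤ ∑ i ∈ I, 2 * B ^ 2 * (q + π ^ 2) := sum_le_sum fun i hi => h.abs_pair_mean_le (hfg i hi)
    _ = #I * (2 * B ^ 2 * (q + π ^ 2)) := by rw [sum_const, nsmul_eq_mul]
    _ ≤ _ := mul_le_mul_of_nonneg_right hn (by positivity)

lemma abs_quad_inc_le_hits (n : ℝ) (hn : (#I : ℝ) ≤ n) (o : ο) :
    |∑ i ∈ I, updWeight O P S o ω (f i) * updWeight O P S o ω (g i) -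
      ∑ i ∈ I, ω (f i) * ω (g i)| ≤
      B ^ 2 * (4 * n * π + ∑ i ∈ I, ((if f i ∈ S o then 1 else 0) + if g i ∈ S o then 1 else 0)) := by
  rw [← sum_sub_distrib]
  calc _ ≤ ∑ i ∈ I, _ := abs_sum_le_sum_abs _ _
    _ ≤ ∑ i ∈ I, B ^ 2 * (4 * π + (if f i ∈ S o then 1 else 0) + (if g i ∈ S o then 1 else 0)) :=
        sum_le_sum fun i _ => h.abs_pair_inc_le _ _
    _ = B ^ 2 * (#I * (4 * π) +
        ∑ i ∈ I, ((if f i ∈ S o then 1 else 0) + if g i ∈ S o then 1 else 0)) := by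
        rw [← mul_sum]
        simp_rw [add_assoc]
        rw [sum_add_distrib, sum_const, nsmul_eq_mul]
    _ ≤ _ := by
        refine mul_le_mul_of_nonneg_left (add_le_add_left ?_ _) (sq_nonneg B)
        nlinarith [h.pi_nonneg]

lemma abs_quad_inc_le (n D : ℝ) (hn : (#I : ℝ) ≤ n) {o : ο} (ho : #(S o) ≤ 3)
    (hf : ∀ x ∈ S o, (#(I.filter fun i => f i = x) : ℝ) ≤ D)
    (hg : ∀ x ∈ S o, (#(I.filter fun i => g i = x) : ℝ) ≤ D) (hD : 0 ≤ D) :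
    |∑ i ∈ I, updWeight O P S o ω (f i) * updWeight O P S o ω (g i) -
      ∑ i ∈ I, ω (f i) * ω (g i)| ≤ B ^ 2 * (4 * n * π + 6 * D) := by
  refine (h.abs_quad_inc_le_hits I f g n hn o).trans
    (mul_le_mul_of_nonneg_left (add_le_add_right ?_ _) (sq_nonneg B))
  have key : ∀ f : ι → σ, (∀ x ∈ S o, (#(I.filter fun i => f i = x) : ℝ) ≤ D) →
      ∑ i ∈ I, (if f i ∈ S o then (1 : ℝ) else 0) ≤ 3 * D := by
    intro f hf
    calc ∑ i ∈ I, (if f i ∈ S o then (1 : ℝ) else 0)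
        = ∑ i ∈ I, ∑ x ∈ S o, (if f i = x then (1 : ℝ) else 0) := by
          refine sum_congr rfl fun i _ => ?_
          rw [sum_ite_eq]
      _ = ∑ x ∈ S o, (#(I.filter fun i => f i = x) : ℝ) := by
          rw [sum_comm]
          refine sum_congr rfl fun x _ => ?_
          rw [sum_boole]
      _ ≤ ∑ x ∈ S o, D := sum_le_sum hf
      _ ≤ 3 * D := by
          rw [sum_const, nsmul_eq_mul]
          exact mul_le_mul_of_nonneg_right (by exact_mod_cast ho) hD
  rw [sum_add_distrib]
  linarith [key f hf, key g hg]

lemma mean_abs_quad_inc_le (n : ℝ) (hn : (#I : ℝ) ≤ n) :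
    ∑ o ∈ O, P o * |∑ i ∈ I, updWeight O P S o ω (f i) * updWeight O P S o ω (g i) -
      ∑ i ∈ I, ω (f i) * ω (g i)| ≤ 6 * B ^ 2 * n * π := by
  have e : ∀ x, ∑ o ∈ O, P o * (if x ∈ S o then (1 : ℝ) else 0) = hitProb O P S x := fun x =>
    sum_congr rfl fun o _ => by split_ifs <;> simp
  calc _ ≤ ∑ o ∈ O, P o * (B ^ 2 * (4 * n * π +
        ∑ i ∈ I, ((if f i ∈ S o then 1 else 0) + if g i ∈ S o then 1 else 0))) :=
        sum_le_sum fun o ho => mul_le_mul_of_nonneg_left (h.abs_quad_inc_le_hits I f g n hn o)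
          (h.nonneg o ho)
    _ = B ^ 2 * (4 * n * π + ∑ i ∈ I, (hitProb O P S (f i) + hitProb O P S (g i))) := by
        have : ∀ o ∈ O, P o * (B ^ 2 * (4 * n * π +
          ∑ i ∈ I, ((if f i ∈ S o then 1 else 0) + if g i ∈ S o then 1 else 0))) =
          B ^ 2 * (P o * (4 * n * π)) + B ^ 2 * ∑ i ∈ I, (P o * (if f i ∈ S o then 1 else 0) +
            P o * (if g i ∈ S o then 1 else 0)) := by
          intro o _
          simp_rw [← mul_add, ← mul_sum]; ring
        rw [sum_congr rfl this, sum_add_distrib, ← mul_sum, ← mul_sum, ← sum_mul, h.total,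
          one_mul, sum_comm]
        simp_rw [sum_add_distrib, e]
        ring
    _ ≤ B ^ 2 * (4 * n * π + 2 * n * π) := by
        refine mul_le_mul_of_nonneg_left (add_le_add_right ?_ _) (sq_nonneg B)
        calc _ ≤ ∑ i ∈ I, (2 * π) :=
              sum_le_sum fun i _ => by linarith [h.hit_le (f i), h.hit_le (g i)]
          _ = #I * (2 * π) := by rw [sum_const, nsmul_eq_mul]
          _ ≤ _ := by nlinarith [h.pi_nonneg]
    _ = _ := by ring

end StepBounds

end WeightedStep

section WeightedSetting

/-- The resources consumed by adding a directed edge to a rainbow path forest: the out-port of its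
tail, the in-port of its head, and its colour; `star` is a dummy which is never consumed. -/
inductive Slot (V : Type*) where
  | out (v : V)
  | inn (v : V)
  | col (c : ℕ)
  | star
  deriving DecidableEq

/-- The kinds of statistics tracked along the process. -/
inductive TestKind where
  | sumOut | dOut | dIn | cls | lOut | lIn | nbrA | nbrZ | conn
  deriving DecidableEq

instance : Fintype TestKind where
  elems := {.sumOut, .dOut, .dIn, .cls, .lOut, .lIn, .nbrA, .nbrZ, .conn}
  complete i := by cases i <;> decide

lemma card_testKind : Fintype.card TestKind = 9 := rfl

/-- A symmetric colouring of pairs of vertices, a set `A` of vertices to be covered by paths,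
and the numerical parameters of the process. -/
structure Setting (V : Type*) [Fintype V] [DecidableEq V] where
  col : V → V → ℕ
  A : Finset V
  (Δ ε δ ρ μ lam : ℝ)

namespace Setting

variable {V : Type*} [Fintype V] [DecidableEq V] (s : Setting V)

noncomputable def n (_ : Setting V) : ℝ := Fintype.card V
noncomputable def N : ℝ := #s.A
noncomputable def B : ℝ := 2 / s.δ
noncomputable def π : ℝ := 8 * s.B / s.n
noncomputable def q : ℝ := 8 * s.Δ * s.B ^ 3 / s.n ^ 2
noncomputable def m : ℝ := s.n * (2 * s.B ^ 2 * (s.q + s.π ^ 2))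
noncomputable def incBound : ℝ := s.B ^ 2 * (4 * s.n * s.π + 6 * s.Δ) + s.m + 2 * s.B ^ 2 + 1
noncomputable def incMean : ℝ := 6 * s.B ^ 2 * s.n * s.π + s.m + 2 * s.B ^ 2 + 1

/-- The slots used by the directed edge `o`. -/
def slots (o : V × V) : Finset (Slot V) := {.out o.1, .inn o.2, .col (s.col o.1 o.2)}

/-- The standing hypotheses on the colouring and on the parameters. -/
structure Good : Prop where
  symm : ∀ u v, s.col u v = s.col v u
  deg_le : ∀ v c, (#(univ.filter fun u => u ≠ v ∧ s.col v u = c) : ℝ) ≤ s.Δ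
  cls_le : ∀ c, (#(univ.filter fun p : V × V => p.1 ≠ p.2 ∧ s.col p.1 p.2 = c) : ℝ) ≤
    (1 - s.ε) * s.n
  one_le_Δ : 1 ≤ s.Δ
  ε_pos : 0 < s.ε
  ε_le : s.ε ≤ 1 / 2
  δ_pos : 0 < s.δ
  δ_le : s.δ ≤ s.ε
  ρ_pos : 0 < s.ρ
  ρ_le : s.ρ ≤ 1 / 100
  ρ_le_δ : 8 * s.ρ ≤ s.δ
  μ_pos : 0 < s.μ
  lam_pos : 0 < s.lam
  n_le : s.n ≤ 2 * s.N
  N_pos : 0 < s.N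
  err_le : s.μ * s.n + 1 + s.B ^ 2 ≤ s.ρ * s.N
  cls_err_le : (1 - s.ε) * s.n + s.μ * s.n ≤ (1 - s.ε / 2) * ((1 - s.ρ) ^ 2 * s.N)
  pi_le : s.π ≤ 1 / 4
  drift_le : s.m ≤ s.μ / 2
  var_le : s.lam ^ 2 * (s.incMean * s.incBound) * s.n ≤ 1
  step_le : s.lam * s.incBound ≤ 1
  tests_le : (18 * s.n ^ 2 + s.n) * Real.exp 1 ≤ Real.exp (s.lam * (s.μ * s.n / 2))
  sparse : 4 + 3 * s.Δ ≤ s.N / 10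

/-- Index sets of the tests. -/
def testIdx : TestKind → V → V → Finset (V × V)
  | .sumOut, a, _ => univ.filter fun p => p.2 = a ∧ p.1 ∈ s.A
  | .dOut, a, _ => univ.filter fun p => p.1 = a ∧ p.2 ∈ s.A ∧ p.2 ≠ a
  | .dIn, a, _ => univ.filter fun p => p.2 = a ∧ p.1 ∈ s.A ∧ p.1 ≠ a
  | .cls, a, b => univ.filter fun p =>
      (p.1 ≠ p.2 ∧ s.col p.1 p.2 = s.col a b) ∧ p.1 ∈ s.A ∧ p.2 ∈ s.A
  | .lOut, a, b => univ.filter fun p => (p.1 ≠ p.2 ∧ s.col p.1 p.2 = s.col a b) ∧ p.1 ∈ s.A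
  | .lIn, a, b => univ.filter fun p => (p.1 ≠ p.2 ∧ s.col p.1 p.2 = s.col a b) ∧ p.2 ∈ s.A
  | .nbrA, a, _ => univ.filter fun p => p.1 = a ∧ p.2 ∈ s.A ∧ p.2 ≠ a
  | .nbrZ, a, _ => univ.filter fun p => p.1 = a ∧ p.2 ∉ s.A ∧ p.2 ≠ a
  | .conn, a, b => univ.filter fun p =>
      p.1 = a ∧ p.2 ∉ s.A ∧ p.2 ≠ a ∧ p.2 ≠ b ∧ s.col a p.2 ≠ s.col b p.2

/-- First slots of the tests. -/
def testFst : TestKind → V → V → V × V → Slot V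
  | .sumOut, _, _, p => .out p.1
  | .dOut, _, _, p => .inn p.2
  | .dIn, _, _, p => .out p.1
  | .cls, _, _, p => .out p.1
  | .lOut, _, _, p => .out p.1
  | .lIn, _, _, p => .inn p.2
  | .nbrA, a, _, p => .col (s.col a p.2)
  | .nbrZ, a, _, p => .col (s.col a p.2)
  | .conn, a, _, p => .col (s.col a p.2)

/-- Second slots of the tests. -/
def testSnd : TestKind → V → V → V × V → Slot V
  | .sumOut, _, _, _ => .star
  | .dOut, a, _, p => .col (s.col a p.2)
  | .dIn, a, _, p => .col (s.col a p.1)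
  | .cls, _, _, p => .inn p.2
  | .lOut, _, _, _ => .star
  | .lIn, _, _, _ => .star
  | .nbrA, _, _, _ => .star
  | .nbrZ, _, _, _ => .star
  | .conn, _, b, p => .col (s.col b p.2)

/-- The value of a test. -/
def testVal (ω : Slot V → ℝ) (i : TestKind) (a b : V) : ℝ :=
  ∑ p ∈ s.testIdx i a b, ω (s.testFst i a b p) * ω (s.testSnd i a b p)

omit [Fintype V] [DecidableEq V] in
lemma card_le_of_fst_eq (a : V) (F : Finset (V × V)) (h : ∀ p ∈ F, p.1 = a) (G : Finset V)
    (hG : ∀ p ∈ F, p.2 ∈ G) : #F ≤ #G :=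
  card_le_card_of_injOn Prod.snd hG fun p hp p' hp' e => Prod.ext ((h p hp).trans (h p' hp').symm) e

omit [Fintype V] [DecidableEq V] in
lemma card_le_of_snd_eq (a : V) (F : Finset (V × V)) (h : ∀ p ∈ F, p.2 = a) (G : Finset V)
    (hG : ∀ p ∈ F, p.1 ∈ G) : #F ≤ #G :=
  card_le_card_of_injOn Prod.fst hG fun p hp p' hp' e => Prod.ext e ((h p hp).trans (h p' hp').symm)

namespace Good

variable {s} (h : s.Good)
include h

lemma n_pos : 0 < s.n := by
  have h1 : s.N ≤ s.n := by
    rw [n, N]; exact_mod_cast card_le_univ _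
  exact h.N_pos.trans_le h1

omit h in
lemma N_le_n : s.N ≤ s.n := by rw [n, N]; exact_mod_cast card_le_univ _

lemma B_pos : 0 < s.B := div_pos two_pos h.δ_pos

lemma one_le_B : 1 ≤ s.B := by
  rw [B, le_div_iff₀ h.δ_pos]; linarith [h.δ_le, h.ε_le]

lemma π_nonneg : 0 ≤ s.π := div_nonneg (by linarith [h.B_pos]) h.n_pos.le

lemma q_nonneg : 0 ≤ s.q := by
  have := h.one_le_Δ
  have := h.B_pos
  have := h.n_pos
  rw [q]; positivity

lemma m_nonneg : 0 ≤ s.m := by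
  have := h.q_nonneg
  have := h.n_pos
  rw [m]; positivity

lemma cls_le_n (c : ℕ) :
    (#(univ.filter fun p : V × V => p.1 ≠ p.2 ∧ s.col p.1 p.2 = c) : ℝ) ≤ s.n :=
  (h.cls_le c).trans (by nlinarith [h.ε_pos, h.n_pos])

lemma card_fiber_fst_le (v : V) (c : ℕ) (F : Finset (V × V))
    (hF : ∀ p ∈ F, p.1 = v ∧ p.2 ≠ v ∧ s.col v p.2 = c) : (#F : ℝ) ≤ s.Δ := by
  refine le_trans ?_ (h.deg_le v c)
  exact_mod_cast card_le_of_fst_eq v F (fun p hp => (hF p hp).1) _ fun p hp =>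
    mem_filter.2 ⟨mem_univ _, (hF p hp).2⟩

lemma card_fiber_snd_le (v : V) (c : ℕ) (F : Finset (V × V))
    (hF : ∀ p ∈ F, p.2 = v ∧ p.1 ≠ v ∧ s.col v p.1 = c) : (#F : ℝ) ≤ s.Δ := by
  refine le_trans ?_ (h.deg_le v c)
  exact_mod_cast card_le_of_snd_eq v F (fun p hp => (hF p hp).1) _ fun p hp =>
    mem_filter.2 ⟨mem_univ _, (hF p hp).2⟩

lemma card_le_Δ_of_eq (p₀ : V × V) (F : Finset (V × V)) (hF : ∀ p ∈ F, p = p₀) :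
    (#F : ℝ) ≤ s.Δ := by
  refine le_trans ?_ h.one_le_Δ
  have : #F ≤ #({p₀} : Finset (V × V)) := card_le_card fun p hp => mem_singleton.2 (hF p hp)
  exact_mod_cast this

lemma card_testIdx_le (i : TestKind) (a b : V) : (#(s.testIdx i a b) : ℝ) ≤ s.n := by
  have h1 : ∀ F : Finset (V × V), (∀ p ∈ F, p.1 = a) → (#F : ℝ) ≤ s.n := fun F hF => by
    rw [n, ← card_univ]
    exact_mod_cast card_le_of_fst_eq a F hF univ fun _ _ => mem_univ _
  have h2 : ∀ F : Finset (V × V), (∀ p ∈ F, p.2 = a) → (#F : ℝ) ≤ s.n := fun F hF => by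
    rw [n, ← card_univ]
    exact_mod_cast card_le_of_snd_eq a F hF univ fun _ _ => mem_univ _
  have h3 : ∀ F : Finset (V × V), (∀ p ∈ F, p.1 ≠ p.2 ∧ s.col p.1 p.2 = s.col a b) →
      (#F : ℝ) ≤ s.n := fun F hF => by
    refine le_trans ?_ (h.cls_le_n (s.col a b))
    exact_mod_cast card_le_card fun p hp => mem_filter.2 ⟨mem_univ _, hF p hp⟩
  cases i <;> simp only [testIdx]
  case sumOut => exact h2 _ (by simp +contextual)
  case dIn => exact h2 _ (by simp +contextual)
  case cls => exact h3 _ (by simp +contextual)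
  case lOut => exact h3 _ (by simp +contextual)
  case lIn => exact h3 _ (by simp +contextual)
  all_goals exact h1 _ (by simp +contextual)

omit h in
lemma testFst_ne_testSnd (i : TestKind) (a b : V) :
    ∀ p ∈ s.testIdx i a b, s.testFst i a b p ≠ s.testSnd i a b p := by
  cases i <;> simp [testIdx, testFst, testSnd]

lemma card_testFst_fiber_le (i : TestKind) (a b : V) (x : Slot V) (hx : x ≠ .star) :
    (#((s.testIdx i a b).filter fun p => s.testFst i a b p = x) : ℝ) ≤ s.Δ := by
  cases i <;> rcases x with v | v | c | _ <;> simp only [testIdx, testFst] <;>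
    first
    | exact absurd rfl hx
    | (simp; linarith [h.one_le_Δ])
    | (refine h.card_le_Δ_of_eq (v, a) _ ?_; simp +contextual [Prod.ext_iff]; done)
    | (refine h.card_le_Δ_of_eq (a, v) _ ?_; simp +contextual [Prod.ext_iff]; done)
    | (refine h.card_fiber_fst_le a c _ ?_; simp +contextual; done)
    | (refine h.card_fiber_fst_le v (s.col a b) _ ?_
       rintro ⟨u, w⟩; simp only [mem_filter, Slot.out.injEq, mem_univ, true_and]
       rintro ⟨h1, rfl⟩; exact ⟨rfl, Ne.symm h1.1.1, h1.1.2⟩)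
    | (refine h.card_fiber_snd_le v (s.col a b) _ ?_
       rintro ⟨u, w⟩; simp only [mem_filter, Slot.inn.injEq, mem_univ, true_and]
       rintro ⟨h1, rfl⟩; exact ⟨rfl, h1.1.1, (h.symm _ _).trans h1.1.2⟩)

lemma card_testSnd_fiber_le (i : TestKind) (a b : V) (x : Slot V) (hx : x ≠ .star) :
    (#((s.testIdx i a b).filter fun p => s.testSnd i a b p = x) : ℝ) ≤ s.Δ := by
  cases i <;> rcases x with v | v | c | _ <;> simp only [testIdx, testSnd, filter_filter] <;>
    first
    | exact absurd rfl hx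
    | (simp; linarith [h.one_le_Δ])
    | (refine h.card_fiber_fst_le a c _ ?_; simp +contextual; done)
    | (refine h.card_fiber_snd_le a c _ ?_; simp +contextual; done)
    | (refine h.card_fiber_snd_le v (s.col a b) _ ?_
       rintro ⟨u, w⟩; simp only [mem_filter, Slot.inn.injEq, mem_univ, true_and]
       rintro ⟨h1, rfl⟩; exact ⟨rfl, h1.1.1, (h.symm _ _).trans h1.1.2⟩)
    | (refine le_trans ?_ (h.deg_le b c)
       refine Nat.cast_le.2 (card_le_of_fst_eq a _ (by simp +contextual) _ ?_)
       simp +contextual)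

omit h in
lemma card_slots_le (o : V × V) : #(s.slots o) ≤ 3 := card_le_three

omit h in
lemma star_notMem_slots (o : V × V) : .star ∉ s.slots o := by simp [slots]

/-- Few options use two given slots. -/
lemma card_joint_le (x y : Slot V) (hxy : x ≠ y) :
    (#(univ.filter fun o : V × V => o.1 ≠ o.2 ∧ x ∈ s.slots o ∧ y ∈ s.slots o) : ℝ) ≤ s.Δ := by
  rcases x with v | v | c | _ <;> rcases y with v' | v' | c' | _ <;> simp only [slots, mem_insert,
      mem_singleton, Slot.out.injEq, Slot.inn.injEq, Slot.col.injEq, reduceCtorEq, false_or, or_false,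
      and_false, false_and, filter_false, card_empty, Nat.cast_zero] <;>
    first
    | linarith [h.one_le_Δ]
    | (refine h.card_le_Δ_of_eq (v, v') _ ?_; simp +contextual [Prod.ext_iff]; done)
    | (refine h.card_le_Δ_of_eq (v', v) _ ?_; simp +contextual [Prod.ext_iff]; done)
    | (refine h.card_fiber_fst_le v c' _ ?_
       rintro ⟨a, b⟩; simp only [mem_filter, mem_univ, true_and]
       rintro ⟨h1, rfl, h2⟩; exact ⟨rfl, Ne.symm h1, h2.symm⟩)
    | (refine h.card_fiber_fst_le v' c _ ?_
       rintro ⟨a, b⟩; simp only [mem_filter, mem_univ, true_and]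
       rintro ⟨h1, h2, rfl⟩; exact ⟨rfl, Ne.symm h1, h2.symm⟩)
    | (refine h.card_fiber_snd_le v c' _ ?_
       rintro ⟨a, b⟩; simp only [mem_filter, mem_univ, true_and]
       rintro ⟨h1, rfl, h2⟩; exact ⟨rfl, h1, (h.symm _ _).trans h2.symm⟩)
    | (refine h.card_fiber_snd_le v' c _ ?_
       rintro ⟨a, b⟩; simp only [mem_filter, mem_univ, true_and]
       rintro ⟨h1, h2, rfl⟩; exact ⟨rfl, h1, (h.symm _ _).trans h2.symm⟩)
    | (rw [filter_eq_empty_iff.2]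
       · simpa using zero_le_one.trans h.one_le_Δ
       · rintro ⟨a, b⟩ _ ⟨_, h1, h2⟩
         exact hxy (by rw [h1, h2]))

end Good

end Setting

end WeightedSetting

section PathForest

variable {V : Type*} [Fintype V] [DecidableEq V]

namespace Setting

variable (s : Setting V)

/-- The slots used by a set of directed edges. -/
def used (pk : Finset (V × V)) : Finset (Slot V) := pk.biUnion s.slots

variable {s}

lemma mem_used {pk : Finset (V × V)} {x : Slot V} : x ∈ s.used pk ↔ ∃ p ∈ pk, x ∈ s.slots p :=
  mem_biUnion

lemma used_insert (o : V × V) (pk : Finset (V × V)) :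
    s.used (insert o pk) = s.slots o ∪ s.used pk := by
  rw [used, biUnion_insert]; rfl

variable (s)

/-- `L` is a rainbow directed path forest with vertex set `s.A` and edge set `pk`. -/
structure IsForest (L : List (List V)) (pk : Finset (V × V)) : Prop where
  ne_nil : ∀ l ∈ L, l ≠ []
  nodup : L.flatten.Nodup
  mem_flatten : ∀ v, v ∈ L.flatten ↔ v ∈ s.A
  isChain : ∀ l ∈ L, l.IsChain fun a b => (a, b) ∈ pk
  out_notMem : ∀ v ∈ s.A, .out v ∉ s.used pk ↔ ∃ l ∈ L, l.getLast? = some v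
  inn_notMem : ∀ v ∈ s.A, .inn v ∉ s.used pk ↔ ∃ l ∈ L, l.head? = some v
  card : L.length + #pk = #s.A
  pick : ∀ p ∈ pk, p.1 ∈ s.A ∧ p.2 ∈ s.A ∧ p.1 ≠ p.2
  disj : ∀ p ∈ pk, ∀ p' ∈ pk, p ≠ p' → Disjoint (s.slots p) (s.slots p')

lemma isForest_singletons : s.IsForest (s.A.toList.map fun v => [v]) ∅ where
  ne_nil := by simp
  nodup := by
    rw [← List.flatMap_def, List.flatMap_singleton']; exact nodup_toList _
  mem_flatten := by simp
  isChain := by simp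
  out_notMem v hv := by simp [used, hv]
  inn_notMem v hv := by simp [used, hv]
  card := by simp
  pick := by simp
  disj := by simp

variable {s}

namespace IsForest

variable {L : List (List V)} {pk : Finset (V × V)} (h : s.IsForest L pk)
include h

lemma fst_injOn : ∀ p ∈ pk, ∀ p' ∈ pk, p.1 = p'.1 → p = p' := by
  intro p hp p' hp' e
  by_contra hne
  exact disjoint_left.1 (h.disj p hp p' hp' hne) (show Slot.out p.1 ∈ _ by simp [slots]) (by simp [slots, e])

lemma snd_injOn : ∀ p ∈ pk, ∀ p' ∈ pk, p.2 = p'.2 → p = p' := by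
  intro p hp p' hp' e
  by_contra hne
  exact disjoint_left.1 (h.disj p hp p' hp' hne) (show Slot.inn p.2 ∈ _ by simp [slots]) (by simp [slots, e])

lemma col_injOn : ∀ p ∈ pk, ∀ p' ∈ pk, s.col p.1 p.2 = s.col p'.1 p'.2 → p = p' := by
  intro p hp p' hp' e
  by_contra hne
  exact disjoint_left.1 (h.disj p hp p' hp' hne) (show Slot.col (s.col p.1 p.2) ∈ _ by simp [slots])
    (by simp [slots, e])

/-- Adding an edge from the end of one path to the start of another. -/
lemma exists_insert {u w : V} (hu : u ∈ s.A) (hw : w ∈ s.A) (huw : u ≠ w)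
    (hcl : ¬ ∃ l ∈ L, l.getLast? = some u ∧ l.head? = some w)
    (hd : Disjoint (s.slots (u, w)) (s.used pk)) :
    ∃ L', s.IsForest L' (insert (u, w) pk) := by
  obtain ⟨a, ha, hau⟩ := (h.out_notMem u hu).1 (disjoint_left.1 hd (by simp [slots]))
  obtain ⟨b, hb, hbw⟩ := (h.inn_notMem w hw).1 (disjoint_left.1 hd (by simp [slots]))
  have hab : a ≠ b := by
    rintro rfl; exact hcl ⟨a, ha, hau, hbw⟩
  obtain ⟨R, hR⟩ : ∃ R, L.Perm (a :: b :: R) :=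
    ⟨(L.erase a).erase b, (List.perm_cons_erase ha).trans
      ((List.perm_cons_erase ((List.mem_erase_of_ne hab.symm).2 hb)).cons a)⟩
  have hmem : ∀ l, l ∈ L ↔ l = a ∨ l = b ∨ l ∈ R := fun l => by rw [hR.mem_iff]; simp
  have hflat : L.flatten.Perm ((a ++ b) :: R).flatten := by simpa using hR.flatten
  have hnd : ((a ++ b) :: R).flatten.Nodup := hflat.nodup_iff.1 h.nodup
  have hnd' : (a ++ (b ++ R.flatten)).Nodup := by simpa using hnd
  have hnd2 : (b ++ (a ++ R.flatten)).Nodup := by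
    refine (List.Perm.nodup_iff ?_).1 hnd'
    rw [← List.append_assoc, ← List.append_assoc]
    exact List.perm_append_comm.append_right _
  have hau' : u ∈ a := List.mem_of_getLast? hau
  have hbw' : w ∈ b := List.mem_of_head? hbw
  have hbne := h.ne_nil b hb
  have hane := h.ne_nil a ha
  have hlast : (a ++ b).getLast? = b.getLast? := List.getLast?_append_of_ne_nil a hbne
  have hhead : (a ++ b).head? = a.head? := List.head?_append_of_ne_nil a hane
  have hpk : (u, w) ∉ pk := fun hm => disjoint_left.1 hd (show Slot.out u ∈ _ by simp [slots])
    (mem_used.2 ⟨_, hm, by simp [slots]⟩)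
  refine ⟨(a ++ b) :: R, ?_, hnd, ?_, ?_, ?_, ?_, ?_, ?_, ?_⟩
  · intro l hl
    rcases List.mem_cons.1 hl with rfl | hl
    · simp [hbne]
    · exact h.ne_nil l ((hmem l).2 (.inr (.inr hl)))
  · intro v
    rw [← hflat.mem_iff, h.mem_flatten]
  · have mono : ∀ l ∈ L, l.IsChain fun x y => (x, y) ∈ insert (u, w) pk := fun l hl =>
      (h.isChain l hl).imp fun x y hxy => mem_insert_of_mem hxy
    intro l hl
    rcases List.mem_cons.1 hl with rfl | hl
    · rw [List.isChain_append]
      refine ⟨mono a ha, mono b hb, ?_⟩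
      intro x hx y hy
      rw [hau] at hx
      rw [hbw] at hy
      simp at hx hy
      subst hx hy
      exact mem_insert_self _ _
    · exact mono l ((hmem l).2 (.inr (.inr hl)))
  · intro v hv
    rw [used_insert, notMem_union, h.out_notMem v hv]
    constructor
    · rintro ⟨h1, l, hl, hlv⟩
      have hvu : v ≠ u := by rintro rfl; exact h1 (by simp [slots])
      rcases (hmem l).1 hl with rfl | rfl | hl
      · rw [hau] at hlv; exact absurd (Option.some_injective _ hlv).symm hvu
      · exact ⟨a ++ l, by simp, hlast.trans hlv⟩
      · exact ⟨l, by simp [hl], hlv⟩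
    · rintro ⟨l, hl, hlv⟩
      have key : ∃ l ∈ L, l.getLast? = some v ∧ v ∈ b ++ R.flatten := by
        rcases List.mem_cons.1 hl with rfl | hl
        · rw [hlast] at hlv
          exact ⟨b, hb, hlv, List.mem_append_left _ (List.mem_of_getLast? hlv)⟩
        · exact ⟨l, (hmem l).2 (.inr (.inr hl)), hlv, List.mem_append_right _
            (List.mem_flatten.2 ⟨l, hl, List.mem_of_getLast? hlv⟩)⟩
      obtain ⟨l', h1, h2, h3⟩ := key
      have hvu : v ≠ u := by
        rintro rfl
        exact List.disjoint_of_nodup_append hnd' hau' h3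
      exact ⟨by simp [slots, hvu], l', h1, h2⟩
  · intro v hv
    rw [used_insert, notMem_union, h.inn_notMem v hv]
    constructor
    · rintro ⟨h1, l, hl, hlv⟩
      have hvw : v ≠ w := by rintro rfl; exact h1 (by simp [slots])
      rcases (hmem l).1 hl with rfl | rfl | hl
      · exact ⟨l ++ b, by simp, hhead.trans hlv⟩
      · rw [hbw] at hlv; exact absurd (Option.some_injective _ hlv).symm hvw
      · exact ⟨l, by simp [hl], hlv⟩
    · rintro ⟨l, hl, hlv⟩
      have key : ∃ l ∈ L, l.head? = some v ∧ v ∈ a ++ R.flatten := by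
        rcases List.mem_cons.1 hl with rfl | hl
        · rw [hhead] at hlv
          exact ⟨a, ha, hlv, List.mem_append_left _ (List.mem_of_head? hlv)⟩
        · exact ⟨l, (hmem l).2 (.inr (.inr hl)), hlv, List.mem_append_right _
            (List.mem_flatten.2 ⟨l, hl, List.mem_of_head? hlv⟩)⟩
      obtain ⟨l', h1, h2, h3⟩ := key
      have hvw : v ≠ w := by
        rintro rfl
        exact List.disjoint_of_nodup_append hnd2 hbw' h3
      exact ⟨by simp [slots, hvw], l', h1, h2⟩
  · have h1 := h.card
    have h2 := hR.length_eq
    rw [card_insert_of_notMem hpk]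
    simp at h2 ⊢
    omega
  · intro p hp
    rcases mem_insert.1 hp with rfl | hp
    · exact ⟨hu, hw, huw⟩
    · exact h.pick p hp
  · have hd' : ∀ p ∈ pk, Disjoint (s.slots (u, w)) (s.slots p) := fun p hp =>
      hd.mono_right (subset_biUnion_of_mem s.slots hp)
    intro p hp p' hp' hne
    rcases mem_insert.1 hp with rfl | hp <;> rcases mem_insert.1 hp' with rfl | hp'
    · exact absurd rfl hne
    · exact hd' _ hp'
    · exact (hd' _ hp).symm
    · exact h.disj p hp p' hp' hne

end IsForest

end Setting

end PathForest

section WeightedState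

variable {V : Type*} [Fintype V] [DecidableEq V]

namespace Setting

variable (s : Setting V)

/-- Edges of the forest into which `z` may be inserted. -/
def insIdx (pk : Finset (V × V)) (z : V) : Finset (V × V) :=
  pk.filter fun p => p.1 ≠ z ∧ p.2 ≠ z ∧ s.col z p.1 ≠ s.col z p.2

/-- Weighted number of edges of the forest into which `z` may be inserted. -/
def insVal (ω : Slot V → ℝ) (pk : Finset (V × V)) (z : V) : ℝ :=
  ∑ p ∈ s.insIdx pk z, ω (.col (s.col z p.1)) * ω (.col (s.col z p.2))

/-- The number of steps during which insertion places are guaranteed to accumulate. -/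
noncomputable def early : ℕ := ⌊s.N / 100⌋₊

/-- The deviations of the tracked statistics from their targets after `k` steps. -/
noncomputable def dev (ω : Slot V → ℝ) (pk : Finset (V × V)) (k : ℕ) :
    (TestKind × V × V × Bool) ⊕ V → ℝ
  | .inl (i, a, b, true) => s.testVal ω i a b - #(s.testIdx i a b) - s.m * k
  | .inl (i, a, b, false) => #(s.testIdx i a b) - s.testVal ω i a b - s.m * k
  | .inr z => (min k s.early : ℕ) / 4 - s.insVal ω pk z - s.m * k

/-- The invariant of the weighted process after `k` steps. -/
structure Inv (L : List (List V)) (pk : Finset (V × V)) (ω : Slot V → ℝ) (k : ℕ) : Prop where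
  forest : s.IsForest L pk
  card_eq : #pk = k
  le : (k : ℝ) ≤ (1 - s.δ) * s.N
  eq_zero : ∀ x ∈ s.used pk, ω x = 0
  one_le : ∀ x ∉ s.used pk, 1 ≤ ω x
  star : ω .star = 1
  out_one : ∀ v ∉ s.A, ω (.out v) = 1
  inn_one : ∀ v ∉ s.A, ω (.inn v) = 1
  out_inv : ∀ v ∈ s.A, .out v ∉ s.used pk →
    |(ω (.out v))⁻¹ - (1 - k / s.N)| ≤ k * (4 * s.ρ / s.N)
  inn_inv : ∀ v ∈ s.A, .inn v ∉ s.used pk →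
    |(ω (.inn v))⁻¹ - (1 - k / s.N)| ≤ k * (4 * s.ρ / s.N)
  col_inv : ∀ c, .col c ∉ s.used pk → 1 - k * ((1 - s.ε / 2) / s.N) ≤ (ω (.col c))⁻¹
  potential : ∑ t, Real.exp (s.lam * s.dev ω pk k t) ≤
    (1 + s.lam ^ 2 * (s.incMean * s.incBound)) ^ k * (18 * s.n ^ 2 + s.n)

variable {s}

namespace Inv

variable {L : List (List V)} {pk : Finset (V × V)} {ω : Slot V → ℝ} {k : ℕ}

lemma nonneg (i : s.Inv L pk ω k) (x : Slot V) : 0 ≤ ω x := by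
  by_cases hx : x ∈ s.used pk
  · rw [i.eq_zero x hx]
  · linarith [i.one_le x hx]

variable (h : s.Good) (i : s.Inv L pk ω k)
include h i

lemma div_le : (k : ℝ) / s.N ≤ 1 - s.δ := by
  rw [div_le_iff₀ h.N_pos]; exact i.le

lemma le_B (x : Slot V) : ω x ≤ s.B := by
  have hN := h.N_pos
  have hδ := h.δ_pos
  by_cases hx : x ∈ s.used pk
  · rw [i.eq_zero x hx]; exact h.B_pos.le
  have hpos : 0 < ω x := by linarith [i.one_le x hx]
  have h1 := div_le h i
  have h2 : (0 : ℝ) ≤ k / s.N := by positivity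
  suffices hs : s.δ / 2 ≤ (ω x)⁻¹ by
    rw [B, show (2 : ℝ) / s.δ = (s.δ / 2)⁻¹ by field_simp]
    exact (le_inv_comm₀ (by positivity) hpos).1 hs
  have h3 : (1 : ℝ) = 1⁻¹ := by norm_num
  have e1 : (k : ℝ) * (4 * s.ρ / s.N) = k / s.N * (4 * s.ρ) := by ring
  have e2 : (k : ℝ) * ((1 - s.ε / 2) / s.N) = k / s.N * (1 - s.ε / 2) := by ring
  have h4 : (k : ℝ) / s.N * (4 * s.ρ) ≤ 1 * (4 * s.ρ) :=
    mul_le_mul_of_nonneg_right (by linarith) (by linarith [h.ρ_pos])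
  have h5 := h.ρ_le_δ
  have h6 := h.δ_le
  have h7 := h.ε_le
  rcases x with v | v | c | _
  · by_cases hv : v ∈ s.A
    · have := (abs_le.1 (i.out_inv v hv hx)).1
      rw [e1] at this
      linarith
    · rw [i.out_one v hv, inv_one]; linarith
  · by_cases hv : v ∈ s.A
    · have := (abs_le.1 (i.inn_inv v hv hx)).1
      rw [e1] at this
      linarith
    · rw [i.inn_one v hv, inv_one]; linarith
  · have := i.col_inv c hx
    rw [e2] at this
    nlinarith
  · rw [i.star, inv_one]; linarith

lemma dev_le (t) : s.dev ω pk k t ≤ s.μ * s.n / 2 := by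
  have hn := h.n_pos
  have h0 : 0 ≤ s.lam ^ 2 * (s.incMean * s.incBound) := by
    have := h.B_pos
    have := h.m_nonneg
    have := h.π_nonneg
    have := h.one_le_Δ
    rw [incMean, incBound]
    positivity
  have hk : (k : ℝ) ≤ s.n := i.le.trans (by nlinarith [h.δ_pos, h.N_pos, Good.N_le_n (s := s)])
  have h1 : (1 + s.lam ^ 2 * (s.incMean * s.incBound)) ^ k ≤ Real.exp 1 := by
    calc _ ≤ (Real.exp (s.lam ^ 2 * (s.incMean * s.incBound))) ^ k := by
          refine pow_le_pow_left₀ (by linarith) ?_ _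
          linarith [Real.add_one_le_exp (s.lam ^ 2 * (s.incMean * s.incBound))]
      _ = Real.exp (k * (s.lam ^ 2 * (s.incMean * s.incBound))) := (Real.exp_nat_mul _ _).symm
      _ ≤ _ := by
          refine Real.exp_le_exp.2 (le_trans ?_ h.var_le)
          rw [mul_comm]
          exact mul_le_mul_of_nonneg_left hk h0
  have h2 : Real.exp (s.lam * s.dev ω pk k t) ≤ Real.exp (s.lam * (s.μ * s.n / 2)) :=
    calc _ ≤ ∑ t, Real.exp (s.lam * s.dev ω pk k t) :=
          single_le_sum (f := fun t => Real.exp (s.lam * s.dev ω pk k t))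
            (fun t _ => (Real.exp_pos _).le) (mem_univ t)
      _ ≤ Real.exp 1 * (18 * s.n ^ 2 + s.n) :=
          i.potential.trans (mul_le_mul_of_nonneg_right h1 (by positivity))
      _ ≤ _ := by rw [mul_comm]; exact h.tests_le
  exact le_of_mul_le_mul_left (Real.exp_le_exp.1 h2) h.lam_pos

lemma drift_mul_le : s.m * k ≤ s.μ * s.n / 2 := by
  have hk : (k : ℝ) ≤ s.n := i.le.trans (by nlinarith [h.δ_pos, h.N_pos, Good.N_le_n (s := s)])
  calc s.m * k ≤ s.μ / 2 * s.n := mul_le_mul h.drift_le hk (by positivity) (by linarith [h.μ_pos])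
    _ = _ := by ring

lemma testVal_le (j : TestKind) (a b : V) :
    s.testVal ω j a b ≤ #(s.testIdx j a b) + s.μ * s.n := by
  have h1 := dev_le h i (.inl (j, a, b, true))
  have h2 := drift_mul_le h i
  rw [dev] at h1
  linarith

lemma le_testVal (j : TestKind) (a b : V) :
    #(s.testIdx j a b) - s.μ * s.n ≤ s.testVal ω j a b := by
  have h1 := dev_le h i (.inl (j, a, b, false))
  have h2 := drift_mul_le h i
  rw [dev] at h1
  linarith

lemma le_insVal (z : V) : ((min k s.early : ℕ) : ℝ) / 4 - s.μ * s.n ≤ s.insVal ω pk z := by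
  have h1 := dev_le h i (.inr z)
  have h2 := drift_mul_le h i
  rw [dev] at h1
  linarith

end Inv

lemma inv_zero (h : s.Good) (hδ : s.δ ≤ 1) : s.Inv (s.A.toList.map fun v => [v]) ∅ (fun _ => 1) 0 where
  forest := s.isForest_singletons
  card_eq := card_empty
  le := by have := h.N_pos; push_cast; exact mul_nonneg (by linarith) this.le
  eq_zero := by simp [used]
  one_le := by simp
  star := rfl
  out_one _ _ := rfl
  inn_one _ _ := rfl
  out_inv := by simp
  inn_inv := by simp
  col_inv := by simp
  potential := by
    have e : ∀ t, s.dev (fun _ => 1) ∅ 0 t = 0 := by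
      rintro (⟨i, a, b, _ | _⟩ | z) <;> simp [dev, testVal, insVal, insIdx]
    simp only [e, mul_zero, Real.exp_zero, sum_const, card_univ, nsmul_eq_mul, mul_one, pow_zero,
      one_mul, Fintype.card_sum, Fintype.card_prod, card_testKind, Fintype.card_bool, n]
    push_cast
    exact le_of_eq (by ring)

end Setting

end WeightedState

section WeightedOptions

variable {V : Type*} [Fintype V] [DecidableEq V]

namespace Setting

variable (s : Setting V)

open Classical in
/-- The edges which may be added to the forest without closing a cycle. -/
noncomputable def opts (L : List (List V)) : Finset (V × V) :=
  univ.filter fun o => (o.1 ∈ s.A ∧ o.2 ∈ s.A ∧ o.1 ≠ o.2) ∧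
    ¬ ∃ l ∈ L, l.getLast? = some o.1 ∧ l.head? = some o.2

/-- The weight of an edge. -/
def wt (ω : Slot V → ℝ) (o : V × V) : ℝ :=
  ω (.out o.1) * (ω (.inn o.2) * ω (.col (s.col o.1 o.2)))

/-- The total weight of the options. -/
noncomputable def tot (L : List (List V)) (ω : Slot V → ℝ) : ℝ := ∑ o ∈ s.opts L, s.wt ω o

/-- The probability of an option. -/
noncomputable def prob (L : List (List V)) (ω : Slot V → ℝ) (o : V × V) : ℝ :=
  s.wt ω o / s.tot L ω

variable {s}

lemma mem_opts {L : List (List V)} {o : V × V} : o ∈ s.opts L ↔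
    (o.1 ∈ s.A ∧ o.2 ∈ s.A ∧ o.1 ≠ o.2) ∧
      ¬ ∃ l ∈ L, l.getLast? = some o.1 ∧ l.head? = some o.2 := by
  simp [opts]

lemma IsForest.eq_of_mem {L : List (List V)} {pk : Finset (V × V)} (h : s.IsForest L pk)
    {l l' : List V} (hl : l ∈ L) (hl' : l' ∈ L) {v : V} (hv : v ∈ l) (hv' : v ∈ l') : l = l' := by
  by_contra hne
  have : Std.Symm (List.Disjoint (α := V)) := ⟨fun _ _ h => h.symm⟩
  exact (List.nodup_flatten.1 h.nodup).2.forall hl hl' hne hv hv'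

lemma sum_bounds_of_card_sdiff_le_one {α : Type*} [DecidableEq α] (F G : Finset α) (hFG : F ⊆ G)
    (hc : #(G \ F) ≤ 1) (f : α → ℝ) (M : ℝ) (hM : 0 ≤ M) (hf0 : ∀ a, 0 ≤ f a) (hf : ∀ a, f a ≤ M) :
    ∑ a ∈ G, f a - M ≤ ∑ a ∈ F, f a ∧ ∑ a ∈ F, f a ≤ ∑ a ∈ G, f a := by
  have h1 := sum_sdiff (f := f) hFG
  have h2 : 0 ≤ ∑ a ∈ G \ F, f a := sum_nonneg fun a _ => hf0 a
  have h3 : ∑ a ∈ G \ F, f a ≤ M := by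
    rcases eq_empty_or_nonempty (G \ F) with he | ⟨a, ha⟩
    · rw [he, sum_empty]
      exact hM
    · have : G \ F = {a} := by
        refine (eq_singleton_iff_unique_mem.2 ⟨ha, fun b hb => card_le_one.1 hc b hb a ha⟩)
      rw [this, sum_singleton]
      exact hf a
  constructor <;> linarith

namespace Inv

variable {L : List (List V)} {pk : Finset (V × V)} {ω : Slot V → ℝ} {k : ℕ}

lemma wt_nonneg (i : s.Inv L pk ω k) (o : V × V) : 0 ≤ s.wt ω o :=
  mul_nonneg (i.nonneg _) (mul_nonneg (i.nonneg _) (i.nonneg _))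

variable (h : s.Good) (i : s.Inv L pk ω k)
include h i

lemma pair_le (x y : Slot V) : ω x * ω y ≤ s.B ^ 2 := by
  rw [sq]
  exact mul_le_mul (le_B h i x) (le_B h i y) (i.nonneg _) h.B_pos.le

lemma wt_le (o : V × V) : s.wt ω o ≤ s.B ^ 3 := by
  rw [wt, pow_succ']
  exact mul_le_mul (le_B h i _) (pair_le h i _ _) (mul_nonneg (i.nonneg _) (i.nonneg _)) h.B_pos.le

lemma outSum_bounds {v : V} (hv : v ∈ s.A) :
    (1 - s.ρ) * s.N ≤ ∑ o ∈ (s.opts L).filter (fun o => o.1 = v),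
      ω (.inn o.2) * ω (.col (s.col o.1 o.2)) ∧
    ∑ o ∈ (s.opts L).filter (fun o => o.1 = v),
      ω (.inn o.2) * ω (.col (s.col o.1 o.2)) ≤ (1 + s.ρ) * s.N := by
  have h1 := sum_bounds_of_card_sdiff_le_one ((s.opts L).filter (fun o => o.1 = v))
    (s.testIdx .dOut v v) (by
      intro o ho
      obtain ⟨ho', rfl⟩ := mem_filter.1 ho
      have := (mem_opts.1 ho').1
      simp [testIdx, this.2.1, this.2.2.symm]) (by
      refine card_le_one.2 fun a ha b hb => ?_
      simp only [testIdx, mem_sdiff, mem_filter, mem_univ, true_and, mem_opts, not_and] at ha hb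
      obtain ⟨⟨ha1, ha2, ha3⟩, ha4⟩ := ha
      obtain ⟨⟨hb1, hb2, hb3⟩, hb4⟩ := hb
      have ha5 : ∃ l ∈ L, l.getLast? = some a.1 ∧ l.head? = some a.2 := by
        by_contra hc
        exact ha4 ⟨⟨ha1 ▸ hv, ha2, ha1 ▸ ha3.symm⟩, hc⟩ ha1
      have hb5 : ∃ l ∈ L, l.getLast? = some b.1 ∧ l.head? = some b.2 := by
        by_contra hc
        exact hb4 ⟨⟨hb1 ▸ hv, hb2, hb1 ▸ hb3.symm⟩, hc⟩ hb1
      obtain ⟨l, hl, hl1, hl2⟩ := ha5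
      obtain ⟨l', hl', hl1', hl2'⟩ := hb5
      have hab : a.1 = b.1 := ha1.trans hb1.symm
      have : l = l' := i.forest.eq_of_mem hl hl' (List.mem_of_getLast? hl1)
        (hab ▸ List.mem_of_getLast? hl1')
      subst this
      rw [hl2] at hl2'
      exact Prod.ext hab (Option.some_injective _ hl2'))
    (fun o => ω (.inn o.2) * ω (.col (s.col o.1 o.2))) (s.B ^ 2)
    (sq_nonneg _) (fun o => mul_nonneg (i.nonneg _) (i.nonneg _)) (fun o => pair_le h i _ _)
  have e : ∑ o ∈ s.testIdx .dOut v v, ω (.inn o.2) * ω (.col (s.col o.1 o.2)) =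
      s.testVal ω .dOut v v := by
    refine sum_congr rfl fun o ho => ?_
    simp only [testIdx, mem_filter] at ho
    simp [testFst, testSnd, ho.2.1]
  have hc : (#(s.testIdx .dOut v v) : ℝ) = s.N - 1 := by
    have : s.testIdx .dOut v v = (s.A.erase v).image fun w => (v, w) := by
      ext ⟨a, b⟩; simp [testIdx]; tauto
    rw [this, card_image_of_injective _ (fun a b hab => (Prod.ext_iff.1 hab).2),
      card_erase_of_mem hv, Nat.cast_sub (card_pos.2 ⟨v, hv⟩), N]
    simp
  have h2 := testVal_le h i .dOut v v
  have h3 := le_testVal h i .dOut v v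
  have h4 := h.err_le
  have h5 := sq_nonneg s.B
  simp only [e, hc] at h1 h2 h3
  constructor <;> linarith

lemma inSum_bounds {v : V} (hv : v ∈ s.A) :
    (1 - s.ρ) * s.N ≤ ∑ o ∈ (s.opts L).filter (fun o => o.2 = v),
      ω (.out o.1) * ω (.col (s.col o.1 o.2)) ∧
    ∑ o ∈ (s.opts L).filter (fun o => o.2 = v),
      ω (.out o.1) * ω (.col (s.col o.1 o.2)) ≤ (1 + s.ρ) * s.N := by
  have h1 := sum_bounds_of_card_sdiff_le_one ((s.opts L).filter (fun o => o.2 = v))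
    (s.testIdx .dIn v v) (by
      intro o ho
      obtain ⟨ho', rfl⟩ := mem_filter.1 ho
      have := (mem_opts.1 ho').1
      simp [testIdx, this.1, this.2.2]) (by
      refine card_le_one.2 fun a ha b hb => ?_
      simp only [testIdx, mem_sdiff, mem_filter, mem_univ, true_and, mem_opts, not_and] at ha hb
      obtain ⟨⟨ha1, ha2, ha3⟩, ha4⟩ := ha
      obtain ⟨⟨hb1, hb2, hb3⟩, hb4⟩ := hb
      have ha5 : ∃ l ∈ L, l.getLast? = some a.1 ∧ l.head? = some a.2 := by
        by_contra hc
        exact ha4 ⟨⟨ha2, ha1 ▸ hv, ha1 ▸ ha3⟩, hc⟩ ha1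
      have hb5 : ∃ l ∈ L, l.getLast? = some b.1 ∧ l.head? = some b.2 := by
        by_contra hc
        exact hb4 ⟨⟨hb2, hb1 ▸ hv, hb1 ▸ hb3⟩, hc⟩ hb1
      obtain ⟨l, hl, hl1, hl2⟩ := ha5
      obtain ⟨l', hl', hl1', hl2'⟩ := hb5
      have hab : a.2 = b.2 := ha1.trans hb1.symm
      have : l = l' := i.forest.eq_of_mem hl hl' (List.mem_of_head? hl2)
        (hab ▸ List.mem_of_head? hl2')
      subst this
      rw [hl1] at hl1'
      exact Prod.ext (Option.some_injective _ hl1') hab)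
    (fun o => ω (.out o.1) * ω (.col (s.col o.1 o.2))) (s.B ^ 2)
    (sq_nonneg _) (fun o => mul_nonneg (i.nonneg _) (i.nonneg _)) (fun o => pair_le h i _ _)
  have e : ∑ o ∈ s.testIdx .dIn v v, ω (.out o.1) * ω (.col (s.col o.1 o.2)) =
      s.testVal ω .dIn v v := by
    refine sum_congr rfl fun o ho => ?_
    simp only [testIdx, mem_filter] at ho
    simp [testFst, testSnd, ho.2.1, h.symm v o.1]
  have hc : (#(s.testIdx .dIn v v) : ℝ) = s.N - 1 := by
    have : s.testIdx .dIn v v = (s.A.erase v).image fun w => (w, v) := by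
      ext ⟨a, b⟩; simp [testIdx]; grind
    rw [this, card_image_of_injective _ (fun a b hab => (Prod.ext_iff.1 hab).1),
      card_erase_of_mem hv, Nat.cast_sub (card_pos.2 ⟨v, hv⟩), N]
    simp
  have h2 := testVal_le h i .dIn v v
  have h3 := le_testVal h i .dIn v v
  have h4 := h.err_le
  have h5 := sq_nonneg s.B
  simp only [e, hc] at h1 h2 h3
  constructor <;> linarith

lemma colSum_le (c : ℕ) :
    ∑ o ∈ (s.opts L).filter (fun o => s.col o.1 o.2 = c), ω (.out o.1) * ω (.inn o.2) ≤
      (1 - s.ε / 2) * ((1 - s.ρ) ^ 2 * s.N) := by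
  rcases eq_empty_or_nonempty ((s.opts L).filter (fun o => s.col o.1 o.2 = c)) with he | ⟨⟨a, b⟩, hab⟩
  · rw [he, sum_empty]
    have := h.ε_le
    have := h.N_pos
    have : 0 ≤ 1 - s.ε / 2 := by linarith
    positivity
  · refine le_trans ?_ h.cls_err_le
    obtain ⟨_, hc⟩ := mem_filter.1 hab
    simp only at hc
    have h1 : ∑ o ∈ (s.opts L).filter (fun o => s.col o.1 o.2 = c), ω (.out o.1) * ω (.inn o.2) ≤
        s.testVal ω .cls a b := by
      refine sum_le_sum_of_subset_of_nonneg (fun o ho => ?_)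
        fun o _ _ => mul_nonneg (i.nonneg _) (i.nonneg _)
      obtain ⟨ho, hoc⟩ := mem_filter.1 ho
      obtain ⟨⟨h1, h2, h3⟩, -⟩ := mem_opts.1 ho
      simp [testIdx, h1, h2, h3, hoc, hc]
    refine (h1.trans (testVal_le h i .cls a b)).trans (add_le_add ?_ le_rfl)
    refine le_trans ?_ (h.cls_le c)
    refine Nat.cast_le.2 (card_le_card fun o ho => ?_)
    simp only [testIdx, mem_filter] at ho ⊢
    rw [← hc]
    exact ⟨ho.1, ho.2.1⟩

lemma tot_bounds : (1 - s.ρ) ^ 2 * s.N ^ 2 ≤ s.tot L ω ∧ s.tot L ω ≤ (1 + s.ρ) ^ 2 * s.N ^ 2 := by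
  have hN := h.N_pos
  have hρ := h.ρ_pos
  have hρ1 := h.ρ_le
  have e : s.tot L ω = ∑ v ∈ s.A, ω (.out v) * ∑ o ∈ (s.opts L).filter (fun o => o.1 = v),
      ω (.inn o.2) * ω (.col (s.col o.1 o.2)) := by
    rw [tot, ← sum_fiberwise_of_maps_to (g := Prod.fst) (t := s.A)
      (fun o ho => (mem_opts.1 ho).1.1)]
    refine sum_congr rfl fun v _ => ?_
    rw [mul_sum]
    refine sum_congr rfl fun o ho => ?_
    rw [wt, (mem_filter.1 ho).2]
  obtain ⟨a₀, ha₀⟩ : s.A.Nonempty := by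
    rw [← card_pos]; exact_mod_cast (show (0 : ℝ) < #s.A from hN)
  have e2 : s.testVal ω .sumOut a₀ a₀ = ∑ v ∈ s.A, ω (.out v) := by
    have : s.testIdx .sumOut a₀ a₀ = s.A.image fun v => (v, a₀) := by
      ext ⟨a, b⟩; simp [testIdx]; grind
    rw [testVal, this, sum_image (by simp)]
    simp [testFst, testSnd, i.star]
  have hc : (#(s.testIdx .sumOut a₀ a₀) : ℝ) = s.N := by
    have : s.testIdx .sumOut a₀ a₀ = s.A.image fun v => (v, a₀) := by
      ext ⟨a, b⟩; simp [testIdx]; grind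
    rw [this, card_image_of_injective _ (fun a b hab => (Prod.ext_iff.1 hab).1), N]
  have h2 := testVal_le h i .sumOut a₀ a₀
  have h3 := le_testVal h i .sumOut a₀ a₀
  rw [e2, hc] at h2 h3
  have h4 := h.err_le
  have h5 := sq_nonneg s.B
  rw [e]
  constructor
  · calc (1 - s.ρ) ^ 2 * s.N ^ 2 = ((1 - s.ρ) * s.N) * ((1 - s.ρ) * s.N) := by ring
      _ ≤ (∑ v ∈ s.A, ω (.out v)) * ((1 - s.ρ) * s.N) :=
        mul_le_mul_of_nonneg_right (by linarith) (mul_nonneg (by linarith) hN.le)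
      _ ≤ _ := by
        rw [sum_mul]
        exact sum_le_sum fun v hv => mul_le_mul_of_nonneg_left (outSum_bounds h i hv).1 (i.nonneg _)
  · calc _ ≤ (∑ v ∈ s.A, ω (.out v)) * ((1 + s.ρ) * s.N) := by
          rw [sum_mul]
          exact sum_le_sum fun v hv =>
            mul_le_mul_of_nonneg_left (outSum_bounds h i hv).2 (i.nonneg _)
      _ ≤ ((1 + s.ρ) * s.N) * ((1 + s.ρ) * s.N) :=
        mul_le_mul_of_nonneg_right (by linarith) (mul_nonneg (by linarith) hN.le)
      _ = _ := by ring

lemma tot_pos : 0 < s.tot L ω := by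
  refine lt_of_lt_of_le ?_ (tot_bounds h i).1
  have := h.ρ_le
  have := h.N_pos
  have : 0 < 1 - s.ρ := by linarith
  positivity

lemma sum_prob : ∑ o ∈ s.opts L, s.prob L ω o = 1 := by
  simp_rw [prob]
  rw [← sum_div]
  exact div_self (tot_pos h i).ne'

lemma prob_nonneg (o : V × V) : 0 ≤ s.prob L ω o := div_nonneg (i.wt_nonneg o) (tot_pos h i).le

end Inv

end Setting

end WeightedOptions

section WeightedHits

variable {V : Type*} [Fintype V] [DecidableEq V]

namespace Setting

variable {s : Setting V}

lemma abs_div_sub_inv_le {r N D T : ℝ} (hr : 0 < r) (hr1 : r ≤ 1 / 100) (hN : 0 < N)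
    (hD : (1 - r) * N ≤ D ∧ D ≤ (1 + r) * N)
    (hT : (1 - r) ^ 2 * N ^ 2 ≤ T ∧ T ≤ (1 + r) ^ 2 * N ^ 2) :
    |D / T - 1 / N| ≤ 4 * r / N := by
  obtain ⟨hD1, hD2⟩ := hD
  obtain ⟨hT1, hT2⟩ := hT
  have h1 : 0 < 1 - r := by linarith
  have hT0 : 0 < T := lt_of_lt_of_le (by positivity) hT1
  rw [abs_le]
  constructor
  · have : (1 - 4 * r) / N ≤ D / T := by
      rw [div_le_div_iff₀ hN hT0]
      calc (1 - 4 * r) * T ≤ (1 - 4 * r) * ((1 + r) ^ 2 * N ^ 2) :=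
            mul_le_mul_of_nonneg_left hT2 (by linarith)
        _ = ((1 - 4 * r) * (1 + r) ^ 2) * N ^ 2 := by ring
        _ ≤ (1 - r) * N ^ 2 := mul_le_mul_of_nonneg_right (by nlinarith [sq_nonneg r, pow_pos hr 3])
            (by positivity)
        _ = (1 - r) * N * N := by ring
        _ ≤ D * N := mul_le_mul_of_nonneg_right hD1 hN.le
    have e : (1 - 4 * r) / N = 1 / N - 4 * r / N := by ring
    linarith
  · have : D / T ≤ (1 + 4 * r) / N := by
      rw [div_le_div_iff₀ hT0 hN]
      calc D * N ≤ (1 + r) * N * N := mul_le_mul_of_nonneg_right hD2 hN.le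
        _ = (1 + r) * N ^ 2 := by ring
        _ ≤ ((1 + 4 * r) * (1 - r) ^ 2) * N ^ 2 :=
            mul_le_mul_of_nonneg_right (by nlinarith [sq_nonneg r, pow_pos hr 3]) (by positivity)
        _ = (1 + 4 * r) * ((1 - r) ^ 2 * N ^ 2) := by ring
        _ ≤ _ := mul_le_mul_of_nonneg_left hT1 (by linarith)
    have e : (1 + 4 * r) / N = 1 / N + 4 * r / N := by ring
    linarith

namespace Inv

variable {L : List (List V)} {pk : Finset (V × V)} {ω : Slot V → ℝ} {k : ℕ}

/-- The probability that a slot is used in the next step. -/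
noncomputable abbrev hit (_ : s.Inv L pk ω k) (x : Slot V) : ℝ :=
  hitProb (s.opts L) (s.prob L ω) s.slots x

lemma hit_eq (i : s.Inv L pk ω k) (x : Slot V) (p : V × V → Prop) [DecidablePred p] (g : V × V → ℝ)
    (hp : ∀ o, x ∈ s.slots o ↔ p o) (hg : ∀ o, p o → s.wt ω o = ω x * g o) :
    i.hit x = ω x * ((∑ o ∈ (s.opts L).filter p, g o) / s.tot L ω) := by
  rw [hit, hitProb, sum_filter, sum_div, mul_sum]
  refine sum_congr rfl fun o _ => ?_
  simp only [hp]
  split_ifs with ho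
  · rw [prob, hg o ho, mul_div_assoc]
  · simp

lemma hit_star (i : s.Inv L pk ω k) : i.hit .star = 0 :=
  sum_eq_zero fun o _ => if_neg (Good.star_notMem_slots o)

lemma hit_out_of_notMem (i : s.Inv L pk ω k) {v : V} (hv : v ∉ s.A) : i.hit (.out v) = 0 :=
  sum_eq_zero fun o ho => if_neg fun hx => hv (by
    have : v = o.1 := by simpa [slots] using hx
    exact this ▸ (mem_opts.1 ho).1.1)

lemma hit_inn_of_notMem (i : s.Inv L pk ω k) {v : V} (hv : v ∉ s.A) : i.hit (.inn v) = 0 :=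
  sum_eq_zero fun o ho => if_neg fun hx => hv (by
    have : v = o.2 := by simpa [slots] using hx
    exact this ▸ (mem_opts.1 ho).1.2.1)

variable (h : s.Good) (i : s.Inv L pk ω k)
include h

lemma hit_out {v : V} (hv : v ∈ s.A) :
    ∃ r, i.hit (.out v) = ω (.out v) * r ∧ |r - 1 / s.N| ≤ 4 * s.ρ / s.N :=
  ⟨_, i.hit_eq _ (fun o => o.1 = v) (fun o => ω (.inn o.2) * ω (.col (s.col o.1 o.2)))
    (fun o => by simp [slots, eq_comm]) (fun o ho => by rw [wt, ho]),
    abs_div_sub_inv_le h.ρ_pos h.ρ_le h.N_pos (outSum_bounds h i hv) (tot_bounds h i)⟩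

lemma hit_inn {v : V} (hv : v ∈ s.A) :
    ∃ r, i.hit (.inn v) = ω (.inn v) * r ∧ |r - 1 / s.N| ≤ 4 * s.ρ / s.N :=
  ⟨_, i.hit_eq _ (fun o => o.2 = v) (fun o => ω (.out o.1) * ω (.col (s.col o.1 o.2)))
    (fun o => by simp [slots, eq_comm]) (fun o ho => by rw [wt, ho]; ring),
    abs_div_sub_inv_le h.ρ_pos h.ρ_le h.N_pos (inSum_bounds h i hv) (tot_bounds h i)⟩

lemma hit_col (c : ℕ) :
    ∃ r, i.hit (.col c) = ω (.col c) * r ∧ 0 ≤ r ∧ r ≤ (1 - s.ε / 2) / s.N := by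
  refine ⟨_, i.hit_eq _ (fun o => s.col o.1 o.2 = c) (fun o => ω (.out o.1) * ω (.inn o.2))
    (fun o => by simp [slots, eq_comm]) (fun o ho => by rw [wt, ho]; ring),
    div_nonneg (sum_nonneg fun o _ => mul_nonneg (i.nonneg _) (i.nonneg _)) (tot_pos h i).le, ?_⟩
  have hN := h.N_pos
  have hε := h.ε_le
  rw [div_le_div_iff₀ (tot_pos h i) hN]
  calc _ ≤ (1 - s.ε / 2) * ((1 - s.ρ) ^ 2 * s.N) * s.N :=
        mul_le_mul_of_nonneg_right (colSum_le h i c) hN.le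
    _ = (1 - s.ε / 2) * ((1 - s.ρ) ^ 2 * s.N ^ 2) := by ring
    _ ≤ _ := mul_le_mul_of_nonneg_left (tot_bounds h i).1 (by linarith)

lemma hit_le (x : Slot V) : i.hit x ≤ s.π := by
  have hN := h.N_pos
  have key : ∀ r, r ≤ 4 / s.n → ω x * r ≤ s.π := by
    intro r hr
    have hn := h.n_pos
    calc ω x * r ≤ ω x * (4 / s.n) := mul_le_mul_of_nonneg_left hr (i.nonneg _)
      _ ≤ s.B * (4 / s.n) := mul_le_mul_of_nonneg_right (le_B h i x) (by positivity)
      _ ≤ s.π := by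
        rw [π, mul_div_assoc', mul_comm]
        exact div_le_div_of_nonneg_right (by linarith [h.B_pos]) hn.le
  have hN2 : 2 / s.N ≤ 4 / s.n := by
    rw [div_le_div_iff₀ hN h.n_pos]; linarith [h.n_le]
  have hr : ∀ r, |r - 1 / s.N| ≤ 4 * s.ρ / s.N → r ≤ 4 / s.n := by
    intro r hr
    refine le_trans ?_ hN2
    have h1 := (abs_le.1 hr).2
    have h2 : 4 * s.ρ / s.N ≤ 1 / s.N := div_le_div_of_nonneg_right (by linarith [h.ρ_le]) hN.le
    have h3 : 2 / s.N = 1 / s.N + 1 / s.N := by ring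
    linarith
  rcases x with v | v | c | _
  · by_cases hv : v ∈ s.A
    · obtain ⟨r, h1, h2⟩ := hit_out h i hv
      rw [h1]; exact key r (hr r h2)
    · rw [i.hit_out_of_notMem hv]; exact h.π_nonneg
  · by_cases hv : v ∈ s.A
    · obtain ⟨r, h1, h2⟩ := hit_inn h i hv
      rw [h1]; exact key r (hr r h2)
    · rw [i.hit_inn_of_notMem hv]; exact h.π_nonneg
  · obtain ⟨r, h1, -, h2⟩ := hit_col h i c
    rw [h1]
    refine key r (h2.trans (le_trans ?_ hN2))
    exact div_le_div_of_nonneg_right (by linarith [h.ε_pos]) hN.le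
  · rw [i.hit_star]; exact h.π_nonneg

include i in
lemma stepBounds : StepBounds (s.opts L) (s.prob L ω) s.slots ω s.B s.π s.q where
  nonneg o _ := prob_nonneg h i o
  total := sum_prob h i
  weight_nonneg := i.nonneg
  weight_le := le_B h i
  hit_le := hit_le h i
  pi_nonneg := h.π_nonneg
  pi_le := h.pi_le
  joint_le x y hxy := by
    have hN := h.N_pos
    have hn := h.n_pos
    have hB := h.B_pos
    have ht := tot_pos h i
    have hP : ∀ o, s.prob L ω o ≤ s.B ^ 3 * 8 / s.n ^ 2 := by
      intro o
      rw [prob, div_le_div_iff₀ ht (by positivity)]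
      have h1 : s.n ^ 2 ≤ 8 * s.tot L ω := by
        have h2 := (tot_bounds h i).1
        have h3 : s.n ^ 2 ≤ (2 * s.N) ^ 2 := pow_le_pow_left₀ hn.le h.n_le 2
        have h4 : (1 / 2 : ℝ) ≤ (1 - s.ρ) ^ 2 := by nlinarith [h.ρ_le, h.ρ_pos]
        nlinarith [mul_le_mul_of_nonneg_right h4 (sq_nonneg s.N)]
      calc s.wt ω o * s.n ^ 2 ≤ s.B ^ 3 * (8 * s.tot L ω) :=
            mul_le_mul (wt_le h i o) h1 (by positivity) (by positivity)
        _ = _ := by ring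
    have hnn : 0 ≤ s.B ^ 3 * 8 / s.n ^ 2 := by positivity
    calc _ = ∑ o ∈ (s.opts L).filter (fun o => x ∈ s.slots o ∧ y ∈ s.slots o), s.prob L ω o :=
          (sum_filter _ _).symm
      _ ≤ #((s.opts L).filter (fun o => x ∈ s.slots o ∧ y ∈ s.slots o)) *
          (s.B ^ 3 * 8 / s.n ^ 2) := by
          rw [← nsmul_eq_mul]; exact sum_le_card_nsmul _ _ _ fun o _ => hP o
      _ ≤ s.Δ * (s.B ^ 3 * 8 / s.n ^ 2) := by
          refine mul_le_mul_of_nonneg_right (le_trans ?_ (h.card_joint_le x y hxy)) hnn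
          refine Nat.cast_le.2 (card_le_card fun o ho => ?_)
          obtain ⟨h1, h2⟩ := mem_filter.1 ho
          exact mem_filter.2 ⟨mem_univ _, (mem_opts.1 h1).1.2.2, h2⟩
      _ = s.q := by rw [q]; ring

omit h in
include i in
/-- A selected edge is disjoint from the earlier ones. -/
lemma disjoint_of_prob_pos {o : V × V} (ho : 0 < s.prob L ω o) :
    Disjoint (s.slots o) (s.used pk) := by
  rw [disjoint_left]
  intro x hx hu
  have h0 := i.eq_zero x hu
  have : s.wt ω o = 0 := by
    rw [wt]
    simp only [slots, mem_insert, mem_singleton] at hx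
    rcases hx with rfl | rfl | rfl <;> simp [h0]
  rw [prob, this, zero_div] at ho
  exact lt_irrefl _ ho

omit h in
lemma inv_upd {o : V × V} {x : Slot V} (hx : x ∉ s.slots o) (r : ℝ) (hr : i.hit x = ω x * r)
    (hu : x ∉ s.used pk) :
    (updWeight (s.opts L) (s.prob L ω) s.slots o ω x)⁻¹ = (ω x)⁻¹ - r := by
  have h0 : 0 < ω x := by linarith [i.one_le x hu]
  rw [updWeight, if_neg hx, inv_div, show hitProb (s.opts L) (s.prob L ω) s.slots x = ω x * r from hr,
    sub_div, mul_div_cancel_left₀ _ h0.ne', one_div]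

end Inv

end Setting

end WeightedHits

section WeightedEarly

variable {V : Type*} [Fintype V] [DecidableEq V]

omit [Fintype V] in
lemma card_le_mul_of_fst_fiber (A : Finset V) (F : Finset (V × V)) (M : ℝ) (hF : ∀ o ∈ F, o.1 ∈ A)
    (hM : ∀ u ∈ A, (#(F.filter fun o => o.1 = u) : ℝ) ≤ M) : (#F : ℝ) ≤ #A * M := by
  rw [card_eq_sum_card_fiberwise (f := Prod.fst) (t := A) hF, Nat.cast_sum, ← nsmul_eq_mul]
  exact sum_le_card_nsmul _ _ _ hM

omit [Fintype V] in
lemma card_le_mul_of_snd_fiber (A : Finset V) (F : Finset (V × V)) (M : ℝ) (hF : ∀ o ∈ F, o.2 ∈ A)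
    (hM : ∀ u ∈ A, (#(F.filter fun o => o.2 = u) : ℝ) ≤ M) : (#F : ℝ) ≤ #A * M := by
  rw [card_eq_sum_card_fiberwise (f := Prod.snd) (t := A) hF, Nat.cast_sum, ← nsmul_eq_mul]
  exact sum_le_card_nsmul _ _ _ hM

namespace Setting

variable {s : Setting V}

namespace Inv

variable {L : List (List V)} {pk : Finset (V × V)} {ω : Slot V → ℝ} {k : ℕ}

/-- The weight which the new edge `o` contributes to the insertion statistic of `z`. -/
noncomputable def gain (_ : s.Inv L pk ω k) (z : V) (o : V × V) : ℝ :=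
  if o.1 ≠ z ∧ o.2 ≠ z ∧ s.col z o.1 ≠ s.col z o.2 then
    updWeight (s.opts L) (s.prob L ω) s.slots o ω (.col (s.col z o.1)) *
      updWeight (s.opts L) (s.prob L ω) s.slots o ω (.col (s.col z o.2)) else 0

variable (h : s.Good) (i : s.Inv L pk ω k)
include h

include i in
lemma le_upd {o : V × V} {x : Slot V} (hx : x ∉ s.slots o) :
    ω x ≤ updWeight (s.opts L) (s.prob L ω) s.slots o ω x := by
  have sb := stepBounds h i
  have h1 := sb.hit_le x
  have h2 := h.pi_le
  have h3 := hitProb_nonneg (S := s.slots) sb.nonneg x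
  rw [updWeight, if_neg hx, le_div_iff₀ (by linarith)]
  nlinarith [i.nonneg x]

lemma gain_nonneg (z : V) (o : V × V) : 0 ≤ i.gain z o := by
  rw [gain]
  split_ifs
  · exact mul_nonneg ((stepBounds h i).upd_nonneg _ _) ((stepBounds h i).upd_nonneg _ _)
  · exact le_rfl

lemma gain_le (z : V) (o : V × V) : i.gain z o ≤ 2 * s.B ^ 2 := by
  have sb := stepBounds h i
  have hB := h.B_pos
  rw [gain]
  split_ifs
  · calc _ ≤ (4 / 3 * s.B) * (4 / 3 * s.B) :=
          mul_le_mul (sb.upd_le _ _) (sb.upd_le _ _) (sb.upd_nonneg _ _) (by positivity)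
      _ ≤ _ := by nlinarith [sq_nonneg s.B]
  · positivity

include i in
lemma card_dead_nbr_le (hk : (k : ℝ) ≤ s.N / 100) (z : V) :
    (#(s.A.filter fun v => v ≠ z ∧ .col (s.col z v) ∈ s.used pk) : ℝ) ≤ s.N / 50 := by
  have hN := h.N_pos
  set I := s.A.erase z with hI
  set D := s.A.filter fun v => v ≠ z ∧ .col (s.col z v) ∈ s.used pk with hD
  have hDI : D ⊆ I := fun v hv => by
    obtain ⟨h1, h2, -⟩ := mem_filter.1 hv
    exact mem_erase.2 ⟨h2, h1⟩
  have hidx : s.testIdx .nbrA z z = I.image fun v => (z, v) := by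
    ext ⟨a, b⟩; simp [testIdx, hI]; grind
  have hval : s.testVal ω .nbrA z z = ∑ v ∈ I, ω (.col (s.col z v)) := by
    rw [testVal, hidx, sum_image (by simp)]
    simp [testFst, testSnd, i.star]
  have hcard : #(s.testIdx .nbrA z z) = #I := by
    rw [hidx, card_image_of_injective _ (fun a b hab => (Prod.ext_iff.1 hab).2)]
  have h1 := le_testVal h i .nbrA z z
  have h2 : ∑ v ∈ I, ω (.col (s.col z v)) ≤ #(I \ D) * (100 / 99 : ℝ) := by
    rw [← sum_sdiff hDI, sum_eq_zero (s := D) (fun v hv => i.eq_zero _ (mem_filter.1 hv).2.2),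
      add_zero, ← nsmul_eq_mul]
    refine sum_le_card_nsmul _ _ _ fun v hv => ?_
    obtain ⟨hv1, hv2⟩ := mem_sdiff.1 hv
    obtain ⟨hv3, hv4⟩ := mem_erase.1 hv1
    have hv5 : .col (s.col z v) ∉ s.used pk := fun hu => hv2 (mem_filter.2 ⟨hv4, hv3, hu⟩)
    have h3 := i.col_inv _ hv5
    have h4 := i.one_le _ hv5
    have h5 : (99 / 100 : ℝ) ≤ (ω (.col (s.col z v)))⁻¹ := by
      have : (k : ℝ) * ((1 - s.ε / 2) / s.N) ≤ s.N / 100 * (1 / s.N) := by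
        refine mul_le_mul hk ?_ ?_ (by positivity)
        · exact div_le_div_of_nonneg_right (by linarith [h.ε_pos]) hN.le
        · exact div_nonneg (by linarith [h.ε_le]) hN.le
      have e : s.N / 100 * (1 / s.N) = 1 / 100 := by field_simp
      linarith
    have := (le_inv_comm₀ (by norm_num) (by linarith)).1 h5
    norm_num at this ⊢
    exact this
  have h6 : (#(I \ D) : ℝ) = #I - #D := by
    rw [card_sdiff_of_subset hDI, Nat.cast_sub (card_le_card hDI)]
  have h7 : (#I : ℝ) ≤ s.N := by
    rw [N]; exact_mod_cast card_le_card (erase_subset z s.A)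
  have h8 := h.err_le
  have h9 := h.ρ_le
  have h10 : s.ρ * s.N ≤ 1 / 100 * s.N := mul_le_mul_of_nonneg_right h9 hN.le
  have h11 := sq_nonneg s.B
  rw [hcard, hval] at h1
  linarith

open Classical in
include i in
lemma le_card_useful (hk : (k : ℝ) ≤ s.N / 100) (z : V) :
    4 / 5 * s.N ^ 2 ≤ #((s.opts L).filter fun o => Disjoint (s.slots o) (s.used pk) ∧
      (o.1 ≠ z ∧ o.2 ≠ z ∧ s.col z o.1 ≠ s.col z o.2) ∧
      ∀ x : Slot V, x = .col (s.col z o.1) ∨ x = .col (s.col z o.2) →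
        x ∉ s.used pk ∧ x ∉ s.slots o) := by
  have hN := h.N_pos
  have hΔ := h.one_le_Δ
  set G := ((s.opts L).filter fun o => Disjoint (s.slots o) (s.used pk) ∧
      (o.1 ≠ z ∧ o.2 ≠ z ∧ s.col z o.1 ≠ s.col z o.2) ∧
      ∀ x : Slot V, x = .col (s.col z o.1) ∨ x = .col (s.col z o.2) →
        x ∉ s.used pk ∧ x ∉ s.slots o)
  set S := s.A ×ˢ s.A with hS
  let D := s.A.filter fun v => v ≠ z ∧ .col (s.col z v) ∈ s.used pk
  have hDc : (#D : ℝ) ≤ s.N / 50 := card_dead_nbr_le h i hk z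
  let b1 := S.filter fun o => o.1 = o.2
  let b2 := S.filter fun o => ∃ l ∈ L, l.getLast? = some o.1 ∧ l.head? = some o.2
  let b3 := (pk.image Prod.fst) ×ˢ s.A
  let b4 := s.A ×ˢ (pk.image Prod.snd)
  let b5 := pk.biUnion fun p => univ.filter fun o : V × V =>
    o.1 ≠ o.2 ∧ s.col o.1 o.2 = s.col p.1 p.2
  let b6 := S.filter fun o => o.1 = z
  let b7 := S.filter fun o => o.2 = z
  let b8 := S.filter fun o => o.2 ≠ z ∧ s.col z o.1 = s.col z o.2
  let b9 := D ×ˢ s.A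
  let b10 := s.A ×ˢ D
  let b11 := S.filter fun o => o.1 ≠ o.2 ∧ s.col z o.1 = s.col o.1 o.2
  let b12 := S.filter fun o => o.1 ≠ o.2 ∧ s.col z o.2 = s.col o.1 o.2
  have hcover : S ⊆ G ∪ (b1 ∪ (b2 ∪ (b3 ∪ (b4 ∪ (b5 ∪ (b6 ∪ (b7 ∪ (b8 ∪ (b9 ∪ (b10 ∪
      (b11 ∪ b12))))))))))) := by
    rintro ⟨u, w⟩ ho
    obtain ⟨hu, hw⟩ := mem_product.1 ho
    simp only at hu hw
    simp only [mem_union]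
    by_contra hcon
    push Not at hcon
    obtain ⟨c0, c1, c2, c3, c4, c5, c6, c7, c8, c9, c10, c11, c12⟩ := hcon
    have n1 : u ≠ w := fun e => c1 (mem_filter.2 ⟨ho, e⟩)
    have n2 : ¬ ∃ l ∈ L, l.getLast? = some u ∧ l.head? = some w := fun e => c2 (mem_filter.2 ⟨ho, e⟩)
    have n6 : u ≠ z := fun e => c6 (mem_filter.2 ⟨ho, e⟩)
    have n7 : w ≠ z := fun e => c7 (mem_filter.2 ⟨ho, e⟩)
    have n8 : s.col z u ≠ s.col z w := fun e => c8 (mem_filter.2 ⟨ho, n7, e⟩)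
    have n9 : .col (s.col z u) ∉ s.used pk := fun e =>
      c9 (mem_product.2 ⟨mem_filter.2 ⟨hu, n6, e⟩, hw⟩)
    have n10 : .col (s.col z w) ∉ s.used pk := fun e =>
      c10 (mem_product.2 ⟨hu, mem_filter.2 ⟨hw, n7, e⟩⟩)
    have n11 : s.col z u ≠ s.col u w := fun e => c11 (mem_filter.2 ⟨ho, n1, e⟩)
    have n12 : s.col z w ≠ s.col u w := fun e => c12 (mem_filter.2 ⟨ho, n1, e⟩)
    refine c0 (mem_filter.2 ⟨mem_opts.2 ⟨⟨hu, hw, n1⟩, n2⟩, ?_, ⟨n6, n7, n8⟩, ?_⟩)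
    · rw [disjoint_left]
      intro x hx hxu
      obtain ⟨p, hp, hxp⟩ := mem_used.1 hxu
      simp only [slots, mem_insert, mem_singleton] at hx hxp
      rcases hx with rfl | rfl | rfl
      · simp only [Slot.out.injEq, reduceCtorEq, or_false] at hxp
        exact c3 (mem_product.2 ⟨mem_image.2 ⟨p, hp, hxp.symm⟩, hw⟩)
      · simp only [Slot.inn.injEq, reduceCtorEq, or_false, false_or] at hxp
        exact c4 (mem_product.2 ⟨hu, mem_image.2 ⟨p, hp, hxp.symm⟩⟩)
      · simp only [Slot.col.injEq, reduceCtorEq, false_or] at hxp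
        exact c5 (mem_biUnion.2 ⟨p, hp, mem_filter.2 ⟨mem_univ _, n1, hxp⟩⟩)
    · rintro x (rfl | rfl)
      · exact ⟨n9, by simp [slots, n11]⟩
      · exact ⟨n10, by simp [slots, n12]⟩
  have hone : ∀ F : Finset (V × V), (∀ a ∈ F, ∀ b ∈ F, a = b) → (#F : ℝ) ≤ 1 := fun F hF => by
    exact_mod_cast card_le_one.2 hF
  have e1 : (#b1 : ℝ) ≤ s.N * 1 := by
    refine card_le_mul_of_fst_fiber _ _ _ (by simp +contextual [b1, hS]) fun u _ => hone _ ?_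
    simp only [b1, mem_filter]
    rintro a ⟨⟨-, h1⟩, h2⟩ b ⟨⟨-, h3⟩, h4⟩
    exact Prod.ext (by rw [h2, h4]) (by rw [← h1, ← h3, h2, h4])
  have e2 : (#b2 : ℝ) ≤ s.N * 1 := by
    refine card_le_mul_of_fst_fiber _ _ _ (by simp +contextual [b2, hS]) fun u _ => hone _ ?_
    simp only [b2, mem_filter]
    rintro a ⟨⟨-, l, hl, h1, h2⟩, h3⟩ b ⟨⟨-, l', hl', h1', h2'⟩, h3'⟩
    have : l = l' := i.forest.eq_of_mem hl hl' (List.mem_of_getLast? h1)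
      (by rw [h3, ← h3']; exact List.mem_of_getLast? h1')
    subst this
    rw [h2] at h2'
    exact Prod.ext (by rw [h3, h3']) (Option.some_injective _ h2')
  have hpk : (#pk : ℝ) ≤ s.N / 100 := by rw [i.card_eq]; exact hk
  have e3 : (#b3 : ℝ) ≤ s.N / 100 * s.N := by
    simp only [b3, card_product]
    push_cast
    exact mul_le_mul ((Nat.cast_le.2 card_image_le).trans hpk) le_rfl (by positivity) (by positivity)
  have e4 : (#b4 : ℝ) ≤ s.N * (s.N / 100) := by
    simp only [b4, card_product]
    push_cast
    exact mul_le_mul le_rfl ((Nat.cast_le.2 card_image_le).trans hpk) (by positivity) hN.le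
  have e5 : (#b5 : ℝ) ≤ s.N / 100 * (2 * s.N) := by
    calc (#b5 : ℝ) ≤ ∑ p ∈ pk, (#(univ.filter fun o : V × V =>
            o.1 ≠ o.2 ∧ s.col o.1 o.2 = s.col p.1 p.2) : ℝ) := by exact_mod_cast card_biUnion_le
      _ ≤ #pk * (2 * s.N) := by
        rw [← nsmul_eq_mul]
        exact sum_le_card_nsmul _ _ _ fun p _ => (h.cls_le_n _).trans h.n_le
      _ ≤ _ := mul_le_mul_of_nonneg_right hpk (by linarith)
  have e6 : (#b6 : ℝ) ≤ s.N * 1 := by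
    refine card_le_mul_of_snd_fiber _ _ _ (by simp +contextual [b6, hS]) fun u _ => hone _ ?_
    simp only [b6, mem_filter]
    rintro a ⟨⟨-, h1⟩, h2⟩ b ⟨⟨-, h3⟩, h4⟩
    exact Prod.ext (by rw [h1, h3]) (by rw [h2, h4])
  have e7 : (#b7 : ℝ) ≤ s.N * 1 := by
    refine card_le_mul_of_fst_fiber _ _ _ (by simp +contextual [b7, hS]) fun u _ => hone _ ?_
    simp only [b7, mem_filter]
    rintro a ⟨⟨-, h1⟩, h2⟩ b ⟨⟨-, h3⟩, h4⟩
    exact Prod.ext (by rw [h2, h4]) (by rw [h1, h3])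
  have e8 : (#b8 : ℝ) ≤ s.N * s.Δ := by
    refine card_le_mul_of_fst_fiber _ _ _ (by simp +contextual [b8, hS]) fun u _ => ?_
    refine le_trans ?_ (h.deg_le z (s.col z u))
    refine Nat.cast_le.2 (card_le_of_fst_eq u _ (by simp +contextual) _ ?_)
    simp only [b8, mem_filter, mem_univ, true_and]
    rintro a ⟨⟨-, h1, h2⟩, rfl⟩
    exact ⟨h1, h2.symm⟩
  have e9 : (#b9 : ℝ) ≤ s.N / 50 * s.N := by
    simp only [b9, card_product]
    push_cast
    exact mul_le_mul hDc le_rfl (by positivity) (by positivity)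
  have e10 : (#b10 : ℝ) ≤ s.N * (s.N / 50) := by
    simp only [b10, card_product]
    push_cast
    exact mul_le_mul le_rfl hDc (by positivity) hN.le
  have e11 : (#b11 : ℝ) ≤ s.N * s.Δ := by
    refine card_le_mul_of_fst_fiber _ _ _ (by simp +contextual [b11, hS]) fun u _ => ?_
    refine h.card_fiber_fst_le u (s.col z u) _ ?_
    simp only [b11, mem_filter]
    rintro a ⟨⟨-, h1, h2⟩, rfl⟩
    exact ⟨rfl, h1.symm, h2.symm⟩
  have e12 : (#b12 : ℝ) ≤ s.N * s.Δ := by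
    refine card_le_mul_of_snd_fiber _ _ _ (by simp +contextual [b12, hS]) fun u _ => ?_
    refine h.card_fiber_snd_le u (s.col z u) _ ?_
    simp only [b12, mem_filter]
    rintro a ⟨⟨-, h1, h2⟩, rfl⟩
    exact ⟨rfl, h1, (h.symm _ _).trans h2.symm⟩
  have hfin : (#S : ℝ) ≤ #G + (#b1 + (#b2 + (#b3 + (#b4 + (#b5 + (#b6 + (#b7 + (#b8 + (#b9 + (#b10 +
      (#b11 + #b12))))))))))) := by
    have : #S ≤ #G + (#b1 + (#b2 + (#b3 + (#b4 + (#b5 + (#b6 + (#b7 + (#b8 + (#b9 + (#b10 +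
        (#b11 + #b12))))))))))) := by
      refine (card_le_card hcover).trans ?_
      iterate 11 refine (card_union_le _ _).trans (Nat.add_le_add_left ?_ _)
      exact card_union_le _ _
    exact_mod_cast this
  have hSc : (#S : ℝ) = s.N ^ 2 := by rw [hS, card_product, N]; push_cast; ring
  have hsp : s.N * (4 + 3 * s.Δ) ≤ s.N * (s.N / 10) := mul_le_mul_of_nonneg_left h.sparse hN.le
  nlinarith [sq_nonneg s.N]

lemma quarter_le_mean_gain (hk : (k : ℝ) ≤ s.N / 100) (z : V) :
    1 / 4 ≤ ∑ o ∈ s.opts L, s.prob L ω o * i.gain z o := by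
  classical
  have hN := h.N_pos
  have ht := tot_pos h i
  have h1 := le_card_useful h i hk z
  have h2 : 0 ≤ ∑ o ∈ s.opts L, s.prob L ω o * i.gain z o := sum_nonneg fun o _ =>
    mul_nonneg (prob_nonneg h i o) (gain_nonneg h i z o)
  refine le_trans ?_ (sum_le_sum_of_subset_of_nonneg (filter_subset (fun o =>
      Disjoint (s.slots o) (s.used pk) ∧ (o.1 ≠ z ∧ o.2 ≠ z ∧ s.col z o.1 ≠ s.col z o.2) ∧
      ∀ x : Slot V, x = .col (s.col z o.1) ∨ x = .col (s.col z o.2) →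
        x ∉ s.used pk ∧ x ∉ s.slots o) (s.opts L))
      fun o _ _ => mul_nonneg (prob_nonneg h i o) (gain_nonneg h i z o))
  refine le_trans ?_ (card_nsmul_le_sum _ _ (1 / s.tot L ω) fun o ho => ?_)
  · rw [nsmul_eq_mul, mul_one_div, le_div_iff₀ ht]
    have h3 := (tot_bounds h i).2
    have h4 : (1 + s.ρ) ^ 2 ≤ 2 := by nlinarith [h.ρ_le, h.ρ_pos]
    have h5 := mul_le_mul_of_nonneg_right h4 (sq_nonneg s.N)
    linarith [sq_nonneg s.N]
  · obtain ⟨-, h3, h4, h5⟩ := mem_filter.1 ho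
    have hal : ∀ x ∈ s.slots o, 1 ≤ ω x := fun x hx => i.one_le x (disjoint_left.1 h3 hx)
    have hw : 1 ≤ s.wt ω o := by
      have a1 := hal (.out o.1) (by simp [slots])
      have a2 := hal (.inn o.2) (by simp [slots])
      have a3 := hal (.col (s.col o.1 o.2)) (by simp [slots])
      rw [wt]
      exact one_le_mul_of_one_le_of_one_le a1 (one_le_mul_of_one_le_of_one_le a2 a3)
    have hg : 1 ≤ i.gain z o := by
      rw [gain, if_pos h4]
      have a : ∀ x : Slot V, x = .col (s.col z o.1) ∨ x = .col (s.col z o.2) →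
          1 ≤ updWeight (s.opts L) (s.prob L ω) s.slots o ω x := fun x hx =>
        (i.one_le x (h5 x hx).1).trans (le_upd h i (h5 x hx).2)
      exact one_le_mul_of_one_le_of_one_le (a _ (.inl rfl)) (a _ (.inr rfl))
    calc 1 / s.tot L ω ≤ s.prob L ω o := div_le_div_of_nonneg_right hw ht.le
      _ ≤ _ := le_mul_of_one_le_right (prob_nonneg h i o) hg

end Inv

end Setting

end WeightedEarly

section WeightedStep

variable {V : Type*} [Fintype V] [DecidableEq V]

namespace Setting

variable {s : Setting V}

namespace Inv

variable {L : List (List V)} {pk : Finset (V × V)} {ω : Slot V → ℝ} {k : ℕ}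

/-- The change of the deviations when the edge `o` is added. -/
noncomputable def inc (i : s.Inv L pk ω k) : (TestKind × V × V × Bool) ⊕ V → V × V → ℝ
  | .inl (j, a, b, true), o =>
    (s.testVal (updWeight (s.opts L) (s.prob L ω) s.slots o ω) j a b - s.testVal ω j a b) - s.m
  | .inl (j, a, b, false), o =>
    -(s.testVal (updWeight (s.opts L) (s.prob L ω) s.slots o ω) j a b - s.testVal ω j a b) - s.m
  | .inr z, o => (if k < s.early then 1 / 4 else 0) -
    (s.insVal (updWeight (s.opts L) (s.prob L ω) s.slots o ω) pk z - s.insVal ω pk z) -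
    i.gain z o - s.m

lemma dev_add_inc (i : s.Inv L pk ω k) {o : V × V} (ho : o ∉ pk) (t) :
    s.dev ω pk k t + i.inc t o =
      s.dev (updWeight (s.opts L) (s.prob L ω) s.slots o ω) (insert o pk) (k + 1) t := by
  rcases t with ⟨j, a, b, _ | _⟩ | z
  · simp only [dev, inc]; push_cast; ring
  · simp only [dev, inc]; push_cast; ring
  · have e1 : s.insVal (updWeight (s.opts L) (s.prob L ω) s.slots o ω) (insert o pk) z =
        s.insVal (updWeight (s.opts L) (s.prob L ω) s.slots o ω) pk z + i.gain z o := by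
      rw [insVal, insVal, insIdx, filter_insert, gain]
      split_ifs with hc
      · rw [sum_insert (fun hm => ho (mem_filter.1 hm).1), add_comm, insIdx]
      · rw [add_zero, insIdx]
    have e2 : ((min (k + 1) s.early : ℕ) : ℝ) = (min k s.early : ℕ) +
        (if k < s.early then 1 else 0) := by
      split_ifs with hc
      · rw [min_eq_left hc, min_eq_left hc.le]; push_cast; ring
      · rw [min_eq_right (not_lt.1 hc), min_eq_right (by omega), add_zero]
    simp only [dev, inc, e1, e2]
    split_ifs <;> push_cast <;> ring

variable (h : s.Good) (i : s.Inv L pk ω k)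
include h i

lemma sum_prob_mul_abs_le (X : V × V → ℝ) (c M : ℝ)
    (hX : ∑ o ∈ s.opts L, s.prob L ω o * |X o| ≤ M) (Y : V × V → ℝ)
    (hY : ∀ o, |Y o| ≤ |X o| + c) : ∑ o ∈ s.opts L, s.prob L ω o * |Y o| ≤ M + c := by
  calc _ ≤ ∑ o ∈ s.opts L, (s.prob L ω o * |X o| + s.prob L ω o * c) :=
        sum_le_sum fun o _ => by
          rw [← mul_add]; exact mul_le_mul_of_nonneg_left (hY o) (prob_nonneg h i o)
    _ = ∑ o ∈ s.opts L, s.prob L ω o * |X o| + c := by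
        rw [sum_add_distrib, ← sum_mul, sum_prob h i, one_mul]
    _ ≤ _ := by linarith

lemma sum_prob_mul_sub (X : V × V → ℝ) (c : ℝ) :
    ∑ o ∈ s.opts L, s.prob L ω o * (X o - c) = ∑ o ∈ s.opts L, s.prob L ω o * X o - c := by
  simp_rw [mul_sub]
  rw [sum_sub_distrib, ← sum_mul, sum_prob h i, one_mul]

lemma card_ins_fst_le (z : V) (x : Slot V) :
    (#((s.insIdx pk z).filter fun p => .col (s.col z p.1) = x) : ℝ) ≤ s.Δ := by
  have h0 : (0 : ℝ) ≤ s.Δ := by linarith [h.one_le_Δ]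
  rcases x with v | v | c | _ <;> simp only [reduceCtorEq, filter_false, card_empty, Nat.cast_zero,
    Slot.col.injEq, h0]
  refine le_trans ?_ (h.deg_le z c)
  refine Nat.cast_le.2 (card_le_card_of_injOn Prod.fst (fun p hp => ?_) fun p hp p' hp' e => ?_)
  · simp only [insIdx, coe_filter, mem_filter, Set.mem_ofPred_eq] at hp
    simp [hp.1.2.1, hp.2]
  · simp only [insIdx, coe_filter, mem_filter, Set.mem_ofPred_eq] at hp hp'
    exact i.forest.fst_injOn p hp.1.1 p' hp'.1.1 e

lemma card_ins_snd_le (z : V) (x : Slot V) :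
    (#((s.insIdx pk z).filter fun p => .col (s.col z p.2) = x) : ℝ) ≤ s.Δ := by
  have h0 : (0 : ℝ) ≤ s.Δ := by linarith [h.one_le_Δ]
  rcases x with v | v | c | _ <;> simp only [reduceCtorEq, filter_false, card_empty, Nat.cast_zero,
    Slot.col.injEq, h0]
  refine le_trans ?_ (h.deg_le z c)
  refine Nat.cast_le.2 (card_le_card_of_injOn Prod.snd (fun p hp => ?_) fun p hp p' hp' e => ?_)
  · simp only [insIdx, coe_filter, mem_filter, Set.mem_ofPred_eq] at hp
    simp [hp.1.2.2.1, hp.2]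
  · simp only [insIdx, coe_filter, mem_filter, Set.mem_ofPred_eq] at hp hp'
    exact i.forest.snd_injOn p hp.1.1 p' hp'.1.1 e

lemma card_le_n : (#pk : ℝ) ≤ s.n := by
  rw [i.card_eq]
  exact i.le.trans (by nlinarith [h.δ_pos, h.N_pos, Good.N_le_n (s := s)])

lemma test_inc (j : TestKind) (a b : V) :
    |∑ o ∈ s.opts L, s.prob L ω o * (s.testVal (updWeight (s.opts L) (s.prob L ω) s.slots o ω) j a b -
      s.testVal ω j a b)| ≤ s.m ∧
    (∀ o, |s.testVal (updWeight (s.opts L) (s.prob L ω) s.slots o ω) j a b -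
      s.testVal ω j a b| ≤ s.B ^ 2 * (4 * s.n * s.π + 6 * s.Δ)) ∧
    ∑ o ∈ s.opts L, s.prob L ω o * |s.testVal (updWeight (s.opts L) (s.prob L ω) s.slots o ω) j a b -
      s.testVal ω j a b| ≤ 6 * s.B ^ 2 * s.n * s.π := by
  have sb := stepBounds h i
  have hs : ∀ o, ∀ x ∈ s.slots o, x ≠ Slot.star := fun o x hx e =>
    Good.star_notMem_slots o (e ▸ hx)
  refine ⟨?_, fun o => ?_, ?_⟩
  · exact sb.abs_quad_mean_le _ _ _ (Good.testFst_ne_testSnd j a b) _ (h.card_testIdx_le j a b)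
      h.q_nonneg
  · exact sb.abs_quad_inc_le _ _ _ _ _ (h.card_testIdx_le j a b) (Good.card_slots_le o)
      (fun x hx => h.card_testFst_fiber_le j a b x (hs o x hx))
      (fun x hx => h.card_testSnd_fiber_le j a b x (hs o x hx)) (by linarith [h.one_le_Δ])
  · exact sb.mean_abs_quad_inc_le _ _ _ _ (h.card_testIdx_le j a b)

lemma ins_inc (z : V) :
    |∑ o ∈ s.opts L, s.prob L ω o * (s.insVal (updWeight (s.opts L) (s.prob L ω) s.slots o ω) pk z -
      s.insVal ω pk z)| ≤ s.m ∧
    (∀ o, |s.insVal (updWeight (s.opts L) (s.prob L ω) s.slots o ω) pk z -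
      s.insVal ω pk z| ≤ s.B ^ 2 * (4 * s.n * s.π + 6 * s.Δ)) ∧
    ∑ o ∈ s.opts L, s.prob L ω o * |s.insVal (updWeight (s.opts L) (s.prob L ω) s.slots o ω) pk z -
      s.insVal ω pk z| ≤ 6 * s.B ^ 2 * s.n * s.π := by
  have sb := stepBounds h i
  have hc : (#(s.insIdx pk z) : ℝ) ≤ s.n :=
    (Nat.cast_le.2 (card_le_card (filter_subset _ _))).trans (card_le_n h i)
  obtain ⟨F, f, g, e, hc, hfg, hf, hg⟩ : ∃ (F : Finset (V × V)) (f g : V × V → Slot V),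
      (∀ ω', s.insVal ω' pk z = ∑ p ∈ F, ω' (f p) * ω' (g p)) ∧ (#F : ℝ) ≤ s.n ∧
      (∀ p ∈ F, f p ≠ g p) ∧ (∀ x, (#(F.filter fun p => f p = x) : ℝ) ≤ s.Δ) ∧
      ∀ x, (#(F.filter fun p => g p = x) : ℝ) ≤ s.Δ :=
    ⟨s.insIdx pk z, fun p => .col (s.col z p.1), fun p => .col (s.col z p.2), fun _ => rfl, hc,
      fun p hp e => (mem_filter.1 hp).2.2.2 (Slot.col.inj e), card_ins_fst_le h i z,
      card_ins_snd_le h i z⟩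
  have h0 : (0 : ℝ) ≤ s.Δ := by linarith [h.one_le_Δ]
  simp only [e]
  refine ⟨?_, fun o => ?_, ?_⟩
  · exact sb.abs_quad_mean_le F f g hfg _ hc h.q_nonneg
  · exact sb.abs_quad_inc_le F f g _ _ hc
      (Good.card_slots_le o) (fun x _ => hf x)
      (fun x _ => hg x) h0
  · exact sb.mean_abs_quad_inc_le F f g _ hc

lemma mean_inc_le (t) : ∑ o ∈ s.opts L, s.prob L ω o * i.inc t o ≤ 0 := by
  rcases t with ⟨j, a, b, _ | _⟩ | z
  · have h1 := (abs_le.1 (test_inc h i j a b).1).1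
    simp only [inc]
    rw [sum_prob_mul_sub h i]
    simp_rw [mul_neg]
    rw [sum_neg_distrib]
    linarith
  · have h1 := (abs_le.1 (test_inc h i j a b).1).2
    simp only [inc]
    rw [sum_prob_mul_sub h i]
    linarith
  · have h1 := (abs_le.1 (ins_inc h i z).1).1
    have h2 : (if k < s.early then 1 / 4 else 0) ≤
        ∑ o ∈ s.opts L, s.prob L ω o * i.gain z o := by
      split_ifs with hk
      · refine quarter_le_mean_gain h i ?_ z
        exact (Nat.le_floor_iff (by linarith [h.N_pos])).1 hk.le
      · exact sum_nonneg fun o _ => mul_nonneg (prob_nonneg h i o) (gain_nonneg h i z o)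
    simp only [inc]
    rw [sum_prob_mul_sub h i]
    have e : ∀ o, s.prob L ω o * ((if k < s.early then 1 / 4 else 0) -
        (s.insVal (updWeight (s.opts L) (s.prob L ω) s.slots o ω) pk z - s.insVal ω pk z) -
        i.gain z o) = s.prob L ω o * (if k < s.early then 1 / 4 else 0) -
        s.prob L ω o *
          (s.insVal (updWeight (s.opts L) (s.prob L ω) s.slots o ω) pk z - s.insVal ω pk z) -
        s.prob L ω o * i.gain z o := fun o => by ring
    simp_rw [e]
    rw [sum_sub_distrib, sum_sub_distrib, ← sum_mul, sum_prob h i, one_mul]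
    linarith

lemma abs_inc_le (t) (o : V × V) : |i.inc t o| ≤ s.incBound := by
  have hm := h.m_nonneg
  have hB := sq_nonneg s.B
  rw [incBound]
  rcases t with ⟨j, a, b, _ | _⟩ | z
  · have h1 := abs_le.1 ((test_inc h i j a b).2.1 o)
    simp only [inc]
    rw [abs_le]
    constructor <;> linarith
  · have h1 := abs_le.1 ((test_inc h i j a b).2.1 o)
    simp only [inc]
    rw [abs_le]
    constructor <;> linarith
  · have h1 := abs_le.1 ((ins_inc h i z).2.1 o)
    have h2 := gain_nonneg h i z o
    have h3 := gain_le h i z o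
    simp only [inc]
    rw [abs_le]
    constructor <;> split_ifs <;> linarith

lemma mean_abs_inc_le (t) : ∑ o ∈ s.opts L, s.prob L ω o * |i.inc t o| ≤ s.incMean := by
  have hm := h.m_nonneg
  have hB := sq_nonneg s.B
  rw [incMean, add_assoc, add_assoc]
  rcases t with ⟨j, a, b, _ | _⟩ | z
  · refine sum_prob_mul_abs_le h i _ _ _ (test_inc h i j a b).2.2 _ fun o => ?_
    simp only [inc]
    refine (abs_sub _ _).trans ?_
    rw [abs_neg, abs_of_nonneg hm]
    linarith
  · refine sum_prob_mul_abs_le h i _ _ _ (test_inc h i j a b).2.2 _ fun o => ?_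
    simp only [inc]
    refine (abs_sub _ _).trans ?_
    rw [abs_of_nonneg hm]
    linarith
  · refine sum_prob_mul_abs_le h i _ _ _ (ins_inc h i z).2.2 _ fun o => ?_
    have h2 := gain_nonneg h i z o
    have h3 := gain_le h i z o
    set X := s.insVal (updWeight (s.opts L) (s.prob L ω) s.slots o ω) pk z - s.insVal ω pk z with hX
    have h4 := le_abs_self X
    have h5 := neg_abs_le X
    simp only [inc, ← hX]
    rw [abs_le]
    constructor <;> split_ifs <;> linarith

/-- One step of the weighted process. -/
lemma exists_step (hk : ((k + 1 : ℕ) : ℝ) ≤ (1 - s.δ) * s.N) :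
    ∃ L' pk' ω', s.Inv L' pk' ω' (k + 1) := by
  have sb := stepBounds h i
  obtain ⟨o, ho, hPo, hpot⟩ := exists_outcome_potential_le (s.opts L) (s.prob L ω)
    (fun o _ => prob_nonneg h i o) (sum_prob h i) s.lam s.incMean s.incBound h.lam_pos.le h.step_le
    (s.dev ω pk k) i.inc (mean_inc_le h i) (fun t o _ => abs_inc_le h i t o)
    (mean_abs_inc_le h i)
  have hd := i.disjoint_of_prob_pos hPo
  have hopk : o ∉ pk := fun hm => disjoint_left.1 hd (show Slot.out o.1 ∈ _ by simp [slots])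
    (mem_used.2 ⟨_, hm, by simp [slots]⟩)
  obtain ⟨⟨hu, hw, huw⟩, hcl⟩ := mem_opts.1 ho
  obtain ⟨L', hL'⟩ := i.forest.exists_insert hu hw huw hcl hd
  refine ⟨L', insert o pk, updWeight (s.opts L) (s.prob L ω) s.slots o ω, hL', ?_, hk, ?_, ?_, ?_,
    ?_, ?_, ?_, ?_, ?_, ?_⟩
  · rw [card_insert_of_notMem hopk, i.card_eq]
  · intro x hx
    rw [used_insert, mem_union] at hx
    rw [updWeight]
    split_ifs with hxo
    · rfl
    · rw [i.eq_zero x (hx.resolve_left hxo), zero_div]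
  · intro x hx
    rw [used_insert, notMem_union] at hx
    exact (i.one_le x hx.2).trans (le_upd h i hx.1)
  · rw [updWeight, if_neg (Good.star_notMem_slots o), i.star,
      show hitProb (s.opts L) (s.prob L ω) s.slots .star = 0 from i.hit_star]
    norm_num
  · intro v hv
    rw [updWeight, if_neg (fun hx => hv (by
      have : v = o.1 := by simpa [slots] using hx
      exact this ▸ hu)), i.out_one v hv,
      show hitProb (s.opts L) (s.prob L ω) s.slots (.out v) = 0 from i.hit_out_of_notMem hv]
    norm_num
  · intro v hv
    rw [updWeight, if_neg (fun hx => hv (by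
      have : v = o.2 := by simpa [slots] using hx
      exact this ▸ hw)), i.inn_one v hv,
      show hitProb (s.opts L) (s.prob L ω) s.slots (.inn v) = 0 from i.hit_inn_of_notMem hv]
    norm_num
  · intro v hv hx
    rw [used_insert, notMem_union] at hx
    obtain ⟨r, hr, hr2⟩ := hit_out h i hv
    rw [i.inv_upd hx.1 r hr hx.2]
    have h1 := abs_le.1 (i.out_inv v hv hx.2)
    have h2 := abs_le.1 hr2
    have e1 : ((k + 1 : ℕ) : ℝ) / s.N = k / s.N + 1 / s.N := by push_cast; ring
    have e2 : ((k + 1 : ℕ) : ℝ) * (4 * s.ρ / s.N) = k * (4 * s.ρ / s.N) + 4 * s.ρ / s.N := by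
      push_cast; ring
    rw [e1, e2, abs_le]
    constructor <;> linarith
  · intro v hv hx
    rw [used_insert, notMem_union] at hx
    obtain ⟨r, hr, hr2⟩ := hit_inn h i hv
    rw [i.inv_upd hx.1 r hr hx.2]
    have h1 := abs_le.1 (i.inn_inv v hv hx.2)
    have h2 := abs_le.1 hr2
    have e1 : ((k + 1 : ℕ) : ℝ) / s.N = k / s.N + 1 / s.N := by push_cast; ring
    have e2 : ((k + 1 : ℕ) : ℝ) * (4 * s.ρ / s.N) = k * (4 * s.ρ / s.N) + 4 * s.ρ / s.N := by
      push_cast; ring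
    rw [e1, e2, abs_le]
    constructor <;> linarith
  · intro c hx
    rw [used_insert, notMem_union] at hx
    obtain ⟨r, hr, -, hr2⟩ := hit_col h i c
    rw [i.inv_upd hx.1 r hr hx.2]
    have h1 := i.col_inv c hx.2
    have e2 : ((k + 1 : ℕ) : ℝ) * ((1 - s.ε / 2) / s.N) =
        k * ((1 - s.ε / 2) / s.N) + (1 - s.ε / 2) / s.N := by
      push_cast; ring
    rw [e2]
    linarith
  · simp_rw [i.dev_add_inc hopk] at hpot
    refine hpot.trans ?_
    have h0 : 0 ≤ s.lam ^ 2 * (s.incMean * s.incBound) := by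
      have := h.B_pos
      have := h.m_nonneg
      have := h.π_nonneg
      have := h.one_le_Δ
      have := h.n_pos
      rw [incMean, incBound]
      positivity
    rw [pow_succ' (1 + _) k, mul_assoc (1 + _)]
    exact mul_le_mul_of_nonneg_left i.potential (add_nonneg zero_le_one h0)

end Inv

/-- The weighted process runs for `(1 - δ) N` steps. -/
lemma Good.exists_inv (h : s.Good) (k : ℕ) (hk : (k : ℝ) ≤ (1 - s.δ) * s.N) :
    ∃ L pk ω, s.Inv L pk ω k := by
  induction k with
  | zero => exact ⟨_, _, _, inv_zero h (by linarith [h.δ_le, h.ε_le])⟩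
  | succ k ih =>
    obtain ⟨L, pk, ω, i⟩ := ih (le_trans (by push_cast; linarith) hk)
    exact i.exists_step h hk

end Setting

end WeightedStep

section PathLists

variable {α : Type*}

/-- Prefixes of a family of paths with prescribed total length plus twice the number of paths,
up to an overshoot of at most two. -/
lemma exists_truncation : ∀ (L : List (List α)), (∀ q ∈ L, q ≠ []) → ∀ t : ℕ,
    t ≤ L.flatten.length + 2 * L.length → ∃ L₁ : List (List α), ∃ r ≤ 2,
      L₁.flatten.length + 2 * L₁.length = t + r ∧ L₁.length ≤ L.length ∧
      (∀ l ∈ L₁, l ≠ [] ∧ ∃ q ∈ L, l <+: q) ∧ L₁.flatten.Sublist L.flatten ∧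
      ∃ d : Option α, ∀ l ∈ L₁, l ∈ L ∨ l.getLast? = d
  | [], _, t, ht => ⟨[], 0, by simp, by simp at ht; simp [ht], by simp, by simp, by simp, none, by simp⟩
  | q :: L, hL, t, ht => by
    rcases Nat.eq_zero_or_pos t with rfl | h0
    · exact ⟨[], 0, by simp, by simp, by simp, by simp, by simp, none, by simp⟩
    have hq : 0 < q.length := List.length_pos_of_ne_nil (hL q (by simp))
    rcases le_or_gt t (q.length + 2) with h1 | h1
    · refine ⟨[q.take (max 1 (t - 2))], 3 - t, by omega, ?_, by simp, ?_, ?_, (q.take (max 1 (t - 2))).getLast?, ?_⟩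
      · simp only [List.flatten_cons, List.flatten_nil, List.append_nil, List.length_take,
          List.length_singleton]
        omega
      · intro l hl
        rw [List.mem_singleton] at hl
        subst hl
        refine ⟨List.ne_nil_of_length_pos ?_, q, by simp, _, List.take_append_drop _ _⟩
        rw [List.length_take]; omega
      · simp only [List.flatten_cons, List.flatten_nil, List.append_nil]
        exact (List.take_sublist _ _).trans (List.sublist_append_left _ _)
      · simp
    · simp only [List.flatten_cons, List.length_append, List.length_cons] at ht
      obtain ⟨L₁, r, hr, h2, h3, h4, h5, d, h6⟩ := exists_truncation L
        (fun q hq => hL q (by simp [hq])) (t - (q.length + 2)) (by omega)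
      refine ⟨q :: L₁, r, hr, ?_, by simpa using h3, ?_, ?_, d, ?_⟩
      · simp only [List.flatten_cons, List.length_append, List.length_cons]
        omega
      · intro l hl
        rcases List.mem_cons.1 hl with rfl | hl
        · exact ⟨hL l (by simp), l, by simp, List.prefix_rfl⟩
        · obtain ⟨h7, q', hq', h8⟩ := h4 l hl
          exact ⟨h7, q', by simp [hq'], h8⟩
      · simpa using h5
      · intro l hl
        rcases List.mem_cons.1 hl with rfl | hl
        · simp
        · rcases h6 l hl with h7 | h7
          · simp [h7]
          · exact Or.inr h7

/-- Prefixes of a family of paths with prescribed total length plus twice the number of paths. -/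
lemma exists_truncation_eq [DecidableEq α] (L : List (List α)) (hL : ∀ q ∈ L, q ≠ [])
    (hnd : L.flatten.Nodup) (q₀ : List α) (hq₀ : q₀ ∈ L) (h3 : 3 ≤ q₀.length) (t : ℕ) (ht3 : 3 ≤ t)
    (ht : t ≤ L.flatten.length + 2 * L.length) :
    ∃ L₁ : List (List α), L₁ ≠ [] ∧ L₁.flatten.length + 2 * L₁.length = t ∧ L₁.length ≤ L.length ∧
      (∀ l ∈ L₁, l ≠ [] ∧ ∃ q ∈ L, l <+: q) ∧ L₁.flatten.Nodup ∧ (∀ v ∈ L₁.flatten, v ∈ L.flatten) ∧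
      ∃ d d' : Option α, ∀ l ∈ L₁, l ∈ L ∨ l.getLast? = d ∨ l.getLast? = d' := by
  have hp := List.perm_cons_erase hq₀
  have hpf : L.flatten.Perm (q₀ ++ (L.erase q₀).flatten) := by simpa using hp.flatten
  have hlen := hpf.length_eq
  have hlen' := hp.length_eq
  simp only [List.length_append, List.length_cons] at hlen hlen'
  have hnd' := (List.Perm.nodup_iff hpf).1 hnd
  rcases le_or_gt t (q₀.length + 2) with h1 | h1
  · have hne : q₀.take (t - 2) ≠ [] := List.ne_nil_of_length_pos (by rw [List.length_take]; omega)
    refine ⟨[q₀.take (t - 2)], by simp, ?_, ?_, ?_, ?_, ?_, (q₀.take (t - 2)).getLast?, none, ?_⟩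
    · simp only [List.flatten_cons, List.flatten_nil, List.append_nil, List.length_take,
          List.length_singleton]
      omega
    · simp only [List.length_singleton]; omega
    · intro l hl
      rw [List.mem_singleton] at hl
      subst hl
      exact ⟨hne, q₀, hq₀, _, List.take_append_drop _ _⟩
    · simpa using ((List.nodup_append.1 hnd').1).sublist (List.take_sublist _ _)
    · intro v hv
      exact List.mem_flatten.2 ⟨q₀, hq₀, List.mem_of_mem_take (by simpa using hv)⟩
    · simp
  · obtain ⟨L₁, r, hr, h2, h3', h4, h5, d, h6⟩ := exists_truncation (L.erase q₀)
        (fun q hq => hL q (List.mem_of_mem_erase hq)) (t - (q₀.length + 2)) (by omega)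
    have hne : q₀.take (q₀.length - r) ≠ [] :=
      List.ne_nil_of_length_pos (by rw [List.length_take]; omega)
    have hsub : (q₀.take (q₀.length - r) ++ L₁.flatten).Sublist (q₀ ++ (L.erase q₀).flatten) :=
      (List.take_sublist _ _).append h5
    refine ⟨q₀.take (q₀.length - r) :: L₁, by simp, ?_, ?_, ?_, ?_, ?_, d,
      (q₀.take (q₀.length - r)).getLast?, ?_⟩
    · simp only [List.flatten_cons, List.length_append, List.length_cons, List.length_take]
      omega
    · simp only [List.length_cons]; omega
    · intro l hl
      rcases List.mem_cons.1 hl with rfl | hl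
      · exact ⟨hne, q₀, hq₀, _, List.take_append_drop _ _⟩
      · obtain ⟨h7, q', hq', h8⟩ := h4 l hl
        exact ⟨h7, q', List.mem_of_mem_erase hq', h8⟩
    · rw [List.flatten_cons]; exact hnd'.sublist hsub
    · intro v hv
      rw [List.flatten_cons] at hv
      exact hpf.mem_iff.2 (hsub.subset hv)
    · intro l hl
      rcases List.mem_cons.1 hl with rfl | hl
      · simp
      · rcases h6 l hl with h7 | h7
        · exact Or.inl (List.mem_of_mem_erase h7)
        · exact Or.inr (Or.inl h7)

lemma isChain_append_self_formPerm [DecidableEq α] (l : List α) (hl : l.Nodup) :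
    (l ++ l).IsChain fun a b => l.formPerm a = b := by
  rw [List.isChain_iff_getElem]
  intro i hi
  simp only [List.length_append] at hi
  rcases lt_or_ge i l.length with h1 | h1
  · rw [List.getElem_append_left h1, List.formPerm_apply_getElem _ hl]
    rcases lt_or_ge (i + 1) l.length with h2 | h2
    · rw [List.getElem_append_left h2]
      simp only [Nat.mod_eq_of_lt h2]
    · have h3 : i + 1 = l.length := by omega
      rw [List.getElem_append_right h2]
      simp [h3]
  · rw [List.getElem_append_right h1, List.getElem_append_right (by omega),
      List.formPerm_apply_getElem _ hl]
    simp only [show i + 1 - l.length = i - l.length + 1 by omega,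
      Nat.mod_eq_of_lt (show i - l.length + 1 < l.length by omega)]

lemma getLast_head_of_isChain_append_self {R : α → α → Prop} {l : List α} (hne : l ≠ [])
    (h : (l ++ l).IsChain R) : l.IsChain R ∧ R (l.getLast hne) (l.head hne) := by
  rw [List.isChain_append] at h
  exact ⟨h.1, h.2.2 _ (by simp [List.getLast?_eq_some_getLast hne]) _
    (by simp [List.head?_eq_some_head hne])⟩

lemma nodup_of_nodup_flatten {L : List (List α)} (hne : ∀ l ∈ L, l ≠ []) (h : L.flatten.Nodup) :
    L.Nodup := by
  rw [List.nodup_flatten] at h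
  refine List.Pairwise.imp_of_mem (fun {a b} ha hb hab => ?_) h.2
  rintro rfl
  obtain ⟨x, hx⟩ := List.exists_mem_of_ne_nil a (hne a ha)
  exact hab hx hx

lemma eq_of_mem_of_nodup_flatten {L : List (List α)} (h : L.flatten.Nodup) {a b : List α}
    (ha : a ∈ L) (hb : b ∈ L) {x : α} (hxa : x ∈ a) (hxb : x ∈ b) : a = b := by
  rw [List.nodup_flatten] at h
  by_contra hab
  have : Std.Symm (List.Disjoint (α := α)) := ⟨fun _ _ h => h.symm⟩
  exact h.2.forall ha hb hab hxa hxb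

/-- Joining the paths in `L` cyclically through pairs of new vertices. -/
lemma exists_closed_join {R : α → α → Prop} (L : List (List α)) (hne : ∀ l ∈ L, l ≠ [])
    (hL : L ≠ []) (hnd : L.flatten.Nodup) (hR : ∀ l ∈ L, l.IsChain R) (lst hd : List α → α)
    (hlst : ∀ l ∈ L, l.getLast? = some (lst l)) (hhd : ∀ l ∈ L, l.head? = some (hd l))
    (f : α → α × α) (x : α → α)
    (hx : (L ++ L).IsChain fun l l' => x (lst l) = hd l')
    (hf : ∀ l ∈ L, R (lst l) (f (lst l)).1 ∧ R (f (lst l)).1 (f (lst l)).2 ∧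
      R (f (lst l)).2 (x (lst l)))
    (hfnd : ∀ l ∈ L, (f (lst l)).1 ≠ (f (lst l)).2 ∧ (f (lst l)).1 ∉ L.flatten ∧
      (f (lst l)).2 ∉ L.flatten)
    (hfd : ∀ l ∈ L, ∀ l' ∈ L, l ≠ l' → (f (lst l)).1 ≠ (f (lst l')).1 ∧
      (f (lst l)).1 ≠ (f (lst l')).2 ∧ (f (lst l)).2 ≠ (f (lst l')).1 ∧
      (f (lst l)).2 ≠ (f (lst l')).2) :
    ∃ M : List α, M ≠ [] ∧ M.Nodup ∧ M.length = L.flatten.length + 2 * L.length ∧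
      (M ++ M).IsChain R ∧
      ∀ v, v ∈ M ↔ v ∈ L.flatten ∨ ∃ l ∈ L, v = (f (lst l)).1 ∨ v = (f (lst l)).2 := by
  set g : List α → List α := fun l => l ++ [(f (lst l)).1, (f (lst l)).2] with hg
  have hmem : ∀ v, v ∈ (L.map g).flatten ↔
      v ∈ L.flatten ∨ ∃ l ∈ L, v = (f (lst l)).1 ∨ v = (f (lst l)).2 := by
    intro v
    rw [← List.flatMap_def]
    simp only [hg, List.mem_flatMap, List.mem_append, List.mem_cons, List.not_mem_nil, or_false,
      List.mem_flatten]
    constructor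
    · rintro ⟨l, hl, h1 | h1⟩
      · exact Or.inl ⟨l, hl, h1⟩
      · exact Or.inr ⟨l, hl, h1⟩
    · rintro (⟨l, hl, h1⟩ | ⟨l, hl, h1⟩)
      · exact ⟨l, hl, Or.inl h1⟩
      · exact ⟨l, hl, Or.inr h1⟩
  refine ⟨(L.map g).flatten, ?_, ?_, ?_, ?_, hmem⟩
  · obtain ⟨l, hl⟩ := List.exists_mem_of_ne_nil L hL
    exact List.ne_nil_of_mem ((hmem _).2 (Or.inr ⟨l, hl, Or.inl rfl⟩))
  · rw [List.nodup_flatten, List.pairwise_map]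
    constructor
    · intro l' hl'
      obtain ⟨l, hl, rfl⟩ := List.mem_map.1 hl'
      obtain ⟨h1, h2, h3⟩ := hfnd l hl
      rw [List.nodup_append]
      refine ⟨(List.nodup_flatten.1 hnd).1 l hl, by simpa using h1, ?_⟩
      intro a ha b hb
      have ha' : a ∈ L.flatten := List.mem_flatten.2 ⟨l, hl, ha⟩
      simp only [List.mem_cons, List.not_mem_nil, or_false] at hb
      rintro rfl
      rcases hb with rfl | rfl
      · exact h2 ha'
      · exact h3 ha'
    · refine List.Pairwise.imp_of_mem ?_ (nodup_of_nodup_flatten hne hnd)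
      intro l l' hl hl' hll v hv hv'
      obtain ⟨h1, h2, h3⟩ := hfnd l hl
      obtain ⟨h1', h2', h3'⟩ := hfnd l' hl'
      obtain ⟨k1, k2, k3, k4⟩ := hfd l hl l' hl' hll
      simp only [hg, List.mem_append, List.mem_cons, List.not_mem_nil, or_false] at hv hv'
      rcases hv with hv | rfl | rfl
      · have hvL : v ∈ L.flatten := List.mem_flatten.2 ⟨l, hl, hv⟩
        rcases hv' with hv' | rfl | rfl
        · exact hll (eq_of_mem_of_nodup_flatten hnd hl hl' hv hv')
        · exact h2' hvL
        · exact h3' hvL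
      · rcases hv' with hv' | hv' | hv'
        · exact h2 (List.mem_flatten.2 ⟨l', hl', hv'⟩)
        · exact k1 hv'
        · exact k2 hv'
      · rcases hv' with hv' | hv' | hv'
        · exact h3 (List.mem_flatten.2 ⟨l', hl', hv'⟩)
        · exact k3 hv'
        · exact k4 hv'
  · clear_value g
    subst hg
    clear hmem hfd hfnd hf hx hhd hlst hR hnd hL hne
    induction L with
    | nil => simp
    | cons l L ih =>
      simp only [List.map_cons, List.flatten_cons, List.length_append, List.length_cons,
        List.length_nil] at ih ⊢
      omega
  · rw [← List.flatten_append, ← List.map_append, List.isChain_flatten (by simp [hg])]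
    constructor
    · intro l' hl'
      obtain ⟨l, hl, rfl⟩ := List.mem_map.1 hl'
      have hl : l ∈ L := by simpa using hl
      obtain ⟨h1, h2, h3⟩ := hf l hl
      rw [List.isChain_append]
      refine ⟨hR l hl, by simpa using h2, ?_⟩
      rw [hlst l hl]
      simpa using h1
    · rw [List.isChain_map]
      refine List.IsChain.imp_of_mem_imp ?_ hx
      intro l l' hl hl' e v hv w hw
      have hl : l ∈ L := by simpa using hl
      have hl' : l' ∈ L := by simpa using hl'
      have hv : (f (lst l)).2 = v := by simpa [hg] using hv
      have hw : hd l' = w := by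
        rw [hg, List.head?_append, hhd l' hl'] at hw
        simpa using hw
      rw [← hv, ← hw, ← e]
      exact (hf l hl).2.2

/-- Inserting new vertices into the edges of a closed list. -/
lemma exists_closed_insert [DecidableEq α] {R : α → α → Prop} (M : List α) (hM : M.Nodup)
    (hch : (M ++ M).IsChain R) (T : Finset α) (hT : ∀ z ∈ T, z ∉ M) (g : α → α × α)
    (hgM : ∀ z ∈ T, (g z).1 ∈ M) (hginj : ∀ z ∈ T, ∀ z' ∈ T, (g z).1 = (g z').1 → z = z')
    (hgR : ∀ z ∈ T, R (g z).1 z ∧ R z (g z).2)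
    (huniq : ∀ z ∈ T, ∀ w ∈ M, R (g z).1 w → w = (g z).2) :
    ∃ M' : List α, M'.Nodup ∧ M'.length = M.length + #T ∧ (M' ++ M').IsChain R := by
  set ins : α → List α := fun v => (T.filter fun z => (g z).1 = v).toList with hins
  have hins' : ∀ v, ins v = [] ∨ ∃ z ∈ T, (g z).1 = v ∧ ins v = [z] := by
    intro v
    rcases (T.filter fun z => (g z).1 = v).eq_empty_or_nonempty with h0 | ⟨z, hz⟩
    · exact Or.inl (by simp [hins, h0])
    · right
      have hz' := mem_filter.1 hz
      refine ⟨z, hz'.1, hz'.2, ?_⟩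
      have : (T.filter fun z => (g z).1 = v) = {z} := by
        ext w
        rw [mem_singleton]
        constructor
        · intro hw
          have hw' := mem_filter.1 hw
          exact hginj w hw'.1 z hz'.1 (hw'.2.trans hz'.2.symm)
        · rintro rfl; exact hz
      simp [hins, this]
  have hmem : ∀ z v, z ∈ ins v ↔ z ∈ T ∧ (g z).1 = v := by simp [hins]
  have hperm : (M.flatMap fun v => v :: ins v).Perm (M ++ M.flatMap ins) := by
    have := List.map_append_flatMap_perm M id ins
    rw [List.map_id] at this
    exact this.symm
  have hnd2 : (M.flatMap ins).Nodup := by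
    rw [List.nodup_flatMap]
    refine ⟨fun v _ => nodup_toList _, List.Pairwise.imp ?_ hM⟩
    intro a b hab z hz hz'
    exact hab (((hmem z a).1 hz).2.symm.trans ((hmem z b).1 hz').2)
  have hT2 : (M.flatMap ins).toFinset = T := by
    ext z
    rw [List.mem_toFinset, List.mem_flatMap]
    constructor
    · rintro ⟨v, -, hz⟩; exact ((hmem z v).1 hz).1
    · intro hz; exact ⟨_, hgM z hz, (hmem _ _).2 ⟨hz, rfl⟩⟩
  refine ⟨M.flatMap fun v => v :: ins v, ?_, ?_, ?_⟩
  · rw [hperm.nodup_iff, List.nodup_append]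
    refine ⟨hM, hnd2, ?_⟩
    rintro a ha b hb rfl
    exact hT a (hT2 ▸ List.mem_toFinset.2 hb) ha
  · rw [hperm.length_eq, List.length_append, ← hT2, List.toFinset_card_of_nodup hnd2]
  · rw [← List.flatMap_append, List.flatMap_def, List.isChain_flatten (by simp)]
    constructor
    · intro l hl
      obtain ⟨v, hv, rfl⟩ := List.mem_map.1 hl
      rcases hins' v with h0 | ⟨z, hz, rfl, h0⟩
      · simp [h0]
      · simpa [h0] using (hgR z hz).1
    · rw [List.isChain_map]
      refine List.IsChain.imp_of_mem_imp ?_ hch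
      intro v w hv hw hvw a ha b hb
      have hw : w ∈ M := by simpa using hw
      have hb : w = b := by simpa using hb
      rcases hins' v with h0 | ⟨z, hz, rfl, h0⟩
      · have ha : v = a := by simpa [h0] using ha
        rwa [← ha, ← hb]
      · have ha : z = a := by simpa [h0] using ha
        rw [← ha, ← hb, huniq z hz w hw hvw]
        exact (hgR z hz).2

end PathLists

section FinalState

variable {V : Type*} [Fintype V] [DecidableEq V]

lemma sum_card_filter_eq (E : Finset V) (P : V → V → Prop) [∀ v u, Decidable (P v u)] :
    ∑ v ∈ E, #(univ.filter fun u => P v u) =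
      #(univ.filter fun p : V × V => p.1 ∈ E ∧ P p.1 p.2) := by
  rw [card_filter, Fintype.sum_prod_type, ← sum_subset (subset_univ E)]
  · refine sum_congr rfl fun v hv => ?_
    rw [card_filter]
    exact sum_congr rfl fun u _ => by simp [hv]
  · intro v _ hv
    exact sum_eq_zero fun u _ => by simp [hv]

namespace Setting

variable {s : Setting V}

variable (s) in
/-- The number of neighbours of `v` in colour `c`. -/
def colDeg (v : V) (c : ℕ) : ℕ := #(univ.filter fun u => u ≠ v ∧ s.col v u = c)

namespace Inv

variable {L : List (List V)} {pk : Finset (V × V)} {ω : Slot V → ℝ} {k : ℕ}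
variable (h : s.Good) (i : s.Inv L pk ω k)
include h i

lemma col_le (c : ℕ) : ω (.col c) ≤ 2 / s.ε := by
  have hε := h.ε_pos
  by_cases hx : .col c ∈ s.used pk
  · rw [i.eq_zero _ hx]; positivity
  have hpos : 0 < ω (.col c) := by linarith [i.one_le _ hx]
  have h1 := i.col_inv c hx
  have h2 := div_le h i
  have h3 : (k : ℝ) * ((1 - s.ε / 2) / s.N) = k / s.N * (1 - s.ε / 2) := by ring
  rw [show (2 : ℝ) / s.ε = (s.ε / 2)⁻¹ by field_simp]
  refine (le_inv_comm₀ (by positivity) hpos).1 ?_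
  nlinarith [h.δ_pos, h.ε_le]

lemma sum_mul_le_card_mul {ι : Type*} (I : Finset ι) (f g : ι → ℕ) (a : ℝ)
    (ha : a ≤ ∑ p ∈ I, ω (.col (f p)) * ω (.col (g p))) :
    s.ε ^ 2 / 4 * a ≤
      #(I.filter fun p => .col (f p) ∉ s.used pk ∧ .col (g p) ∉ s.used pk) := by
  have hε := h.ε_pos
  have h1 : ∑ p ∈ I, ω (.col (f p)) * ω (.col (g p)) ≤
      ∑ p ∈ I, if .col (f p) ∉ s.used pk ∧ .col (g p) ∉ s.used pk then (2 / s.ε) ^ 2 else 0 := by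
    refine sum_le_sum fun p _ => ?_
    split_ifs with hc
    · rw [sq]
      exact mul_le_mul (col_le h i _) (col_le h i _) (i.nonneg _) (by positivity)
    · rw [not_and_or, not_not, not_not] at hc
      rcases hc with hc | hc <;> simp [i.eq_zero _ hc]
  rw [← sum_filter, sum_const, nsmul_eq_mul] at h1
  calc _ ≤ s.ε ^ 2 / 4 * (_ * (2 / s.ε) ^ 2) :=
        mul_le_mul_of_nonneg_left (ha.trans h1) (by positivity)
    _ = _ := by field_simp; ring

lemma sum_le_card_mul {ι : Type*} (I : Finset ι) (f : ι → ℕ) (a : ℝ)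
    (ha : a ≤ ∑ p ∈ I, ω (.col (f p))) :
    s.ε / 2 * a ≤ #(I.filter fun p => .col (f p) ∉ s.used pk) := by
  have hε := h.ε_pos
  have h1 : ∑ p ∈ I, ω (.col (f p)) ≤
      ∑ p ∈ I, if .col (f p) ∉ s.used pk then 2 / s.ε else 0 := by
    refine sum_le_sum fun p _ => ?_
    by_cases hc : .col (f p) ∉ s.used pk
    · rw [if_pos hc]; exact col_le h i _
    · rw [if_neg hc, i.eq_zero _ (not_not.1 hc)]
  rw [← sum_filter, sum_const, nsmul_eq_mul] at h1
  calc _ ≤ s.ε / 2 * (_ * (2 / s.ε)) :=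
        mul_le_mul_of_nonneg_left (ha.trans h1) (by positivity)
    _ = _ := by field_simp

/-- Insertion places for `z`. -/
lemma le_card_ins (z : V) :
    s.ε ^ 2 / 4 * (((min k s.early : ℕ) : ℝ) / 4 - s.μ * s.n) ≤
      #((s.insIdx pk z).filter fun p =>
        .col (s.col z p.1) ∉ s.used pk ∧ .col (s.col z p.2) ∉ s.used pk) := by
  have h1 := le_insVal h i z
  rw [insVal] at h1
  exact sum_mul_le_card_mul h i (s.insIdx pk z) (fun p => s.col z p.1) (fun p => s.col z p.2) _ h1

lemma le_card_nbr (a : V) :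
    s.ε / 2 * (#((univ.filter fun z => z ∉ s.A ∧ z ≠ a)) - s.μ * s.n) ≤
      #((univ.filter fun z => z ∉ s.A ∧ z ≠ a).filter fun z => .col (s.col a z) ∉ s.used pk) := by
  have e : s.testIdx .nbrZ a a = (univ.filter fun z => z ∉ s.A ∧ z ≠ a).map
      ⟨fun z => (a, z), Prod.mk_right_injective a⟩ := by
    ext ⟨x, y⟩
    simp only [testIdx, mem_filter, mem_univ, true_and, mem_map, Function.Embedding.coeFn_mk,
      Prod.mk.injEq]
    constructor
    · rintro ⟨rfl, h2⟩; exact ⟨y, h2, rfl, rfl⟩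
    · rintro ⟨z, h2, rfl, rfl⟩; exact ⟨rfl, h2⟩
  have h1 := le_testVal h i .nbrZ a a
  rw [testVal, e, sum_map, card_map] at h1
  simp only [Function.Embedding.coeFn_mk, testFst, testSnd, i.star, mul_one] at h1
  exact sum_le_card_mul h i _ (fun z => s.col a z) _ h1

lemma le_card_conn (a b : V) :
    s.ε ^ 2 / 4 * (#(univ.filter fun z => z ∉ s.A ∧ z ≠ a ∧ z ≠ b ∧ s.col a z ≠ s.col b z) -
      s.μ * s.n) ≤
      #((univ.filter fun z => z ∉ s.A ∧ z ≠ a ∧ z ≠ b ∧ s.col a z ≠ s.col b z).filter fun z =>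
        .col (s.col a z) ∉ s.used pk ∧ .col (s.col b z) ∉ s.used pk) := by
  have e : s.testIdx .conn a b =
      (univ.filter fun z => z ∉ s.A ∧ z ≠ a ∧ z ≠ b ∧ s.col a z ≠ s.col b z).map
      ⟨fun z => (a, z), Prod.mk_right_injective a⟩ := by
    ext ⟨x, y⟩
    simp only [testIdx, mem_filter, mem_univ, true_and, mem_map, Function.Embedding.coeFn_mk,
      Prod.mk.injEq]
    constructor
    · rintro ⟨rfl, h2⟩; exact ⟨y, h2, rfl, rfl⟩
    · rintro ⟨z, h2, rfl, rfl⟩; exact ⟨rfl, h2⟩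
  have h1 := le_testVal h i .conn a b
  rw [testVal, e, sum_map, card_map] at h1
  simp only [Function.Embedding.coeFn_mk, testFst, testSnd] at h1
  exact sum_mul_le_card_mul h i _ (fun z => s.col a z) (fun z => s.col b z) _ h1

lemma inv_le_of_final (hk : (1 - s.δ) * s.N - 1 ≤ k) {y : ℝ} (hy : 0 < y)
    (hy' : |y⁻¹ - (1 - k / s.N)| ≤ k * (4 * s.ρ / s.N)) : 1 ≤ 2 * s.δ * y := by
  have hN := h.N_pos
  have h1 := (abs_le.1 hy').2
  have e1 : (k : ℝ) * (4 * s.ρ / s.N) = k / s.N * (4 * s.ρ) := by ring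
  have h2 : (k : ℝ) / s.N * (4 * s.ρ) ≤ 1 * (4 * s.ρ) :=
    mul_le_mul_of_nonneg_right (by linarith [div_le h i, h.δ_pos]) (by linarith [h.ρ_pos])
  have h3 : 1 ≤ s.ρ * s.N := by
    have := h.err_le
    nlinarith [h.μ_pos, h.n_pos, sq_nonneg s.B, mul_pos h.μ_pos h.n_pos]
  have h4 : 1 - s.δ - s.ρ ≤ (k : ℝ) / s.N := by
    rw [le_div_iff₀ hN]; linarith
  have h5 : y⁻¹ ≤ 2 * s.δ := by linarith [h.ρ_le_δ, h.δ_pos]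
  calc (1 : ℝ) = y⁻¹ * y := (inv_mul_cancel₀ hy.ne').symm
    _ ≤ _ := mul_le_mul_of_nonneg_right h5 hy.le

omit i in
lemma idx_add_le (j : TestKind) (a b : V) :
    (#(s.testIdx j a b) : ℝ) + s.μ * s.n ≤ 2 * s.n := by
  have h1 := h.card_testIdx_le j a b
  have h2 : s.μ * s.n ≤ s.ρ * s.N := by linarith [h.err_le, sq_nonneg s.B]
  nlinarith [h.ρ_le, h.N_pos, Good.N_le_n (s := s)]

lemma sum_colDeg_out_le (hk : (1 - s.δ) * s.N - 1 ≤ k) (c : ℕ) :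
    ∑ v ∈ s.A.filter (fun v => .out v ∉ s.used pk), (s.colDeg v c : ℝ) ≤ 4 * s.δ * s.n := by
  have hδ := h.δ_pos
  have hn := h.n_pos
  by_cases hc : ∃ a b, s.col a b = c
  swap
  · push Not at hc
    refine (sum_nonpos fun v _ => ?_).trans (by positivity)
    simp [colDeg, hc]
  obtain ⟨a, b, rfl⟩ := hc
  have h1 := (testVal_le h i .lOut a b).trans (idx_add_le h _ _ _)
  simp only [testVal, testFst, testSnd, i.star, mul_one] at h1
  set F := (s.testIdx .lOut a b).filter fun p => .out p.1 ∉ s.used pk with hF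
  have h2 : (∑ v ∈ s.A.filter (fun v => .out v ∉ s.used pk), (s.colDeg v (s.col a b) : ℝ)) = #F := by
    rw [← Nat.cast_sum]
    simp only [colDeg]
    rw [sum_card_filter_eq]
    congr 2
    ext p
    simp only [hF, testIdx, mem_filter, mem_univ, true_and]
    constructor
    · rintro ⟨⟨h1, h2⟩, h3, h4⟩; exact ⟨⟨⟨h3.symm, h4⟩, h1⟩, h2⟩
    · rintro ⟨⟨⟨h3, h4⟩, h1⟩, h2⟩; exact ⟨⟨h1, h2⟩, h3.symm, h4⟩
  have h3 : (#F : ℝ) ≤ 2 * s.δ * ∑ p ∈ s.testIdx .lOut a b, ω (.out p.1) := by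
    calc (#F : ℝ) = ∑ p ∈ F, (1 : ℝ) := by simp
      _ ≤ ∑ p ∈ F, 2 * s.δ * ω (.out p.1) := by
          refine sum_le_sum fun p hp => ?_
          have hp' := mem_filter.1 hp
          have hpA : p.1 ∈ s.A := by simpa using (mem_filter.1 hp'.1).2.2
          exact inv_le_of_final h i hk (by linarith [i.one_le _ hp'.2]) (i.out_inv _ hpA hp'.2)
      _ ≤ ∑ p ∈ s.testIdx .lOut a b, 2 * s.δ * ω (.out p.1) :=
          sum_le_sum_of_subset_of_nonneg (filter_subset _ _) fun p _ _ =>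
            mul_nonneg (by positivity) (i.nonneg _)
      _ = _ := by rw [mul_sum]
  rw [h2]
  refine h3.trans ((mul_le_mul_of_nonneg_left h1 (by positivity)).trans (le_of_eq (by ring)))

lemma sum_colDeg_inn_le (hk : (1 - s.δ) * s.N - 1 ≤ k) (c : ℕ) :
    ∑ v ∈ s.A.filter (fun v => .inn v ∉ s.used pk), (s.colDeg v c : ℝ) ≤ 4 * s.δ * s.n := by
  have hδ := h.δ_pos
  have hn := h.n_pos
  by_cases hc : ∃ a b, s.col a b = c
  swap
  · push Not at hc
    refine (sum_nonpos fun v _ => ?_).trans (by positivity)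
    simp [colDeg, hc]
  obtain ⟨a, b, rfl⟩ := hc
  have h1 := (testVal_le h i .lIn a b).trans (idx_add_le h _ _ _)
  simp only [testVal, testFst, testSnd, i.star, mul_one] at h1
  set F := (s.testIdx .lIn a b).filter fun p => .inn p.2 ∉ s.used pk with hF
  have h2 : (∑ v ∈ s.A.filter (fun v => .inn v ∉ s.used pk), (s.colDeg v (s.col a b) : ℝ)) = #F := by
    rw [← Nat.cast_sum]
    simp only [colDeg]
    rw [sum_card_filter_eq]
    congr 1
    refine card_equiv (Equiv.prodComm V V) fun p => ?_
    simp only [hF, testIdx, mem_filter, mem_univ, true_and, Equiv.prodComm_apply, Prod.fst_swap,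
      Prod.snd_swap, h.symm p.2 p.1]
    tauto
  have h3 : (#F : ℝ) ≤ 2 * s.δ * ∑ p ∈ s.testIdx .lIn a b, ω (.inn p.2) := by
    calc (#F : ℝ) = ∑ p ∈ F, (1 : ℝ) := by simp
      _ ≤ ∑ p ∈ F, 2 * s.δ * ω (.inn p.2) := by
          refine sum_le_sum fun p hp => ?_
          have hp' := mem_filter.1 hp
          have hpA : p.2 ∈ s.A := by simpa using (mem_filter.1 hp'.1).2.2
          exact inv_le_of_final h i hk (by linarith [i.one_le _ hp'.2]) (i.inn_inv _ hpA hp'.2)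
      _ ≤ ∑ p ∈ s.testIdx .lIn a b, 2 * s.δ * ω (.inn p.2) :=
          sum_le_sum_of_subset_of_nonneg (filter_subset _ _) fun p _ _ =>
            mul_nonneg (by positivity) (i.nonneg _)
      _ = _ := by rw [mul_sum]
  rw [h2]
  refine h3.trans ((mul_le_mul_of_nonneg_left h1 (by positivity)).trans (le_of_eq (by ring)))

end Inv

end Setting

end FinalState

section Connectors

variable {V : Type*} [Fintype V] [DecidableEq V]

namespace Setting

variable (s : Setting V)

/-- The vertices outside `s.A`. -/
def Z : Finset V := univ.filter fun z => z ∉ s.A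

variable {s} in
lemma mem_Z {z : V} : z ∈ s.Z ↔ z ∉ s.A := by simp [Z]

/-- Pairs of vertices through which `y` can be joined to `x` in unused colours. -/
def connOpts (pk : Finset (V × V)) (y x : V) : Finset (V × V) :=
  univ.filter fun p => p.1 ∈ s.Z ∧ p.2 ∈ s.Z ∧ p.1 ≠ p.2 ∧ .col (s.col y p.1) ∉ s.used pk ∧
    .col (s.col p.1 p.2) ∉ s.used pk ∧ .col (s.col x p.2) ∉ s.used pk ∧
    s.col y p.1 ≠ s.col p.1 p.2 ∧ s.col y p.1 ≠ s.col x p.2 ∧ s.col p.1 p.2 ≠ s.col x p.2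

/-- Forest edges into which `z` can be inserted in unused colours. -/
def insOpts (pk : Finset (V × V)) (z : V) : Finset (V × V) :=
  (s.insIdx pk z).filter fun p =>
    .col (s.col z p.1) ∉ s.used pk ∧ .col (s.col z p.2) ∉ s.used pk

/-- Colours, vertices and forest edges consumed by a connection (`Sum.inl`) or by an
insertion (`Sum.inr`). -/
def res (x : V → V) : V ⊕ V → V × V → Finset (ℕ ⊕ V ⊕ V × V)
  | .inl y, p => {.inl (s.col y p.1), .inl (s.col p.1 p.2), .inl (s.col (x y) p.2),
      .inr (.inl p.1), .inr (.inl p.2)}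
  | .inr z, p => {.inl (s.col z p.1), .inl (s.col z p.2), .inr (.inr p)}

lemma card_res_le (x : V → V) (j : V ⊕ V) (p : V × V) : #(s.res x j p) ≤ 5 := by
  rcases j with y | z
  · exact card_le_five
  · exact card_le_three.trans (by norm_num)

variable {s}

namespace Inv

variable {L : List (List V)} {pk : Finset (V × V)} {ω : Slot V → ℝ} {k : ℕ}
variable (h : s.Good) (i : s.Inv L pk ω k)
include h

lemma sum_card_mono_le (x : V) :
    ∑ z ∈ s.Z, (#(s.Z.filter fun z' => z' ≠ z ∧ s.col z z' = s.col x z') : ℝ) ≤ #s.Z * s.Δ := by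
  have e : ∑ z ∈ s.Z, #(s.Z.filter fun z' => z' ≠ z ∧ s.col z z' = s.col x z') =
      ∑ z' ∈ s.Z, #(s.Z.filter fun z => z' ≠ z ∧ s.col z z' = s.col x z') := by
    simp_rw [card_filter]
    exact sum_comm
  rw [← Nat.cast_sum, e, Nat.cast_sum, ← nsmul_eq_mul]
  refine sum_le_card_nsmul _ _ _ fun z' _ => le_trans ?_ (h.deg_le z' (s.col x z'))
  refine Nat.cast_le.2 (card_le_card fun z hz => ?_)
  have hz' := mem_filter.1 hz
  exact mem_filter.2 ⟨mem_univ _, hz'.2.1.symm, by rw [h.symm]; exact hz'.2.2⟩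

include i

lemma le_card_connOpts {y x : V} (hy : y ∈ s.A) (hx : x ∈ s.A)
    (hZ : 1 + s.μ * s.n ≤ #s.Z / 2) (hΔ : s.Δ ≤ s.ε ^ 3 / 128 * #s.Z) :
    s.ε ^ 3 / 64 * (#s.Z : ℝ) ^ 2 ≤ #(s.connOpts pk y x) := by
  set G := (univ.filter fun z => z ∉ s.A ∧ z ≠ y).filter fun z => .col (s.col y z) ∉ s.used pk with hG
  have hε := h.ε_pos
  have hε' := h.ε_le
  have hΔ1 := h.one_le_Δ
  have hGZ : G ⊆ s.Z := fun z hz => mem_Z.2 (by simp [hG] at hz; exact hz.1.1)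
  have hGcard : s.ε / 4 * #s.Z ≤ #G := by
    have h1 := le_card_nbr h i y
    have e : (univ.filter fun z => z ∉ s.A ∧ z ≠ y) = s.Z := by
      ext z
      simp only [mem_filter, mem_univ, true_and, mem_Z]
      exact ⟨fun h => h.1, fun h => ⟨h, fun e => h (e ▸ hy)⟩⟩
    rw [← hG, e] at h1
    nlinarith
  set mono : V → Finset V := fun z => s.Z.filter fun z' => z' ≠ z ∧ s.col z z' = s.col x z' with hmono
  set fib : V → Finset V := fun z => univ.filter fun z' =>
    z ∈ s.Z ∧ z' ∈ s.Z ∧ z ≠ z' ∧ .col (s.col y z) ∉ s.used pk ∧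
    .col (s.col z z') ∉ s.used pk ∧ .col (s.col x z') ∉ s.used pk ∧
    s.col y z ≠ s.col z z' ∧ s.col y z ≠ s.col x z' ∧ s.col z z' ≠ s.col x z' with hfib
  have hfibcard : ∀ z ∈ G, s.ε ^ 2 / 4 * (#s.Z / 2 - #(mono z)) - 2 * s.Δ ≤ #(fib z) := by
    intro z hz
    have h1 := le_card_conn h i z x
    set C := univ.filter fun z' => z' ∉ s.A ∧ z' ≠ z ∧ z' ≠ x ∧ s.col z z' ≠ s.col x z' with hC
    set F := C.filter fun z' => .col (s.col z z') ∉ s.used pk ∧ .col (s.col x z') ∉ s.used pk with hF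
    have h2 : #s.Z ≤ #C + #(mono z) + 1 := by
      have : s.Z ⊆ (C ∪ mono z) ∪ {z} := by
        intro z' hz'
        simp only [hC, hmono, mem_union, mem_filter, mem_univ, true_and, mem_singleton, hz']
        have : z' ≠ x := fun e => (mem_Z.1 hz') (e ▸ hx)
        have := mem_Z.1 hz'
        tauto
      refine (card_le_card this).trans ((card_union_le _ _).trans ?_)
      rw [card_singleton]
      exact Nat.add_le_add_right (card_union_le _ _) 1
    have h3 : #F ≤ #(fib z) + #(univ.filter fun u => u ≠ z ∧ s.col z u = s.col y z) +
        #(univ.filter fun u => u ≠ x ∧ s.col x u = s.col y z) := by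
      have : F ⊆ (fib z ∪ (univ.filter fun u => u ≠ z ∧ s.col z u = s.col y z)) ∪
          (univ.filter fun u => u ≠ x ∧ s.col x u = s.col y z) := by
        intro z' hz'
        have hzZ := hGZ hz
        have hz2 : .col (s.col y z) ∉ s.used pk := (mem_filter.1 hz).2
        simp only [hF, hC, mem_filter, mem_univ, true_and] at hz'
        obtain ⟨⟨a1, a2, a3, a4⟩, a5, a6⟩ := hz'
        by_cases e1 : s.col z z' = s.col y z
        · exact mem_union_left _ (mem_union_right _ (mem_filter.2 ⟨mem_univ _, a2, e1⟩))
        by_cases e2 : s.col x z' = s.col y z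
        · exact mem_union_right _ (mem_filter.2 ⟨mem_univ _, a3, e2⟩)
        exact mem_union_left _ (mem_union_left _ (mem_filter.2 ⟨mem_univ _, hzZ, mem_Z.2 a1,
          a2.symm, hz2, a5, a6, fun e => e1 e.symm, fun e => e2 e.symm, a4⟩))
      exact (card_le_card this).trans ((card_union_le _ _).trans
        (Nat.add_le_add_right (card_union_le _ _) _))
    have h4 := h.deg_le z (s.col y z)
    have h5 := h.deg_le x (s.col y z)
    have h2' : (#s.Z : ℝ) ≤ #C + #(mono z) + 1 := by exact_mod_cast h2
    have h3' : (#F : ℝ) ≤ #(fib z) + #(univ.filter fun u => u ≠ z ∧ s.col z u = s.col y z) +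
        #(univ.filter fun u => u ≠ x ∧ s.col x u = s.col y z) := by exact_mod_cast h3
    have h6 : s.ε ^ 2 / 4 * (#s.Z / 2 - #(mono z)) ≤ s.ε ^ 2 / 4 * (#C - s.μ * s.n) :=
      mul_le_mul_of_nonneg_left (by linarith) (by positivity)
    linarith
  have h7 : (#(s.connOpts pk y x) : ℝ) = ∑ z, (#(fib z) : ℝ) := by
    rw [← Nat.cast_sum, hfib, sum_card_filter_eq]
    simp [connOpts]
  have h8 : ∑ z ∈ G, (#(fib z) : ℝ) ≤ ∑ z, (#(fib z) : ℝ) :=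
    sum_le_sum_of_subset_of_nonneg (subset_univ _) fun _ _ _ => Nat.cast_nonneg _
  have h9 : ∑ z ∈ G, (#(mono z) : ℝ) ≤ #s.Z * s.Δ :=
    (sum_le_sum_of_subset_of_nonneg hGZ fun _ _ _ => Nat.cast_nonneg _).trans
      (sum_card_mono_le h x)
  have h10 := sum_le_sum hfibcard
  rw [sum_sub_distrib, ← mul_sum, sum_sub_distrib, sum_const, sum_const, nsmul_eq_mul,
    nsmul_eq_mul] at h10
  rw [h7]
  refine le_trans ?_ (h10.trans h8)
  set z : ℝ := ((#s.Z : ℕ) : ℝ) with hz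
  have hz0 : 0 ≤ z := Nat.cast_nonneg _
  have h11 : s.ε ^ 2 / 4 * ∑ z ∈ G, (#(mono z) : ℝ) ≤ s.ε ^ 2 / 4 * (z * (s.ε ^ 3 / 128 * z)) :=
    mul_le_mul_of_nonneg_left (h9.trans (mul_le_mul_of_nonneg_left hΔ hz0)) (by positivity)
  have h12 : s.ε ^ 2 / 8 * z - s.ε ^ 3 / 64 * z ≤ s.ε ^ 2 / 8 * z - 2 * s.Δ := by linarith
  have h13 : 0 ≤ s.ε ^ 2 / 8 * z - s.ε ^ 3 / 64 * z := by
    have : 0 ≤ s.ε ^ 2 * z * (1 / 8 - s.ε / 64) := by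
      refine mul_nonneg (by positivity) (by linarith)
    nlinarith
  have h14 : s.ε / 4 * z * (s.ε ^ 2 / 8 * z - s.ε ^ 3 / 64 * z) ≤
      #G * (s.ε ^ 2 / 8 * z - 2 * s.Δ) :=
    mul_le_mul hGcard h12 h13 (Nat.cast_nonneg _)
  have h15 : s.ε ^ 3 / 64 * z ^ 2 ≤ s.ε / 4 * z * (s.ε ^ 2 / 8 * z - s.ε ^ 3 / 64 * z) -
      s.ε ^ 2 / 4 * (z * (s.ε ^ 3 / 128 * z)) := by
    have : 0 ≤ s.ε ^ 3 * z ^ 2 * (1 / 64 - s.ε / 256 - s.ε ^ 2 / 512) := by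
      refine mul_nonneg (by positivity) ?_
      nlinarith
    nlinarith
  have e : s.ε ^ 2 / 4 * (#G * (z / 2) - ∑ z ∈ G, (#(mono z) : ℝ)) - #G * (2 * s.Δ) =
      #G * (s.ε ^ 2 / 8 * z - 2 * s.Δ) - s.ε ^ 2 / 4 * ∑ z ∈ G, (#(mono z) : ℝ) := by ring
  rw [e]
  linarith

end Inv

end Setting

end Connectors

section Transversal

variable {V : Type*} [Fintype V] [DecidableEq V]

namespace Setting

variable {s : Setting V}

lemma card_connOpts_col_le (pk : Finset (V × V)) {y x : V} (hy : y ∈ s.A) (hx : x ∈ s.A) (c : ℕ) :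
    #((s.connOpts pk y x).filter fun p => c = s.col y p.1 ∨ c = s.col p.1 p.2 ∨ c = s.col x p.2) ≤
      s.colDeg y c * #s.Z + ∑ z ∈ s.Z, s.colDeg z c + #s.Z * s.colDeg x c := by
  have h1 : #(univ.filter fun p : V × V => p.1 ∈ s.Z ∧ (p.2 ≠ p.1 ∧ s.col p.1 p.2 = c)) =
      ∑ z ∈ s.Z, s.colDeg z c := (sum_card_filter_eq s.Z fun v u => u ≠ v ∧ s.col v u = c).symm
  rw [← h1, colDeg, colDeg, ← card_product, ← card_product]
  refine (card_le_card fun p hp => ?_).trans ((card_union_le _ _).trans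
    (Nat.add_le_add_right (card_union_le _ _) _))
  obtain ⟨hp, hc⟩ := mem_filter.1 hp
  obtain ⟨-, p1, p2, p3, -⟩ := mem_filter.1 hp
  rw [mem_union, mem_union, mem_product, mem_product, mem_filter, mem_filter, mem_filter]
  rcases hc with hc | hc | hc
  · exact .inl (.inl ⟨⟨mem_univ _, fun e => mem_Z.1 p1 (e ▸ hy), hc.symm⟩, p2⟩)
  · exact .inl (.inr ⟨mem_univ _, p1, p3.symm, hc.symm⟩)
  · exact .inr ⟨p1, mem_univ _, fun e => mem_Z.1 p2 (e ▸ hx), hc.symm⟩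

lemma card_connOpts_vert_le (pk : Finset (V × V)) (y x v : V) :
    #((s.connOpts pk y x).filter fun p => v = p.1 ∨ v = p.2) ≤ 2 * #s.Z := by
  have : ((s.connOpts pk y x).filter fun p => v = p.1 ∨ v = p.2) ⊆ {v} ×ˢ s.Z ∪ s.Z ×ˢ {v} := by
    intro p hp
    obtain ⟨hp, hc⟩ := mem_filter.1 hp
    obtain ⟨-, p1, p2, -⟩ := mem_filter.1 hp
    rw [mem_union, mem_product, mem_product, mem_singleton, mem_singleton]
    exact hc.imp (fun e => ⟨e.symm, p2⟩) fun e => ⟨p1, e.symm⟩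
  refine (card_le_card this).trans ((card_union_le _ _).trans ?_)
  rw [card_product, card_product, card_singleton]
  omega

variable {L : List (List V)} {pk : Finset (V × V)} {ω : Slot V → ℝ} {k : ℕ}

lemma IsForest.card_insOpts_col_le (hf : s.IsForest L pk) (z : V) (c : ℕ) :
    #((s.insOpts pk z).filter fun p => c = s.col z p.1 ∨ c = s.col z p.2) ≤ 2 * s.colDeg z c := by
  rw [filter_or, two_mul]
  refine (card_union_le _ _).trans (Nat.add_le_add ?_ ?_)
  · refine card_le_card_of_injOn Prod.fst (fun p hp => ?_) fun p hp q hq e => ?_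
    · obtain ⟨hp, hc⟩ := mem_filter.1 hp
      obtain ⟨-, p1, p2, -⟩ := mem_filter.1 (mem_filter.1 hp).1
      exact mem_filter.2 ⟨mem_univ _, p1, hc.symm⟩
    · exact hf.fst_injOn _ (mem_filter.1 (mem_filter.1 (mem_filter.1 hp).1).1).1
        _ (mem_filter.1 (mem_filter.1 (mem_filter.1 hq).1).1).1 e
  · refine card_le_card_of_injOn Prod.snd (fun p hp => ?_) fun p hp q hq e => ?_
    · obtain ⟨hp, hc⟩ := mem_filter.1 hp
      obtain ⟨-, p1, p2, -⟩ := mem_filter.1 (mem_filter.1 hp).1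
      exact mem_filter.2 ⟨mem_univ _, p2, hc.symm⟩
    · exact hf.snd_injOn _ (mem_filter.1 (mem_filter.1 (mem_filter.1 hp).1).1).1
        _ (mem_filter.1 (mem_filter.1 (mem_filter.1 hq).1).1).1 e

lemma sum_div_card_le {ι : Type*} (S : Finset ι) (f g : ι → ℕ) {P : ℝ} (hP : 0 < P)
    (hg : ∀ j ∈ S, P ≤ g j) : ∑ j ∈ S, (f j : ℝ) / g j ≤ (∑ j ∈ S, (f j : ℝ)) / P := by
  rw [sum_div]
  exact sum_le_sum fun j hj => div_le_div_of_nonneg_left (Nat.cast_nonneg _) hP (hg j hj)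

lemma IsForest.exists_transversal (hf : s.IsForest L pk) (Y : Finset V) (hY : Y ⊆ s.A) (x : V → V)
    (hx : ∀ y ∈ Y, x y ∈ s.A) {P Q d e : ℝ} (hP : 0 < P) (hQ : 0 < Q)
    (hPle : ∀ y ∈ Y, P ≤ #(s.connOpts pk y (x y))) (hQle : ∀ z ∈ s.Z, Q ≤ #(s.insOpts pk z))
    (hd : ∀ c, ∑ y ∈ Y, (s.colDeg y c : ℝ) + ∑ y ∈ Y, (s.colDeg (x y) c : ℝ) ≤ d)
    (he : ∀ c, ∑ z ∈ s.Z, (s.colDeg z c : ℝ) ≤ e)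
    (h1 : (#s.Z * d + #Y * e) / P + 2 * e / Q ≤ 1 / 20)
    (h2 : 2 * #Y * #s.Z / P ≤ 1 / 20) (h3 : #s.Z / Q ≤ 1 / 20) :
    ∃ F : V ⊕ V → V × V, (∀ y ∈ Y, F (.inl y) ∈ s.connOpts pk y (x y)) ∧
      (∀ z ∈ s.Z, F (.inr z) ∈ s.insOpts pk z) ∧
      ∀ j ∈ Y.disjSum s.Z, ∀ j' ∈ Y.disjSum s.Z, j ≠ j' →
        Disjoint (s.res x j (F j)) (s.res x j' (F j')) := by
  let U : V ⊕ V → Finset (V × V) := Sum.elim (fun y => s.connOpts pk y (x y)) (s.insOpts pk)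
  rcases isEmpty_or_nonempty V with hV | ⟨⟨v₀⟩⟩
  · exact ⟨fun j => (hV.elim (j.elim id id)), fun y => hV.elim y, fun y => hV.elim y,
      fun j => hV.elim (j.elim id id)⟩
  suffices hload : ∀ r, ∑ j ∈ Y.disjSum s.Z,
      (#((U j).filter fun b => r ∈ s.res x j b) : ℝ) / #(U j) ≤ 1 / 20 by
    have hne : ∀ j ∈ Y.disjSum s.Z, (U j).Nonempty := by
      rintro (y | z) hj
      · have := hPle y (inl_mem_disjSum.1 hj)
        exact card_pos.1 (by exact_mod_cast hP.trans_le this)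
      · have := hQle z (inr_mem_disjSum.1 hj)
        exact card_pos.1 (by exact_mod_cast hQ.trans_le this)
    have key := exists_disjoint_choice U (s.res x) (v₀, v₀) (Y.disjSum s.Z) hne
      (fun j p => s.card_res_le x j p) fun r => by convert hload r
    obtain ⟨F, hF, hF'⟩ := key
    exact ⟨F, fun y hy => hF _ (inl_mem_disjSum.2 hy), fun z hz => hF _ (inr_mem_disjSum.2 hz), hF'⟩
  · intro r
    rw [sum_disjSum]
    simp only [U, Sum.elim_inl, Sum.elim_inr]
    have b1 := sum_div_card_le Y
      (fun y => #((s.connOpts pk y (x y)).filter fun b => r ∈ s.res x (.inl y) b)) _ hP hPle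
    have b2 := sum_div_card_le s.Z
      (fun z => #((s.insOpts pk z).filter fun b => r ∈ s.res x (.inr z) b)) _ hQ hQle
    refine (add_le_add b1 b2).trans ?_
    rcases r with c | v | p
    · have c1 : ∑ y ∈ Y, (#((s.connOpts pk y (x y)).filter fun b => .inl c ∈ s.res x (.inl y) b) : ℝ)
          ≤ #s.Z * d + #Y * e := by
        calc _ ≤ ∑ y ∈ Y, ((s.colDeg y c : ℝ) * #s.Z + ∑ z ∈ s.Z, (s.colDeg z c : ℝ) +
              #s.Z * s.colDeg (x y) c) := by
              refine sum_le_sum fun y hy => ?_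
              have := card_connOpts_col_le pk (hY hy) (hx y hy) c
              simp only [res, mem_insert, mem_singleton, Sum.inl.injEq, reduceCtorEq, or_false]
              exact_mod_cast this
          _ = #s.Z * (∑ y ∈ Y, (s.colDeg y c : ℝ) + ∑ y ∈ Y, (s.colDeg (x y) c : ℝ)) +
              #Y * ∑ z ∈ s.Z, (s.colDeg z c : ℝ) := by
              rw [sum_add_distrib, sum_add_distrib, ← sum_mul, ← mul_sum, sum_const, nsmul_eq_mul]
              ring
          _ ≤ _ := add_le_add (mul_le_mul_of_nonneg_left (hd c) (Nat.cast_nonneg _))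
              (mul_le_mul_of_nonneg_left (he c) (Nat.cast_nonneg _))
      have c2 : ∑ z ∈ s.Z, (#((s.insOpts pk z).filter fun b => .inl c ∈ s.res x (.inr z) b) : ℝ)
          ≤ 2 * e := by
        calc _ ≤ ∑ z ∈ s.Z, 2 * (s.colDeg z c : ℝ) := by
              refine sum_le_sum fun z hz => ?_
              have := hf.card_insOpts_col_le z c
              simp only [res, mem_insert, mem_singleton, Sum.inl.injEq, reduceCtorEq, or_false]
              exact_mod_cast this
          _ ≤ _ := by
            rw [← mul_sum]
            linarith [he c]
      exact (add_le_add (div_le_div_of_nonneg_right c1 hP.le)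
        (div_le_div_of_nonneg_right c2 hQ.le)).trans h1
    · have c1 : ∑ y ∈ Y, (#((s.connOpts pk y (x y)).filter fun b =>
          .inr (.inl v) ∈ s.res x (.inl y) b) : ℝ) ≤ 2 * #Y * #s.Z := by
        calc _ ≤ ∑ y ∈ Y, (2 * #s.Z : ℝ) := by
              refine sum_le_sum fun y hy => ?_
              have := card_connOpts_vert_le (s := s) pk y (x y) v
              simp only [res, mem_insert, mem_singleton, Sum.inr.injEq, Sum.inl.injEq, reduceCtorEq,
                false_or]
              exact_mod_cast this
          _ = _ := by
            rw [sum_const, nsmul_eq_mul]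
            ring
      have c2 : ∑ z ∈ s.Z, (#((s.insOpts pk z).filter fun b =>
          .inr (.inl v) ∈ s.res x (.inr z) b) : ℝ) = 0 := by
        simp [res]
      rw [c2, zero_div, add_zero]
      exact (div_le_div_of_nonneg_right c1 hP.le).trans h2
    · have c1 : ∑ y ∈ Y, (#((s.connOpts pk y (x y)).filter fun b =>
          .inr (.inr p) ∈ s.res x (.inl y) b) : ℝ) = 0 := by
        simp [res]
      have c2 : ∑ z ∈ s.Z, (#((s.insOpts pk z).filter fun b =>
          .inr (.inr p) ∈ s.res x (.inr z) b) : ℝ) ≤ #s.Z := by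
        rw [← nsmul_one, ← sum_const]
        refine sum_le_sum fun z _ => ?_
        have : #((s.insOpts pk z).filter fun b => .inr (.inr p) ∈ s.res x (.inr z) b) ≤
            #({p} : Finset (V × V)) := by
          refine card_le_card fun q hq => ?_
          have := (mem_filter.1 hq).2
          simp only [res, mem_insert, mem_singleton, Sum.inr.injEq, reduceCtorEq, false_or] at this
          exact mem_singleton.2 this.symm
        exact_mod_cast this
      rw [c1, zero_div, zero_add]
      exact (div_le_div_of_nonneg_right c2 hQ.le).trans h3

end Setting

end Transversal

section Assembly

variable {V : Type*} [Fintype V] [DecidableEq V]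

namespace Setting

variable (s : Setting V)

/-- Directed edges used by a connection (`Sum.inl`) or by an insertion (`Sum.inr`). -/
def links (x : V → V) : V ⊕ V → V × V → Finset (V × V)
  | .inl y, p => {(y, p.1), (p.1, p.2), (p.2, x y)}
  | .inr z, p => {(p.1, z), (z, p.2)}

/-- A conflict-free choice of connections from `y ∈ Y` to `x y`, and of places of insertion. -/
structure IsTransversal (pk : Finset (V × V)) (Y : Finset V) (x : V → V) (F : V ⊕ V → V × V) :
    Prop where
  subset : Y ⊆ s.A
  maps : ∀ y ∈ Y, x y ∈ s.A
  conn : ∀ y ∈ Y, F (.inl y) ∈ s.connOpts pk y (x y)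
  ins : ∀ z ∈ s.Z, F (.inr z) ∈ s.insOpts pk z
  disj : ∀ j ∈ Y.disjSum s.Z, ∀ j' ∈ Y.disjSum s.Z, j ≠ j' →
    Disjoint (s.res x j (F j)) (s.res x j' (F j'))

variable {s}

namespace IsTransversal

variable {L : List (List V)} {pk : Finset (V × V)} {Y : Finset V} {x : V → V} {F : V ⊕ V → V × V}
variable (hs : ∀ u v, s.col u v = s.col v u) (τ : s.IsTransversal pk Y x F)
include hs τ

lemma of_mem_links {j : V ⊕ V} (hj : j ∈ Y.disjSum s.Z) {a b : V} (h : (a, b) ∈ links x j (F j)) :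
    .inl (s.col a b) ∈ s.res x j (F j) ∧ .col (s.col a b) ∉ s.used pk ∧ a ≠ b := by
  rcases j with y | z
  · have hy := inl_mem_disjSum.1 hj
    obtain ⟨-, h1, h2, h3, h4, h5, h6, -⟩ := mem_filter.1 (τ.conn y hy)
    have hyA := τ.subset hy
    have hxA := τ.maps y hy
    simp only [links, mem_insert, mem_singleton, Prod.mk.injEq] at h
    obtain ⟨rfl, rfl⟩ | ⟨rfl, rfl⟩ | ⟨rfl, rfl⟩ := h
    · exact ⟨by simp [res], h4, fun e => mem_Z.1 h1 (e ▸ hyA)⟩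
    · exact ⟨by simp [res], h5, h3⟩
    · rw [hs]
      exact ⟨by simp [res], h6, fun e => mem_Z.1 h2 (e ▸ hxA)⟩
  · obtain ⟨h1, h2, h3⟩ := mem_filter.1 (τ.ins z (inr_mem_disjSum.1 hj))
    obtain ⟨-, h4, h5, -⟩ := mem_filter.1 h1
    simp only [links, mem_insert, mem_singleton, Prod.mk.injEq] at h
    obtain ⟨rfl, rfl⟩ | ⟨rfl, rfl⟩ := h
    · rw [hs]
      exact ⟨by simp [res], h2, h4⟩
    · exact ⟨by simp [res], h3, h5.symm⟩

lemma fst_eq_of_mem_links {j : V ⊕ V} (hj : j ∈ Y.disjSum s.Z) {a b c d : V}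
    (h : (a, b) ∈ links x j (F j)) (h' : (c, d) ∈ links x j (F j)) (e : s.col a b = s.col c d) :
    a = c := by
  rcases j with y | z
  · have hy := inl_mem_disjSum.1 hj
    obtain ⟨-, -, -, -, -, -, -, h1, h2, h3⟩ := mem_filter.1 (τ.conn y hy)
    rw [hs (x y)] at h2 h3
    simp only [links, mem_insert, mem_singleton, Prod.mk.injEq] at h h'
    obtain ⟨rfl, rfl⟩ | ⟨rfl, rfl⟩ | ⟨rfl, rfl⟩ := h <;>
    obtain ⟨rfl, rfl⟩ | ⟨rfl, rfl⟩ | ⟨rfl, rfl⟩ := h' <;>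
    first | rfl | exact absurd e ‹_› | exact absurd e.symm ‹_›
  · obtain ⟨h1, -⟩ := mem_filter.1 (τ.ins z (inr_mem_disjSum.1 hj))
    obtain ⟨-, -, -, h2⟩ := mem_filter.1 h1
    rw [hs z (F (.inr z)).1] at h2
    simp only [links, mem_insert, mem_singleton, Prod.mk.injEq] at h h'
    obtain ⟨rfl, rfl⟩ | ⟨rfl, rfl⟩ := h <;>
    obtain ⟨rfl, rfl⟩ | ⟨rfl, rfl⟩ := h' <;>
    first | rfl | exact absurd e ‹_› | exact absurd e.symm ‹_›

lemma fst_eq_of_col_eq (hf : s.IsForest L pk) {a b c d : V}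
    (h : (a, b) ∈ pk ∨ ∃ j ∈ Y.disjSum s.Z, (a, b) ∈ links x j (F j))
    (h' : (c, d) ∈ pk ∨ ∃ j ∈ Y.disjSum s.Z, (c, d) ∈ links x j (F j))
    (e : s.col a b = s.col c d) : a = c := by
  have hused : ∀ {u v}, (u, v) ∈ pk → .col (s.col u v) ∈ s.used pk := fun hm =>
    mem_used.2 ⟨_, hm, by simp [slots]⟩
  rcases h with h | ⟨j, hj, h⟩ <;> rcases h' with h' | ⟨j', hj', h'⟩
  · exact congrArg Prod.fst (hf.col_injOn _ h _ h' e)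
  · exact absurd (e ▸ hused h) (τ.of_mem_links hs hj' h').2.1
  · exact absurd (e ▸ hused h') (τ.of_mem_links hs hj h).2.1
  · rcases eq_or_ne j j' with rfl | hne
    · exact τ.fst_eq_of_mem_links hs hj h h' e
    · exact absurd (e ▸ (τ.of_mem_links hs hj' h').1)
        (disjoint_left.1 (τ.disj j hj j' hj' hne) (τ.of_mem_links hs hj h).1)

lemma exists_cycle (hf : s.IsForest L pk) (φ : Sym2 V → ℕ) (hφ : ∀ u v, s.col u v = φ s(u, v))
    (L₁ : List (List V)) (hL₁ : L₁ ≠ []) (hpre : ∀ l ∈ L₁, l ≠ [] ∧ ∃ q ∈ L, l <+: q)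
    (hnd : L₁.flatten.Nodup) (lst hd : List V → V)
    (hlst : ∀ l ∈ L₁, l.getLast? = some (lst l)) (hhd : ∀ l ∈ L₁, l.head? = some (hd l))
    (hY : ∀ v, v ∈ Y ↔ ∃ l ∈ L₁, lst l = v)
    (hx : (L₁ ++ L₁).IsChain fun l l' => x (lst l) = hd l')
    (t : ℕ) (ht : t = 0 ∨ L₁ = L ∧ t + 2 * L.length ≤ #s.Z)
    (h3 : 3 ≤ L₁.flatten.length + 2 * L₁.length + t) :
    ∃ (v : V) (w : (⊤ : SimpleGraph V).Walk v v), w.IsCycle ∧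
      w.length = L₁.flatten.length + 2 * L₁.length + t ∧ (w.edges.map φ).Nodup := by
  have hA : ∀ v ∈ L₁.flatten, v ∈ s.A := by
    intro v hv
    obtain ⟨l, hl, hvl⟩ := List.mem_flatten.1 hv
    obtain ⟨q, hq, hlq⟩ := (hpre l hl).2
    exact (hf.mem_flatten v).1 (List.mem_flatten.2 ⟨q, hq, hlq.subset hvl⟩)
  have hYl : ∀ l ∈ L₁, lst l ∈ Y := fun l hl => (hY _).2 ⟨l, hl, rfl⟩
  have hlmem : ∀ l ∈ L₁, lst l ∈ l := fun l hl => List.mem_of_getLast? (hlst l hl)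
  have hlinj : ∀ l ∈ L₁, ∀ l' ∈ L₁, lst l = lst l' → l = l' := fun l hl l' hl' e =>
    eq_of_mem_of_nodup_flatten hnd hl hl' (hlmem l hl) (e ▸ hlmem l' hl')
  set R : V → V → Prop := fun a b =>
    (a, b) ∈ pk ∨ ∃ j ∈ Y.disjSum s.Z, (a, b) ∈ links x j (F j) with hR
  have hRne : ∀ a b, R a b → a ≠ b := by
    rintro a b (h | ⟨j, hj, h⟩)
    · exact (hf.pick _ h).2.2
    · exact (τ.of_mem_links hs hj h).2.2
  have hRinj : ∀ a b c d, R a b → R c d → φ s(a, b) = φ s(c, d) → a = c := fun a b c d h h' e =>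
    τ.fst_eq_of_col_eq hs hf h h' (by rw [hφ, hφ, e])
  have hconnZ : ∀ y ∈ Y, (F (.inl y)).1 ∉ s.A ∧ (F (.inl y)).2 ∉ s.A ∧
      (F (.inl y)).1 ≠ (F (.inl y)).2 := by
    intro y hy
    obtain ⟨-, h1, h2, h3, -⟩ := mem_filter.1 (τ.conn y hy)
    exact ⟨mem_Z.1 h1, mem_Z.1 h2, h3⟩
  have hvert : ∀ y ∈ Y, ∀ y' ∈ Y, y ≠ y' → ∀ v,
      v = (F (.inl y)).1 ∨ v = (F (.inl y)).2 → v ≠ (F (.inl y')).1 ∧ v ≠ (F (.inl y')).2 := by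
    intro y hy y' hy' hne v hv
    have hm : .inr (.inl v) ∈ s.res x (.inl y) (F (.inl y)) := by
      rcases hv with rfl | rfl <;> simp [res]
    have hd := disjoint_left.1 (τ.disj (.inl y) (inl_mem_disjSum.2 hy) (.inl y')
      (inl_mem_disjSum.2 hy') (by simpa using hne)) hm
    constructor <;> (rintro rfl; exact hd (by simp [res]))
  have hinspk : ∀ z ∈ s.Z, F (.inr z) ∈ pk := fun z hz =>
    (mem_filter.1 (mem_filter.1 (τ.ins z hz)).1).1
  have hinsinj : ∀ z ∈ s.Z, ∀ z' ∈ s.Z, (F (.inr z)).1 = (F (.inr z')).1 → z = z' := by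
    intro z hz z' hz' e
    by_contra hne
    have e' := hf.fst_injOn _ (hinspk z hz) _ (hinspk z' hz') e
    have hm : .inr (.inr (F (.inr z))) ∈ s.res x (.inr z) (F (.inr z)) := by simp [res]
    refine disjoint_left.1 (τ.disj (.inr z) (inr_mem_disjSum.2 hz) (.inr z')
      (inr_mem_disjSum.2 hz') (by simpa using hne)) hm ?_
    rw [e']
    simp [res]
  obtain ⟨M, hMne, hM, hMlen, hMch, hMmem⟩ := exists_closed_join (R := R) L₁
    (fun l hl => (hpre l hl).1) hL₁ hnd
    (fun l hl => by
      obtain ⟨_, hq, _, rfl⟩ := (hpre l hl).2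
      exact (hf.isChain _ hq).left_of_append.imp fun _ _ h => Or.inl h)
    lst hd hlst hhd (fun y => F (.inl y)) x hx
    (fun l hl => by
      have hj := inl_mem_disjSum (t := s.Z).2 (hYl l hl)
      exact ⟨.inr ⟨_, hj, by simp [links]⟩, .inr ⟨_, hj, by simp [links]⟩,
        .inr ⟨_, hj, by simp [links]⟩⟩)
    (fun l hl => by
      have h := hconnZ _ (hYl l hl)
      exact ⟨h.2.2, fun h' => h.1 (hA _ h'), fun h' => h.2.1 (hA _ h')⟩)
    (fun l hl l' hl' hne => by
      have h := hvert _ (hYl l hl) _ (hYl l' hl') fun e => hne (hlinj l hl l' hl' e)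
      exact ⟨(h _ (.inl rfl)).1, (h _ (.inl rfl)).2, (h _ (.inr rfl)).1, (h _ (.inr rfl)).2⟩)
  suffices hM' : ∃ M' : List V, M'.Nodup ∧ M'.length = M.length + t ∧ (M' ++ M').IsChain R by
    obtain ⟨M', h1, h2, h4⟩ := hM'
    have h5 : 3 ≤ M'.length := by omega
    have hne : M' ≠ [] := by
      rintro rfl
      simp at h5
    obtain ⟨h6, h7⟩ := getLast_head_of_isChain_append_self hne h4
    obtain ⟨v, w, hw, hwl, hwn⟩ := exists_rainbow_cycle_of_list φ hRne hRinj M' hne h1 h5 h6 h7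
    exact ⟨v, w, hw, by omega, hwn⟩
  rcases ht with rfl | ⟨rfl, ht⟩
  · exact ⟨M, hM, rfl, hMch⟩
  have hMA : ∀ v ∈ s.A, v ∈ M := fun v hv => (hMmem v).2 (.inl ((hf.mem_flatten v).2 hv))
  obtain ⟨T, hT, rfl⟩ : ∃ T ⊆ s.Z.filter (fun z => z ∉ M), #T = t := by
    refine exists_subset_card_eq ?_
    have h1 : #(s.Z.filter fun z => z ∈ M) + #(s.Z.filter fun z => z ∉ M) = #s.Z :=
      card_filter_add_card_filter_not _
    have h2 : #(s.Z.filter fun z => z ∈ M) + #s.A ≤ M.length := by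
      rw [← card_union_of_disjoint, ← List.toFinset_card_of_nodup hM]
      · refine card_le_card fun v hv => List.mem_toFinset.2 ?_
        rcases mem_union.1 hv with hv | hv
        · exact (mem_filter.1 hv).2
        · exact hMA v hv
      · exact disjoint_left.2 fun v hv => mem_Z.1 (mem_filter.1 hv).1
    have h4 : L₁.flatten.length = #s.A := by
      rw [← List.toFinset_card_of_nodup hnd]
      congr 1
      ext v
      rw [List.mem_toFinset, hf.mem_flatten]
    omega
  have hTZ : ∀ z ∈ T, z ∈ s.Z := fun z hz => (mem_filter.1 (hT hz)).1
  have hTM : ∀ z ∈ T, z ∉ M := fun z hz => (mem_filter.1 (hT hz)).2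
  refine exists_closed_insert M hM hMch T hTM (fun z => F (.inr z))
    (fun z hz => hMA _ (hf.pick _ (hinspk z (hTZ z hz))).1)
    (fun z hz z' hz' => hinsinj z (hTZ z hz) z' (hTZ z' hz'))
    (fun z hz => ⟨.inr ⟨_, inr_mem_disjSum.2 (hTZ z hz), by simp [links]⟩,
      .inr ⟨_, inr_mem_disjSum.2 (hTZ z hz), by simp [links]⟩⟩) ?_
  rintro z hz w hw (h | ⟨j, hj, h⟩)
  · exact congrArg Prod.snd (hf.fst_injOn _ h _ (hinspk z (hTZ z hz)) rfl)
  have hzA := (hf.pick _ (hinspk z (hTZ z hz))).1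
  rcases j with y | z'
  · have hy := inl_mem_disjSum.1 hj
    have hc := hconnZ y hy
    simp only [links, mem_insert, mem_singleton, Prod.mk.injEq] at h
    rcases h with ⟨h, -⟩ | ⟨h, -⟩ | ⟨h, -⟩
    · obtain ⟨l, hl, rfl⟩ := (hY y).1 hy
      refine absurd ?_ ((hf.out_notMem _ (τ.subset hy)).2 ⟨l, hl, hlst l hl⟩)
      rw [← h]
      exact mem_used.2 ⟨_, hinspk z (hTZ z hz), by simp [slots]⟩
    · exact absurd (h ▸ hzA) hc.1
    · exact absurd (h ▸ hzA) hc.2.1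
  · have hz' := inr_mem_disjSum.1 hj
    simp only [links, mem_insert, mem_singleton, Prod.mk.injEq] at h
    rcases h with ⟨h, rfl⟩ | ⟨h, -⟩
    · have := hinsinj z (hTZ z hz) w hz' h
      exact absurd (this ▸ hw) (hTM z hz)
    · exact absurd (h ▸ hzA) (mem_Z.1 hz')

end IsTransversal

end Setting

end Assembly

section Cycle

variable {V : Type*} [Fintype V] [DecidableEq V]

namespace Setting

/-- Smallness of the parameters and of the reservoir `s.Z`, as needed to close up the cycle. -/
structure Closable (s : Setting V) (ζ : ℝ) : Prop where
  ζ_pos : 0 < ζ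
  ζ_le : 2000000 * ζ ≤ s.ε ^ 2
  δ_le : 1000000 * s.δ ≤ s.ε ^ 3 * ζ
  μ_le : 16 * s.μ ≤ ζ
  le_Z : ζ * s.n / 2 ≤ #s.Z
  Z_le : (#s.Z : ℝ) ≤ 2 * ζ * s.n
  sum_Z_le : ∀ c, ∑ z ∈ s.Z, (s.colDeg z c : ℝ) ≤ 2 * ζ * s.n
  Δ_le : 2 * s.Δ ≤ s.δ * s.n
  n_large : 16 ≤ ζ * s.n

variable {s : Setting V} {ζ : ℝ} {L : List (List V)} {pk : Finset (V × V)} {ω : Slot V → ℝ} {k : ℕ}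

namespace Closable

variable (C : s.Closable ζ) (h : s.Good) (i : s.Inv L pk ω k)
include C h

omit i in
lemma ζ_small : ζ ≤ 1 / 8000000 := by
  have h1 := C.ζ_le
  have h2 := h.ε_le
  have h3 := h.ε_pos
  nlinarith

omit i in
lemma δ_small : 8000000 * s.δ ≤ ζ := by
  have h1 := C.δ_le
  have h2 := h.ε_le
  have h3 := h.ε_pos
  have h4 : s.ε ^ 3 ≤ 1 / 8 := by
    calc s.ε ^ 3 ≤ (1 / 2) ^ 3 := pow_le_pow_left₀ h3.le h2 3
      _ = _ := by norm_num
  nlinarith [C.ζ_pos]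

include i

lemma exists_isTransversal (hk : s.early ≤ k) (Y : Finset V) (x : V → V) (hY : Y ⊆ s.A)
    (hx : ∀ y ∈ Y, x y ∈ s.A) (hYc : (#Y : ℝ) ≤ 2 * s.δ * s.n)
    (hd : ∀ c, ∑ y ∈ Y, (s.colDeg y c : ℝ) + ∑ y ∈ Y, (s.colDeg (x y) c : ℝ) ≤ 9 * s.δ * s.n) :
    ∃ F, s.IsTransversal pk Y x F := by
  have hn := h.n_pos
  have hε := h.ε_pos
  have hζ := C.ζ_pos
  have hδ := h.δ_pos
  have hζs := C.ζ_small h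
  have hP : ∀ y ∈ Y, s.ε ^ 3 * ζ ^ 2 / 256 * s.n ^ 2 ≤ #(s.connOpts pk y (x y)) := by
    intro y hy
    refine le_trans ?_ (i.le_card_connOpts h (hY hy) (hx y hy) ?_ ?_)
    · have h1 : (ζ * s.n / 2) ^ 2 ≤ (#s.Z : ℝ) ^ 2 :=
        pow_le_pow_left₀ (by positivity) C.le_Z 2
      calc s.ε ^ 3 * ζ ^ 2 / 256 * s.n ^ 2 = s.ε ^ 3 / 64 * (ζ * s.n / 2) ^ 2 := by ring
        _ ≤ _ := mul_le_mul_of_nonneg_left h1 (by positivity)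
    · nlinarith [C.le_Z, C.μ_le, C.n_large]
    · have h1 := mul_le_mul_of_nonneg_left C.le_Z (show 0 ≤ s.ε ^ 3 / 128 by positivity)
      have h2 := mul_le_mul_of_nonneg_right C.δ_le hn.le
      have h3 : 0 ≤ s.ε ^ 3 * ζ * s.n := by positivity
      linarith [C.Δ_le]
  have hQ : ∀ z ∈ s.Z, s.ε ^ 2 / 8000 * s.n ≤ #(s.insOpts pk z) := by
    intro z _
    refine le_trans ?_ (i.le_card_ins h z)
    rw [min_eq_right hk]
    have h1 : s.N / 100 - 1 ≤ s.early := (Nat.sub_one_lt_floor _).le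
    have h2 : s.n / 2000 ≤ (s.early : ℝ) / 4 - s.μ * s.n := by
      nlinarith [h.n_le, C.μ_le, C.n_large]
    calc s.ε ^ 2 / 8000 * s.n = s.ε ^ 2 / 4 * (s.n / 2000) := by ring
      _ ≤ _ := mul_le_mul_of_nonneg_left h2 (by positivity)
  have hPpos : 0 < s.ε ^ 3 * ζ ^ 2 / 256 * s.n ^ 2 := by positivity
  have hQpos : 0 < s.ε ^ 2 / 8000 * s.n := by positivity
  have hn2 : 0 < s.n ^ 2 := by positivity
  have e1 := mul_le_mul_of_nonneg_right C.δ_le (show 0 ≤ ζ * s.n ^ 2 by positivity)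
  have e2 := mul_le_mul_of_nonneg_right C.ζ_le hn.le
  have e3 : (#s.Z : ℝ) * #Y ≤ 2 * ζ * s.n * (2 * s.δ * s.n) :=
    mul_le_mul C.Z_le hYc (Nat.cast_nonneg _) (by positivity)
  have p1 : 0 ≤ s.δ * ζ * s.n ^ 2 := by positivity
  have p2 : 0 ≤ ζ * s.n := by positivity
  obtain ⟨F, h1, h2, h3⟩ := i.forest.exists_transversal Y hY x hx hPpos hQpos hP hQ hd C.sum_Z_le
    (by
      have h1 : (#s.Z * (9 * s.δ * s.n) + #Y * (2 * ζ * s.n)) /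
          (s.ε ^ 3 * ζ ^ 2 / 256 * s.n ^ 2) ≤ 1 / 40 := by
        rw [div_le_iff₀ hPpos]
        have h1 := mul_le_mul_of_nonneg_right C.Z_le (show 0 ≤ 9 * s.δ * s.n by positivity)
        have h2 := mul_le_mul_of_nonneg_right hYc (show 0 ≤ 2 * ζ * s.n by positivity)
        nlinarith
      have h2 : 2 * (2 * ζ * s.n) / (s.ε ^ 2 / 8000 * s.n) ≤ 1 / 40 := by
        rw [div_le_iff₀ hQpos]
        linarith
      linarith)
    (by rw [div_le_iff₀ hPpos]; nlinarith)
    (by rw [div_le_iff₀ hQpos]; linarith [C.Z_le])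
  exact ⟨F, hY, hx, h1, h2, h3⟩

end Closable

end Setting

end Cycle

section CycleExists

lemma exists_three_le_length {α : Type*} : ∀ (L : List (List α)),
    2 * L.length < L.flatten.length → ∃ q ∈ L, 3 ≤ q.length
  | [], h => by simp at h
  | l :: L, h => by
    by_cases hl : 3 ≤ l.length
    · exact ⟨l, List.mem_cons_self, hl⟩
    · obtain ⟨q, hq, h3⟩ := exists_three_le_length L (by
        simp only [List.flatten_cons, List.length_append, List.length_cons] at h
        omega)
      exact ⟨q, List.mem_cons_of_mem _ hq, h3⟩

variable {V : Type*} [Fintype V] [DecidableEq V]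

namespace Setting

variable {s : Setting V} {ζ : ℝ}

namespace Closable

lemma exists_cycle (C : s.Closable ζ) (h : s.Good) (φ : Sym2 V → ℕ)
    (hφ : ∀ u v, s.col u v = φ s(u, v)) (ℓ : ℕ) (h3 : 3 ≤ ℓ) (hℓ : ℓ ≤ Fintype.card V) :
    ∃ (v : V) (w : (⊤ : SimpleGraph V).Walk v v), w.IsCycle ∧ w.length = ℓ ∧
      (w.edges.map φ).Nodup := by
  have hn := h.n_pos
  have hNpos := h.N_pos
  have hδ := h.δ_pos
  have hδs := C.δ_small h
  have hζs := C.ζ_small h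
  have hN : s.N ≤ s.n := Good.N_le_n
  have hδ1 : 2 ≤ s.δ * s.n := by linarith [C.Δ_le, h.one_le_Δ]
  obtain ⟨v₀⟩ : Nonempty V := by
    rw [← Fintype.card_pos_iff]
    omega
  set K := ⌊(1 - s.δ) * s.N⌋₊ with hK
  have hK0 : 0 ≤ (1 - s.δ) * s.N := mul_nonneg (by linarith) hNpos.le
  have hK1 : (K : ℝ) ≤ (1 - s.δ) * s.N := Nat.floor_le hK0
  have hK2 : (1 - s.δ) * s.N - 1 ≤ K := (Nat.sub_one_lt_floor _).le
  obtain ⟨L, pk, ω, i⟩ := h.exists_inv K hK1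
  have hf := i.forest
  have hearly : s.early ≤ K := Nat.floor_le_floor (by nlinarith)
  have hcard : L.length + K = #s.A := i.card_eq ▸ hf.card
  have hcardR : (L.length : ℝ) + K = s.N := by rw [N]; exact_mod_cast hcard
  have hLlen : (L.length : ℝ) ≤ 2 * s.δ * s.n := by nlinarith
  have hflat : L.flatten.length = #s.A := by
    rw [← List.toFinset_card_of_nodup hf.nodup]
    congr 1
    ext v
    rw [List.mem_toFinset, hf.mem_flatten]
  have hAZ : #s.A + #s.Z = Fintype.card V := by
    have : s.Z = s.Aᶜ := by ext v; simp [mem_Z]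
    rw [this, card_add_card_compl]
  have hLN : 2 * L.length < L.flatten.length := by
    have : (2 * L.length : ℝ) < s.N := by nlinarith [h.n_le]
    rw [hflat]
    rw [N] at this
    exact_mod_cast this
  have hLne : L ≠ [] := by
    rintro rfl
    simp at hLN
  obtain ⟨L₁, t, hne₁, hlen, hle₁, hpre, hnd, ht, d, d', hdd⟩ : ∃ (L₁ : List (List V)) (t : ℕ),
      L₁ ≠ [] ∧ L₁.flatten.length + 2 * L₁.length + t = ℓ ∧ L₁.length ≤ L.length ∧
      (∀ l ∈ L₁, l ≠ [] ∧ ∃ q ∈ L, l <+: q) ∧ L₁.flatten.Nodup ∧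
      (t = 0 ∨ L₁ = L ∧ t + 2 * L.length ≤ #s.Z) ∧
      ∃ d d' : Option V, ∀ l ∈ L₁, l ∈ L ∨ l.getLast? = d ∨ l.getLast? = d' := by
    rcases le_or_gt ℓ (L.flatten.length + 2 * L.length) with hle | hlt
    · obtain ⟨q₀, hq₀, hq₃⟩ := exists_three_le_length L hLN
      obtain ⟨L₁, h1, h2, h4, h5, h6, -, h7⟩ :=
        exists_truncation_eq L hf.ne_nil hf.nodup q₀ hq₀ hq₃ ℓ h3 hle
      exact ⟨L₁, 0, h1, h2, h4, h5, h6, .inl rfl, h7⟩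
    · exact ⟨L, ℓ - (L.flatten.length + 2 * L.length), hLne, by omega, le_rfl,
        fun l hl => ⟨hf.ne_nil l hl, l, hl, List.prefix_rfl⟩, hf.nodup, .inr ⟨rfl, by omega⟩,
        none, none, fun l hl => .inl hl⟩
  obtain ⟨lst, hlst⟩ : ∃ lst : List V → V, ∀ l ∈ L₁, l.getLast? = some (lst l) :=
    ⟨fun l => l.getLast?.getD v₀, fun l hl => by
      simp [List.getLast?_eq_some_getLast (hpre l hl).1]⟩
  obtain ⟨hd, hhd⟩ : ∃ hd : List V → V, ∀ l ∈ L₁, l.head? = some (hd l) :=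
    ⟨fun l => l.head?.getD v₀, fun l hl => by
      simp [List.head?_eq_some_head (hpre l hl).1]⟩
  have hlmem : ∀ l ∈ L₁, lst l ∈ l := fun l hl => List.mem_of_getLast? (hlst l hl)
  have hhmem : ∀ l ∈ L₁, hd l ∈ l := fun l hl => List.mem_of_head? (hhd l hl)
  have hlinj : ∀ l ∈ L₁, ∀ l' ∈ L₁, lst l = lst l' → l = l' := fun l hl l' hl' e =>
    eq_of_mem_of_nodup_flatten hnd hl hl' (hlmem l hl) (e ▸ hlmem l' hl')
  have hhinj : ∀ l ∈ L₁, ∀ l' ∈ L₁, hd l = hd l' → l = l' := fun l hl l' hl' e =>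
    eq_of_mem_of_nodup_flatten hnd hl hl' (hhmem l hl) (e ▸ hhmem l' hl')
  have hA : ∀ l ∈ L₁, ∀ v ∈ l, v ∈ s.A := by
    intro l hl v hv
    obtain ⟨q, hq, hlq⟩ := (hpre l hl).2
    exact (hf.mem_flatten v).1 (List.mem_flatten.2 ⟨q, hq, hlq.subset hv⟩)
  have hperm : ∀ l ∈ L₁, L₁.formPerm l ∈ L₁ := fun l hl => List.formPerm_apply_mem_of_mem hl
  obtain ⟨x, hx⟩ : ∃ x : V → V, ∀ l ∈ L₁, x (lst l) = hd (L₁.formPerm l) := by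
    classical
    refine ⟨fun y => if hy : ∃ l ∈ L₁, lst l = y then hd (L₁.formPerm hy.choose) else y,
      fun l hl => ?_⟩
    have hy : ∃ l' ∈ L₁, lst l' = lst l := ⟨l, hl, rfl⟩
    beta_reduce
    rw [dif_pos hy, hlinj _ hy.choose_spec.1 _ hl hy.choose_spec.2]
  set Y : Finset V := L₁.toFinset.image lst with hYdef
  have hY : ∀ v, v ∈ Y ↔ ∃ l ∈ L₁, lst l = v := by simp [hYdef]
  have hYA : Y ⊆ s.A := fun y hy => by
    obtain ⟨l, hl, rfl⟩ := (hY y).1 hy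
    exact hA l hl _ (hlmem l hl)
  have hxA : ∀ y ∈ Y, x y ∈ s.A := fun y hy => by
    obtain ⟨l, hl, rfl⟩ := (hY y).1 hy
    rw [hx l hl]
    exact hA _ (hperm l hl) _ (hhmem _ (hperm l hl))
  have hYcard : (#Y : ℝ) ≤ 2 * s.δ * s.n := by
    refine le_trans ?_ hLlen
    exact_mod_cast card_image_le.trans ((List.toFinset_card_le L₁).trans hle₁)
  have hsumY : ∀ c, ∑ y ∈ Y, (s.colDeg y c : ℝ) ≤ 5 * s.δ * s.n := by
    intro c
    have hsub : Y ⊆ s.A.filter (fun v => .out v ∉ s.used pk) ∪ (d.toFinset ∪ d'.toFinset) := by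
      intro y hy
      obtain ⟨l, hl, rfl⟩ := (hY y).1 hy
      rw [mem_union, mem_union, mem_filter]
      rcases hdd l hl with hlL | hd | hd
      · exact .inl ⟨hYA hy, (hf.out_notMem _ (hYA hy)).2 ⟨l, hlL, hlst l hl⟩⟩
      · exact .inr (.inl (by simp [← hd, hlst l hl]))
      · exact .inr (.inr (by simp [← hd, hlst l hl]))
    have hopt : ∀ d : Option V, ∑ y ∈ d.toFinset, (s.colDeg y c : ℝ) ≤ s.Δ := by
      rintro (_ | v)
      · simpa using by linarith [h.one_le_Δ]
      · rw [Option.toFinset_some, sum_singleton]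
        exact h.deg_le v c
    have hun : ∀ S T : Finset V, ∑ y ∈ S ∪ T, (s.colDeg y c : ℝ) ≤
        ∑ y ∈ S, (s.colDeg y c : ℝ) + ∑ y ∈ T, (s.colDeg y c : ℝ) := fun S T => by
      rw [← sum_union_inter]
      exact le_add_of_nonneg_right (sum_nonneg fun _ _ => Nat.cast_nonneg _)
    have h1 := i.sum_colDeg_out_le h hK2 c
    have h2 := sum_le_sum_of_subset_of_nonneg (f := fun y => (s.colDeg y c : ℝ)) hsub
      fun _ _ _ => Nat.cast_nonneg _
    linarith [hun (s.A.filter fun v => .out v ∉ s.used pk) (d.toFinset ∪ d'.toFinset),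
      hun d.toFinset d'.toFinset, hopt d, hopt d', C.Δ_le]
  have hsumx : ∀ c, ∑ y ∈ Y, (s.colDeg (x y) c : ℝ) ≤ 4 * s.δ * s.n := by
    intro c
    refine le_trans ?_ (i.sum_colDeg_inn_le h hK2 c)
    have hinj : Set.InjOn x Y := by
      intro y hy y' hy' e
      obtain ⟨l, hl, rfl⟩ := (hY y).1 hy
      obtain ⟨l', hl', rfl⟩ := (hY y').1 hy'
      rw [hx l hl, hx l' hl'] at e
      rw [L₁.formPerm.injective (hhinj _ (hperm l hl) _ (hperm l' hl') e)]
    rw [← sum_image (f := fun v => (s.colDeg v c : ℝ)) hinj]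
    refine sum_le_sum_of_subset_of_nonneg (fun v hv => ?_) fun _ _ _ => Nat.cast_nonneg _
    obtain ⟨y, hy, rfl⟩ := mem_image.1 hv
    refine mem_filter.2 ⟨hxA y hy, (hf.inn_notMem _ (hxA y hy)).2 ?_⟩
    obtain ⟨l, hl, rfl⟩ := (hY y).1 hy
    obtain ⟨q, hq, r, rfl⟩ := (hpre _ (hperm l hl)).2
    refine ⟨_, hq, ?_⟩
    rw [hx l hl, List.head?_append, hhd _ (hperm l hl), Option.some_or]
  obtain ⟨F, τ⟩ := C.exists_isTransversal h i hearly Y x hYA hxA hYcard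
    fun c => by linarith [hsumY c, hsumx c]
  obtain ⟨v, w, hw, hwl, hwn⟩ := τ.exists_cycle h.symm hf φ hφ L₁ hne₁ hpre hnd lst hd hlst hhd hY
    ((isChain_append_self_formPerm L₁ (nodup_of_nodup_flatten (fun l hl => (hpre l hl).1) hnd)
      ).imp_of_mem_imp fun l l' hl _ e => by
        rw [hx l (by simpa using hl), e]) t ht (by omega)
  exact ⟨v, w, hw, hwl.trans hlen, hwn⟩

end Closable

end Setting

end CycleExists

section Parameters

variable {V : Type*} [Fintype V] [DecidableEq V]

namespace Setting

/-- The choice of the auxiliary parameters of a setting in terms of its order and of `s.δ`. -/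
structure Tuned (s : Setting V) : Prop where
  ε_pos : 0 < s.ε
  ε_le : s.ε ≤ 1 / 2
  δ_pos : 0 < s.δ
  δ_le : s.δ ≤ s.ε
  δ_small : s.δ ≤ 1 / 100
  ρ_eq : s.ρ = s.δ / 8
  μ_eq : s.μ = s.δ / 64
  lam_eq : s.lam = 8 / s.μ * (Real.log s.n / s.n)
  Δ_eq : s.Δ = s.n / Real.log s.n ^ 4
  le_log : 2 ^ 28 * s.B ^ 8 ≤ Real.log s.n
  log_pow_le : Real.log s.n ^ 4 ≤ s.n

variable {s : Setting V}

namespace Tuned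

variable (T : s.Tuned)
include T

lemma one_le_B : 1 ≤ s.B := by
  rw [B, le_div_iff₀ T.δ_pos]
  linarith [T.δ_small]

lemma δ_eq : s.δ = 2 / s.B := by
  have := T.δ_pos
  rw [B]
  field_simp

lemma pow_B_le {j : ℕ} (hj : j ≤ 8) : 2 ^ 28 * s.B ^ j ≤ Real.log s.n :=
  le_trans (mul_le_mul_of_nonneg_left (pow_le_pow_right₀ T.one_le_B hj) (by norm_num)) T.le_log

lemma log_large : 2 ^ 28 ≤ Real.log s.n := by simpa using T.pow_B_le (Nat.zero_le 8)

lemma log_le : Real.log s.n ≤ s.n := by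
  have h1 := T.log_large
  exact le_trans (le_self_pow₀ (by linarith) (by norm_num)) T.log_pow_le

lemma n_pos : 0 < s.n := by linarith [T.log_le, T.log_large]

lemma Δ_mul : s.Δ * Real.log s.n ^ 4 = s.n := by
  have : Real.log s.n ≠ 0 := by linarith [T.log_large]
  rw [T.Δ_eq]
  field_simp

lemma one_le_Δ : 1 ≤ s.Δ := by
  have h1 := T.log_large
  rw [T.Δ_eq, le_div_iff₀ (by positivity), one_mul]
  exact T.log_pow_le

lemma Δ_mul_log_le : s.Δ * Real.log s.n ≤ s.n := by
  have h1 := T.log_large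
  calc s.Δ * Real.log s.n ≤ s.Δ * Real.log s.n ^ 4 :=
        mul_le_mul_of_nonneg_left (le_self_pow₀ (by linarith) (by norm_num))
          (by linarith [T.one_le_Δ])
    _ = s.n := T.Δ_mul

lemma n_mul_π : s.n * s.π = 8 * s.B := by
  have := T.n_pos
  rw [π]
  field_simp

lemma m_le : s.m ≤ s.δ / 128 := by
  have hn := T.n_pos
  have hB := T.one_le_B
  have hΔ := T.one_le_Δ
  have e : s.m = (16 * s.B ^ 5 * s.Δ + 128 * s.B ^ 4) / s.n := by
    rw [m, q, π]
    field_simp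
    ring
  have h1 : s.B ^ 4 ≤ s.B ^ 5 * s.Δ := by
    calc s.B ^ 4 ≤ s.B ^ 5 := pow_le_pow_right₀ hB (by norm_num)
      _ ≤ _ := le_mul_of_one_le_right (by positivity) hΔ
  have h2 := T.pow_B_le (show 6 ≤ 8 by norm_num)
  have h3 := T.Δ_mul_log_le
  have h4 := mul_le_mul_of_nonneg_left h2 (show 0 ≤ s.Δ by linarith)
  have h5 : 0 ≤ s.Δ * s.B ^ 6 := by positivity
  rw [e, T.δ_eq, div_div, div_le_div_iff₀ hn (by positivity)]
  have h6 : (16 * s.B ^ 5 * s.Δ + 128 * s.B ^ 4) * (s.B * 128) ≤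
      (144 * (s.B ^ 5 * s.Δ)) * (s.B * 128) :=
    mul_le_mul_of_nonneg_right (by linarith) (by positivity)
  nlinarith

lemma m_nonneg : 0 ≤ s.m := by
  have hn := T.n_pos
  have hB := T.one_le_B
  have hΔ := T.one_le_Δ
  rw [m, q]
  positivity

lemma incBound_le : s.incBound ≤ 42 * s.B ^ 3 * s.Δ := by
  have hB := T.one_le_B
  have hΔ := T.one_le_Δ
  have h1 : s.B ^ 2 ≤ s.B ^ 3 := pow_le_pow_right₀ hB (by norm_num)
  have h2 : 1 ≤ s.B ^ 3 := one_le_pow₀ hB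
  have h3 : s.B ^ 3 ≤ s.B ^ 3 * s.Δ := le_mul_of_one_le_right (by linarith) hΔ
  have h4 : s.B ^ 2 * s.Δ ≤ s.B ^ 3 * s.Δ := mul_le_mul_of_nonneg_right h1 (by linarith)
  have e : s.incBound = 32 * s.B ^ 3 + 6 * (s.B ^ 2 * s.Δ) + s.m + 2 * s.B ^ 2 + 1 := by
    rw [incBound, mul_assoc 4, T.n_mul_π]
    ring
  rw [e]
  linarith [T.m_le, T.δ_small]

lemma incMean_le : s.incMean ≤ 52 * s.B ^ 3 := by
  have hB := T.one_le_B
  have h1 : s.B ^ 2 ≤ s.B ^ 3 := pow_le_pow_right₀ hB (by norm_num)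
  have h2 : 1 ≤ s.B ^ 3 := one_le_pow₀ hB
  have e : s.incMean = 48 * s.B ^ 3 + s.m + 2 * s.B ^ 2 + 1 := by
    rw [incMean, mul_assoc (6 * s.B ^ 2), T.n_mul_π]
    ring
  rw [e]
  linarith [T.m_le, T.δ_small]

lemma incBound_nonneg : 0 ≤ s.incBound := by
  have hn := T.n_pos
  have hB := T.one_le_B
  have hΔ := T.one_le_Δ
  have := T.m_nonneg
  rw [incBound, π]
  positivity

lemma lam_eq' : s.lam = 256 * s.B * (Real.log s.n / s.n) := by
  have hB := T.one_le_B
  rw [T.lam_eq, T.μ_eq, T.δ_eq]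
  field_simp
  ring

lemma good (hsymm : ∀ u v, s.col u v = s.col v u)
    (hdeg : ∀ v c, (#(univ.filter fun u => u ≠ v ∧ s.col v u = c) : ℝ) ≤ s.Δ)
    (hcls : ∀ c, (#(univ.filter fun p : V × V => p.1 ≠ p.2 ∧ s.col p.1 p.2 = c) : ℝ) ≤
      (1 - s.ε) * s.n) (hN : (1 - s.ε / 8) * s.n ≤ s.N) : s.Good := by
  have hn := T.n_pos
  have hB := T.one_le_B
  have hΔ := T.one_le_Δ
  have hε := T.ε_pos
  have hε' := T.ε_le
  have hδ := T.δ_pos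
  have hδε := T.δ_le
  have hlog := T.log_large
  have hlogn := T.log_le
  have hΔn := T.Δ_mul_log_le
  have hN2 : s.n ≤ 2 * s.N := by nlinarith
  have hlam : 0 < s.lam := by
    rw [T.lam_eq']
    positivity
  refine ⟨hsymm, hdeg, hcls, hΔ, hε, hε', hδ, hδε, ?_, ?_, ?_, ?_, hlam, hN2, by linarith, ?_, ?_,
    ?_, ?_, ?_, ?_, ?_, ?_⟩
  · rw [T.ρ_eq]; positivity
  · rw [T.ρ_eq]; linarith [T.δ_small]
  · rw [T.ρ_eq]; linarith
  · rw [T.μ_eq]; positivity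
  · have h1 : 2 ^ 28 * s.B ^ 3 ≤ s.n := (T.pow_B_le (by norm_num)).trans hlogn
    have h2 : 1 ≤ s.B ^ 2 := one_le_pow₀ hB
    have h3 : 2 ^ 28 * s.B ^ 2 ≤ s.n / s.B := by
      rw [le_div_iff₀ (by positivity)]
      calc _ = 2 ^ 28 * s.B ^ 3 := by ring
        _ ≤ _ := h1
    have h4 : s.δ * s.n = 2 * (s.n / s.B) := by rw [T.δ_eq]; ring
    rw [T.μ_eq, T.ρ_eq]
    nlinarith
  · rw [T.μ_eq, T.ρ_eq]
    have h1 : (1 - s.δ / 8) ^ 2 ≥ 1 - s.δ / 4 := by nlinarith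
    have h2 : (1 - s.ε) + s.δ / 64 ≤ (1 - s.ε / 2) * ((1 - s.δ / 4) * (1 - s.ε / 8)) := by
      nlinarith [mul_nonneg hε.le hδ.le, mul_nonneg hε.le hε.le,
        mul_nonneg hε.le (mul_nonneg hδ.le hε.le)]
    have h3 : (1 - s.δ / 4) * ((1 - s.ε / 8) * s.n) ≤ (1 - s.δ / 8) ^ 2 * s.N :=
      mul_le_mul h1 hN (mul_nonneg (by linarith) hn.le) (sq_nonneg _)
    calc (1 - s.ε) * s.n + s.δ / 64 * s.n = ((1 - s.ε) + s.δ / 64) * s.n := by ring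
      _ ≤ (1 - s.ε / 2) * ((1 - s.δ / 4) * (1 - s.ε / 8)) * s.n :=
        mul_le_mul_of_nonneg_right h2 hn.le
      _ = (1 - s.ε / 2) * ((1 - s.δ / 4) * ((1 - s.ε / 8) * s.n)) := by ring
      _ ≤ _ := mul_le_mul_of_nonneg_left h3 (by linarith)
  · have h1 : 2 ^ 28 * s.B ^ 1 ≤ s.n := (T.pow_B_le (by norm_num)).trans hlogn
    rw [π, div_le_iff₀ hn]
    linarith
  · rw [T.μ_eq]
    linarith [T.m_le]
  · have h1 : s.incMean * s.incBound ≤ 52 * s.B ^ 3 * (42 * s.B ^ 3 * s.Δ) :=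
      mul_le_mul T.incMean_le T.incBound_le T.incBound_nonneg (by positivity)
    have h2 : s.lam ^ 2 * (52 * s.B ^ 3 * (42 * s.B ^ 3 * s.Δ)) * s.n =
        256 ^ 2 * 52 * 42 * s.B ^ 8 / Real.log s.n ^ 2 := by
      rw [T.lam_eq', T.Δ_eq]
      field_simp
    calc _ ≤ s.lam ^ 2 * (52 * s.B ^ 3 * (42 * s.B ^ 3 * s.Δ)) * s.n :=
          mul_le_mul_of_nonneg_right (mul_le_mul_of_nonneg_left h1 (sq_nonneg _)) hn.le
      _ ≤ 1 := by
        rw [h2, div_le_one (by positivity)]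
        have h3 := T.le_log
        have h4 : 0 ≤ s.B ^ 8 := by positivity
        nlinarith
  · have h1 : s.lam * (42 * s.B ^ 3 * s.Δ) = 256 * 42 * s.B ^ 4 / Real.log s.n ^ 3 := by
      rw [T.lam_eq', T.Δ_eq]
      field_simp
    calc _ ≤ s.lam * (42 * s.B ^ 3 * s.Δ) := mul_le_mul_of_nonneg_left T.incBound_le hlam.le
      _ ≤ 1 := by
        rw [h1, div_le_one (by positivity)]
        have h3 := T.pow_B_le (show 4 ≤ 8 by norm_num)
        have h4 : 0 ≤ s.B ^ 4 := by positivity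
        have h5 : Real.log s.n ≤ Real.log s.n ^ 3 := le_self_pow₀ (by linarith) (by norm_num)
        linarith
  · have h1 : s.lam * (s.μ * s.n / 2) = 4 * Real.log s.n := by
      have : s.μ ≠ 0 := by rw [T.μ_eq]; positivity
      rw [T.lam_eq]
      field_simp
      norm_num
    have h2 : Real.exp (4 * Real.log s.n) = s.n ^ 4 := by
      rw [← Nat.cast_ofNat, Real.exp_nat_mul, Real.exp_log hn]
    rw [h1, h2]
    have h3 : Real.exp 1 ≤ 3 := by linarith [Real.exp_one_lt_d9]
    have h4 : 0 < 18 * s.n ^ 2 + s.n := by positivity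
    have h5 : 1 ≤ s.n := by linarith
    have h6 : s.n ≤ s.n ^ 2 := le_self_pow₀ h5 (by norm_num)
    calc (18 * s.n ^ 2 + s.n) * Real.exp 1 ≤ (18 * s.n ^ 2 + s.n) * 3 :=
          mul_le_mul_of_nonneg_left h3 h4.le
      _ ≤ 57 * s.n ^ 2 := by linarith
      _ ≤ s.n ^ 2 * s.n ^ 2 := mul_le_mul_of_nonneg_right (by linarith) (sq_nonneg _)
      _ = s.n ^ 4 := by ring
  · nlinarith

end Tuned

end Setting

end Parameters

section RainbowCycle

variable {V : Type*} [Fintype V] [DecidableEq V]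

lemma sq_mul_exp_add_exp_lt_one {x a b : ℝ} (hx : 4 ≤ x) (ha : 3 * Real.log x ≤ a) (hb : 3 ≤ b) :
    x ^ 2 * Real.exp (-a) + 2 * Real.exp (-b) < 1 := by
  have hx0 : 0 < x := by linarith
  have h1 : x ^ 2 * Real.exp (-a) ≤ 1 / 4 := by
    calc x ^ 2 * Real.exp (-a) ≤ x ^ 2 * Real.exp (-(3 * Real.log x)) :=
          mul_le_mul_of_nonneg_left (Real.exp_le_exp.2 (by linarith)) (sq_nonneg _)
      _ = 1 / x := by
        have e : Real.exp (3 * Real.log x) = x ^ 3 := by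
          rw [mul_comm, Real.exp_mul, Real.exp_log hx0]
          norm_cast
        rw [Real.exp_neg, e]
        field_simp
      _ ≤ 1 / 4 := one_div_le_one_div_of_le (by norm_num) hx
  have h2 : Real.exp (-b) ≤ 1 / 4 := by
    rw [Real.exp_neg, ← one_div]
    exact one_div_le_one_div_of_le (by norm_num) (by linarith [Real.add_one_le_exp b])
  linarith

theorem exists_rainbow_cycle_of_log_le {ε ζ δ : ℝ} (hε : 0 < ε) (hε' : ε ≤ 1 / 2)
    (hζ : ζ = ε ^ 2 / 2000000) (hδ : δ = ε ^ 3 * ζ / 1000000)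
    (hlog : 2 ^ 28 * (2 / δ) ^ 8 ≤ Real.log (Fintype.card V))
    (hpow : Real.log (Fintype.card V) ^ 4 ≤ Fintype.card V) (φ : Sym2 V → ℕ)
    (hdeg : ∀ v c, (#(univ.filter fun u => u ≠ v ∧ φ s(v, u) = c) : ℝ) ≤
      Fintype.card V / Real.log (Fintype.card V) ^ 4)
    (hcls : ∀ c, (#(univ.filter fun p : V × V => p.1 ≠ p.2 ∧ φ s(p.1, p.2) = c) : ℝ) ≤
      (1 - ε) * Fintype.card V) (ℓ : ℕ) (h3 : 3 ≤ ℓ) (hℓ : ℓ ≤ Fintype.card V) :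
    ∃ (v : V) (w : (⊤ : SimpleGraph V).Walk v v), w.IsCycle ∧ w.length = ℓ ∧
      (w.edges.map φ).Nodup := by
  have hζ0 : 0 < ζ := by rw [hζ]; positivity
  have hδ0 : 0 < δ := by rw [hδ]; positivity
  have hζε : ζ ≤ ε / 4000000 := by rw [hζ]; nlinarith
  have hε3 : ε ^ 3 ≤ 1 / 8 := by
    calc ε ^ 3 ≤ (1 / 2) ^ 3 := pow_le_pow_left₀ hε.le hε' 3
      _ = _ := by norm_num
  have hδζ : 8000000 * δ ≤ ζ := by rw [hδ]; nlinarith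
  have tuned : ∀ Z : Finset V, (⟨fun u v => φ s(u, v), Zᶜ,
      Fintype.card V / Real.log (Fintype.card V) ^ 4, ε, δ, δ / 8, δ / 64,
      8 / (δ / 64) * (Real.log (Fintype.card V) / Fintype.card V)⟩ : Setting V).Tuned := fun Z =>
    ⟨hε, hε', hδ0, by linarith, by linarith, rfl, rfl, rfl, rfl, hlog, hpow⟩
  have T := tuned ∅
  have hn : (0 : ℝ) < Fintype.card V := T.n_pos
  have hΔ : (1 : ℝ) ≤ Fintype.card V / Real.log (Fintype.card V) ^ 4 := T.one_le_Δ
  have hlarge : (2 : ℝ) ^ 28 ≤ Real.log (Fintype.card V) := T.log_large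
  have hlogn : Real.log (Fintype.card V) ≤ Fintype.card V := T.log_le
  have hδlog : 2 ^ 28 ≤ δ * Real.log (Fintype.card V) := by
    have h1 : 2 ^ 28 * (2 / δ) ^ 1 ≤ Real.log (Fintype.card V) := T.pow_B_le (by norm_num)
    have h2 := mul_le_mul_of_nonneg_left h1 hδ0.le
    have e : δ * (2 ^ 28 * (2 / δ) ^ 1) = 2 ^ 29 := by
      field_simp
    linarith
  have hδn : 2 ^ 28 ≤ δ * Fintype.card V :=
    hδlog.trans (mul_le_mul_of_nonneg_left hlogn hδ0.le)
  obtain ⟨Z, hZ1, hZ2, hZ3⟩ := exists_subset_balanced (V := V) (κ := V × V) ζ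
    (Fintype.card V / Real.log (Fintype.card V) ^ 4) hζ0.le (by linarith) (by linarith)
    (fun p v => (#(univ.filter fun u => u ≠ v ∧ φ s(v, u) = φ s(p.1, p.2)) : ℝ))
    (fun _ _ => Nat.cast_nonneg _) (fun p v => hdeg v _)
    (fun p => by
      have h1 := hcls (φ s(p.1, p.2))
      rw [← Nat.cast_sum, sum_card_filter_eq univ fun v u => u ≠ v ∧ φ s(v, u) = φ s(p.1, p.2)]
      simp only [mem_univ, true_and]
      simp only [ne_comm] at h1 ⊢
      nlinarith)
    (by
      rw [Fintype.card_prod, Nat.cast_mul, ← sq]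
      refine sq_mul_exp_add_exp_lt_one (by linarith) ?_ (by nlinarith)
      set lg := Real.log (Fintype.card V)
      have e : ζ * Fintype.card V / (4 * (Fintype.card V / lg ^ 4)) = ζ * lg / 4 * lg ^ 3 := by
        field_simp
      have h1 : lg ≤ lg ^ 3 := le_self_pow₀ (by linarith) (by norm_num)
      have h2 : 3 ≤ ζ * lg / 4 := by nlinarith
      rw [e]
      exact mul_le_mul h2 h1 (by linarith) (by linarith))
  have hs := tuned Z
  set s : Setting V := ⟨fun u v => φ s(u, v), Zᶜ,
      Fintype.card V / Real.log (Fintype.card V) ^ 4, ε, δ, δ / 8, δ / 64,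
      8 / (δ / 64) * (Real.log (Fintype.card V) / Fintype.card V)⟩ with hsdef
  have hsZ : s.Z = Z := by ext v; simp [Setting.mem_Z, hsdef]
  have hN : s.N = Fintype.card V - #Z := by
    have := card_add_card_compl Z
    rw [Setting.N, ← this]
    push_cast
    simp [hsdef]
  have good : s.Good := hs.good (fun u v => congrArg φ Sym2.eq_swap) hdeg hcls (by
    rw [hN]
    change (1 - ε / 8) * Fintype.card V ≤ _
    nlinarith)
  have hC : s.Closable ζ := by
    refine ⟨hζ0, ?_, ?_, ?_, ?_, ?_, ?_, ?_, ?_⟩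
    · change _ ≤ ε ^ 2
      linarith
    · change 1000000 * δ ≤ ε ^ 3 * ζ
      linarith
    · change 16 * (δ / 64) ≤ ζ
      linarith
    · rw [hsZ]
      exact hZ1
    · rw [hsZ]
      exact hZ2
    · intro c
      rw [hsZ]
      by_cases hc : ∃ a b, φ s(a, b) = c
      · obtain ⟨a, b, rfl⟩ := hc
        exact hZ3 (a, b)
      · have h0 : ∀ z ∈ Z, (s.colDeg z c : ℝ) = 0 := fun z _ => by
          rw [Setting.colDeg, Nat.cast_eq_zero, card_eq_zero, filter_eq_empty_iff]
          exact fun u _ h => hc ⟨z, u, h.2⟩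
        rw [sum_eq_zero h0]
        exact mul_nonneg (by linarith) hn.le
    · have h1 : s.Δ * Real.log s.n ≤ s.n := hs.Δ_mul_log_le
      change 2 * s.Δ ≤ δ * s.n
      change 2 ^ 28 ≤ δ * Real.log s.n at hδlog
      have h2 := mul_le_mul_of_nonneg_left h1 hδ0.le
      have h4 := mul_le_mul_of_nonneg_left hδlog (show 0 ≤ s.Δ by linarith [hs.one_le_Δ])
      nlinarith [hs.one_le_Δ]
    · change 16 ≤ ζ * Fintype.card V
      nlinarith
  exact hC.exists_cycle good φ (fun _ _ => rfl) ℓ h3 hℓ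

end RainbowCycle

section BoundedColouring

variable {V : Type*} [Fintype V] [DecidableEq V]

lemma LBounded.card_filter_le {φ : Sym2 V → ℕ} {a : ℝ} (h : LBounded (⊤ : SimpleGraph V) φ a)
    (v : V) (c : ℕ) : (#(univ.filter fun u => u ≠ v ∧ φ s(v, u) = c) : ℝ) ≤ a := by
  convert h v c
  rw [← Set.ncard_coe_finset]
  congr 1
  ext u
  simp [ne_comm]

lemma GBounded.card_filter_le {φ : Sym2 V → ℕ} {a : ℝ} (h : GBounded (⊤ : SimpleGraph V) φ a)
    (c : ℕ) : (#(univ.filter fun p : V × V => p.1 ≠ p.2 ∧ φ s(p.1, p.2) = c) : ℝ) ≤ 2 * a := by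
  have h1 : #(univ.filter fun p : V × V => p.1 ≠ p.2 ∧ φ s(p.1, p.2) = c) ≤
      2 * #((univ.filter fun p : V × V => p.1 ≠ p.2 ∧ φ s(p.1, p.2) = c).image
        fun p => s(p.1, p.2)) := by
    refine card_le_mul_card_image _ 2 fun e _ => ?_
    induction e using Sym2.ind with
    | _ x y =>
      refine (card_le_card (t := {(x, y), (y, x)}) fun p hp => ?_).trans card_le_two
      have := (mem_filter.1 hp).2
      simpa [Prod.ext_iff] using this
  have h2 : ((univ.filter fun p : V × V => p.1 ≠ p.2 ∧ φ s(p.1, p.2) = c).image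
      fun p => s(p.1, p.2)).card ≤ (colourCls (⊤ : SimpleGraph V) φ c).ncard := by
    rw [← Set.ncard_coe_finset]
    refine Set.ncard_le_ncard (fun e he => ?_) (Set.toFinite _)
    obtain ⟨p, hp, rfl⟩ := mem_image.1 (mem_coe.1 he)
    exact ⟨by simpa using (mem_filter.1 hp).2.1, (mem_filter.1 hp).2.2⟩
  calc (#(univ.filter fun p : V × V => p.1 ≠ p.2 ∧ φ s(p.1, p.2) = c) : ℝ) ≤
      2 * ((colourCls (⊤ : SimpleGraph V) φ c).ncard : ℝ) := by
        exact_mod_cast h1.trans (Nat.mul_le_mul_left 2 h2)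
    _ ≤ 2 * a := by linarith [h c]

end BoundedColouring

lemma eventually_le_log_and_log_pow_le (M : ℝ) : ∃ n₀ : ℕ, ∀ n : ℕ, n₀ ≤ n →
    M ≤ Real.log n ∧ Real.log n ^ 4 ≤ n := by
  have h1 : ∀ᶠ x : ℝ in Filter.atTop, M ≤ Real.log x :=
    Real.tendsto_log_atTop.eventually_ge_atTop M
  have h2 : ∀ᶠ x : ℝ in Filter.atTop, ‖Real.log x ^ 4‖ ≤ 1 * ‖x‖ :=
    (Real.isLittleO_pow_log_id_atTop (n := 4)).bound one_pos
  obtain ⟨n₀, h⟩ := Filter.eventually_atTop.1 (tendsto_natCast_atTop_atTop.eventually (h1.and h2))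
  refine ⟨n₀, fun n hn => ⟨(h n hn).1, (le_abs_self _).trans ?_⟩⟩
  simpa using (h n hn).2

end

/-- Pancyclicity (Section 5.3): any `(1-ε)n/2`-bounded, locally `ηn/log⁴n`-bounded
edge-colouring of `K_n` contains a rainbow cycle of every length `3 ≤ ℓ ≤ n`. -/
theorem stmt_19 :
    ∀ ε : ℝ, 0 < ε →
    ∃ η : ℝ, 0 < η ∧ ∃ n₀ : ℕ, ∀ n : ℕ, n₀ ≤ n →
    ∀ φ : Sym2 (Fin n) → ℕ,
      GBounded (⊤ : SimpleGraph (Fin n)) φ ((1 - ε) * n / 2) →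
      LBounded (⊤ : SimpleGraph (Fin n)) φ (η * n / (Real.log n) ^ 4) →
      ∀ l : ℕ, 3 ≤ l → l ≤ n →
        ∃ (v : Fin n) (w : (⊤ : SimpleGraph (Fin n)).Walk v v),
          w.IsCycle ∧ w.length = l ∧ (w.edges.map φ).Nodup := by
  intro ε hε
  have hε₀ : 0 < min ε (1 / 2) := lt_min hε one_half_pos
  obtain ⟨n₀, h⟩ := eventually_le_log_and_log_pow_le
    (2 ^ 28 * (2 / (min ε (1 / 2) ^ 3 * (min ε (1 / 2) ^ 2 / 2000000) / 1000000)) ^ 8)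
  refine ⟨1, one_pos, n₀, fun n hn φ hG hL ℓ h3 hℓ => ?_⟩
  have hcard := Fintype.card_fin n
  obtain ⟨hlog, hpow⟩ := h n hn
  refine exists_rainbow_cycle_of_log_le hε₀ (min_le_right _ _) rfl rfl (by rwa [hcard])
    (by rwa [hcard]) φ (fun v c => ?_) (fun c => ?_) ℓ h3 (by rwa [hcard])
  · rw [hcard]
    simpa only [one_mul] using LBounded.card_filter_le hL v c
  · rw [hcard]
    have h1 := mul_le_mul_of_nonneg_right (min_le_left ε (1 / 2)) (Nat.cast_nonneg (α := ℝ) n)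
    linarith [GBounded.card_filter_le hG c]
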